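/- arXiv:2211.03678 — 8 statements merged into one kernel-verified Lean document; each statement's English description precedes it below -/
import Mathlib

section
/- Let F be a finite field with q elements, ψ a nontrivial additive character of F, n ≥ 1, and π an irreducible generic complex representation of GL_n(F). Then for every m > n and every c ∈ F^×: Σ_σ dim(σ) · ( Σ_{h ∈ GL_n(F)} J_{π,ψ}(h) · conj(J_{σ,ψ}(v_m(h))) ) · J_{σ,ψ}(c·I_m) = 0, where σ runs over the isomorphism classes of irreducible generic representations of GL_m(F), conj denotes complex conjugation, and for h ∈ GL_n(F), v_m(h) ∈ GL_m(F) denotes the block matrix with −I_{m−n} in the upper-right corner, h in the lower-left corner, and zero blocks elsewhere. -/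
noncomputable section

open scoped BigOperators

/-- The predicate of being an upper unitriangular matrix. -/
def IsUnipUpper {F : Type} [Field F] {N : ℕ} (u : Matrix (Fin N) (Fin N) F) : Prop :=
  (∀ i, u i i = 1) ∧ ∀ i j : Fin N, (j : ℕ) < (i : ℕ) → u i j = 0

/-- The extension of an additive character `ψ` to (unitriangular) matrices:
`u ↦ ψ (u 1 2 + u 2 3 + ⋯)`. -/
def psiU {F : Type} [Field F] (ψ : AddChar F ℂ) {N : ℕ} (u : Matrix (Fin N) (Fin N) F) : ℂ :=
  ψ (∑ i : Fin (N - 1),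
      u ⟨(i : ℕ), lt_of_lt_of_le i.isLt (Nat.sub_le N 1)⟩
        ⟨(i : ℕ) + 1, by have := i.isLt; omega⟩)

/-- A finite-dimensional complex (matrix) representation of `GL_N(F)`. -/
structure FinRep (N : ℕ) (F : Type) [Field F] where
  d : ℕ
  ρ : (Matrix (Fin N) (Fin N) F)ˣ →* (Matrix (Fin d) (Fin d) ℂ)ˣ

/-- Irreducibility: the space is nonzero and has no nontrivial invariant subspace. -/
def FinRep.Irreducible {N : ℕ} {F : Type} [Field F] (π : FinRep N F) : Prop :=
  0 < π.d ∧ ∀ W : Submodule ℂ (Fin π.d → ℂ),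
    (∀ g : (Matrix (Fin N) (Fin N) F)ˣ, ∀ v ∈ W,
        ((π.ρ g : Matrix (Fin π.d) (Fin π.d) ℂ)).mulVec v ∈ W) →
      W = ⊥ ∨ W = ⊤

/-- Genericity: there is a nonzero `ψ`-Whittaker functional. -/
def FinRep.Generic {N : ℕ} {F : Type} [Field F] (ψ : AddChar F ℂ) (π : FinRep N F) : Prop :=
  ∃ ℓ : (Fin π.d → ℂ) →ₗ[ℂ] ℂ, ℓ ≠ 0 ∧
    ∀ u : (Matrix (Fin N) (Fin N) F)ˣ, IsUnipUpper (u : Matrix (Fin N) (Fin N) F) →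
      ∀ v : Fin π.d → ℂ,
        ℓ (((π.ρ u : Matrix (Fin π.d) (Fin π.d) ℂ)).mulVec v) =
          psiU ψ (u : Matrix (Fin N) (Fin N) F) * ℓ v

/-- Isomorphism of two such representations. -/
def FinRep.Iso {N : ℕ} {F : Type} [Field F] (π σ : FinRep N F) : Prop :=
  ∃ e : (Fin π.d → ℂ) ≃ₗ[ℂ] (Fin σ.d → ℂ),
    ∀ (g : (Matrix (Fin N) (Fin N) F)ˣ) (v : Fin π.d → ℂ),
      e (((π.ρ g : Matrix (Fin π.d) (Fin π.d) ℂ)).mulVec v) =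
        ((σ.ρ g : Matrix (Fin σ.d) (Fin σ.d) ℂ)).mulVec (e v)

open scoped Classical in
/-- The set `U_N` of upper unitriangular matrices. -/
def unipFinset (F : Type) [Field F] [Fintype F] (N : ℕ) :
    Finset (Matrix (Fin N) (Fin N) F) :=
  Finset.univ.filter IsUnipUpper

open scoped Classical in
/-- The trace character of `π`, extended by zero to all matrices. -/
def traceChar {F : Type} [Field F] {N : ℕ} (π : FinRep N F) (A : Matrix (Fin N) (Fin N) F) : ℂ :=
  if h : IsUnit A then Matrix.trace ((π.ρ h.unit : Matrix (Fin π.d) (Fin π.d) ℂ)) else 0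

/-- The normalized Bessel function of `π` (S. I. Gelfand's formula), extended by zero to
all matrices. -/
def Bessel {F : Type} [Field F] [Fintype F] {N : ℕ}
    (ψ : AddChar F ℂ) (π : FinRep N F) (A : Matrix (Fin N) (Fin N) F) : ℂ :=
  ((unipFinset F N).card : ℂ)⁻¹ *
    ∑ u ∈ unipFinset F N, (psiU ψ u)⁻¹ * traceChar π (A * u)

/-- The `N × N` block matrix with `a·I_{N-M}` in the upper-right corner, an `M × M` matrix `h`
in the lower-left corner, and zero blocks elsewhere. -/
def cornerBlock (F : Type) [Field F] (N M : ℕ) (a : F) (h : Matrix (Fin M) (Fin M) F) :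
    Matrix (Fin N) (Fin N) F :=
  fun i j =>
    if (i : ℕ) < N - M then (if (j : ℕ) = (i : ℕ) + M then a else 0)
    else if hi : (i : ℕ) - (N - M) < M then
      (if hj : (j : ℕ) < M then h ⟨(i : ℕ) - (N - M), hi⟩ ⟨(j : ℕ), hj⟩ else 0)
    else 0

end

/-- For an injective self-map of `Fin N` all of whose descents are by one, the map is an affine
reflection along every interval bounded by an inversion, and a label which is constant along
descents is constant on such an interval. -/
theorem eq_of_inversion {N : ℕ} {X : Type*} {v : Fin N → Fin N} (hv : Function.Injective v)
    {t : Fin N → X}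
    (hd : ∀ i k : Fin N, (k : ℕ) = i + 1 → v k < v i → (v i : ℕ) = v k + 1 ∧ t k = t i)
    (d : ℕ) : ∀ p q : Fin N, (p : ℕ) = q + d → v p < v q → ∀ x : Fin N, q ≤ x → x ≤ p →
      (v x : ℕ) + x = v q + q ∧ t x = t q := by
  induction d with
  | zero =>
    intro p q hpq hlt
    have : p = q := Fin.ext hpq
    subst this
    exact absurd hlt (lt_irrefl _)
  | succ d ih =>
    intro p q hpq hlt x hqx hxp
    let q' : Fin N := ⟨q + 1, by omega⟩
    have hstep : v q' < v q := by
      by_contra hcon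
      -- the first position after `q` with value below that of `q`
      have hex : ∃ k : ℕ, ∃ h : k < N, (q : ℕ) < k ∧ v ⟨k, h⟩ < v q :=
        ⟨p, p.isLt, by omega, hlt⟩
      obtain ⟨k, ⟨hk, hqk, hvk⟩, hmin⟩ : ∃ k : ℕ,
          (∃ h : k < N, (q : ℕ) < k ∧ v ⟨k, h⟩ < v q) ∧
          ∀ l < k, ¬ ∃ h : l < N, (q : ℕ) < l ∧ v ⟨l, h⟩ < v q := by
        classical
        exact ⟨Nat.find hex, Nat.find_spec hex, fun l => Nat.find_min hex⟩
      let k' : Fin N := ⟨k - 1, by omega⟩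
      have hne : k ≠ q + 1 := by
        intro h
        apply hcon
        have : q' = ⟨k, hk⟩ := Fin.ext h.symm
        rw [this]
        exact hvk
      have hk1 : ¬ v k' < v q := by
        intro h
        exact hmin (k - 1) (by omega) ⟨by omega, by omega, h⟩
      have := (hd k' ⟨k, hk⟩ (by simp [k']; omega) (lt_of_lt_of_le hvk (not_lt.1 hk1))).1
      have heq : v k' = v q := by
        apply Fin.ext
        have h1 := Fin.lt_def.1 hvk
        have h2 := Fin.le_def.1 (not_lt.1 hk1)
        omega
      have := congrArg Fin.val (hv heq)
      simp only [k'] at this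
      omega
    obtain ⟨h1, h2⟩ := hd q q' rfl hstep
    rcases eq_or_lt_of_le hqx with rfl | hlx
    · exact ⟨rfl, rfl⟩
    have hq'x : q' ≤ x := Fin.le_def.2 (Nat.succ_le_of_lt (Fin.lt_def.1 hlx))
    rcases Nat.eq_zero_or_pos d with rfl | hd0
    · have : x = q' := le_antisymm (Fin.le_def.2 (by
        have := Fin.le_def.1 hxp; simp only [q']; omega)) hq'x
      rw [this]
      refine ⟨?_, h2⟩
      simp only [q'] at h1 ⊢
      omega
    · have hpne : v p ≠ v q' := fun h => by
        have := congrArg Fin.val (hv h)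
        simp only [q'] at this
        omega
      have hplt : v p < v q' := by
        have := Fin.val_ne_of_ne hpne
        have := Fin.lt_def.1 hlt
        exact Fin.lt_def.2 (by omega)
      obtain ⟨h3, h4⟩ := ih p q' (by simp only [q']; omega) hplt x hq'x hxp
      refine ⟨?_, h4.trans h2⟩
      simp only [q'] at h1 h3
      omega

/-- An injective self-map of `Fin N` all of whose descents are by one is an involution. -/
theorem involutive_of_descents {N : ℕ} {X : Type*} {v : Fin N → Fin N}
    (hv : Function.Injective v) {t : Fin N → X}
    (hd : ∀ i k : Fin N, (k : ℕ) = i + 1 → v k < v i → (v i : ℕ) = v k + 1 ∧ t k = t i)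
    (j : Fin N) : v (v j) = j ∧ t (v j) = t j := by
  rcases lt_trichotomy (v j) j with hlt | heq | hgt
  · obtain ⟨p, hpj, hjp⟩ : ∃ p, p < j ∧ j ≤ v p := by
      by_contra! hcon
      have hsub : (Finset.Iic j).image v ⊆ Finset.Iio j := by
        intro y hy
        obtain ⟨x, hx, rfl⟩ := Finset.mem_image.1 hy
        rcases eq_or_lt_of_le (Finset.mem_Iic.1 hx) with rfl | h
        · exact Finset.mem_Iio.2 hlt
        · exact Finset.mem_Iio.2 (hcon x h)
      have := Finset.card_le_card hsub
      rw [Finset.card_image_of_injective _ hv] at this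
      simp at this
    have hinv := eq_of_inversion hv hd (j - p) j p (by have := Fin.lt_def.1 hpj; omega)
      (lt_of_lt_of_le hlt hjp)
    have hj := hinv j hpj.le le_rfl
    have hx := hinv (v j) (Fin.le_def.2 (by
      have := Fin.le_def.1 hjp; omega)) hlt.le
    exact ⟨Fin.ext (by omega), hx.2.trans hj.2.symm⟩
  · simp [heq]
  · obtain ⟨p, hpj, hjp⟩ : ∃ p, j < p ∧ v p ≤ j := by
      by_contra! hcon
      have hsub : (Finset.Ici j).image v ⊆ Finset.Ioi j := by
        intro y hy
        obtain ⟨x, hx, rfl⟩ := Finset.mem_image.1 hy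
        rcases eq_or_lt_of_le (Finset.mem_Ici.1 hx) with rfl | h
        · exact Finset.mem_Ioi.2 hgt
        · exact Finset.mem_Ioi.2 (hcon x h)
      have := Finset.card_le_card hsub
      rw [Finset.card_image_of_injective _ hv] at this
      simp at this
      omega
    have hinv := eq_of_inversion hv hd (p - j) p j (by have := Fin.lt_def.1 hpj; omega)
      (lt_of_le_of_lt hjp hgt)
    have hp := hinv p hpj.le le_rfl
    have hx := hinv (v j) hgt.le (Fin.le_def.2 (by
      have := Fin.le_def.1 hjp; omega))
    exact ⟨Fin.ext (by omega), hx.2⟩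

section Unipotent

open Matrix

variable {F : Type} [Field F] {N : ℕ}

theorem IsUnipUpper.one : IsUnipUpper (1 : Matrix (Fin N) (Fin N) F) :=
  ⟨fun i => one_apply_eq i, fun _ _ h => one_apply_ne fun e => by simp [e] at h⟩

theorem IsUnipUpper.mul {u u' : Matrix (Fin N) (Fin N) F} (h : IsUnipUpper u)
    (h' : IsUnipUpper u') : IsUnipUpper (u * u') := by
  refine ⟨fun i => ?_, fun i j hij => ?_⟩
  · rw [mul_apply, Finset.sum_eq_single i]
    · rw [h.1, h'.1, one_mul]
    · intro k _ hk
      rcases lt_or_gt_of_ne (Fin.val_ne_of_ne hk) with hlt | hlt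
      · rw [h.2 _ _ hlt, zero_mul]
      · rw [h'.2 _ _ hlt, mul_zero]
    · simp
  · rw [mul_apply]
    refine Finset.sum_eq_zero fun k _ => ?_
    rcases lt_or_ge (k : ℕ) (i : ℕ) with hlt | hle
    · rw [h.2 _ _ hlt, zero_mul]
    · rw [h'.2 _ _ (by omega), mul_zero]

theorem IsUnipUpper.isUnit {u : Matrix (Fin N) (Fin N) F} (h : IsUnipUpper u) : IsUnit u := by
  rw [isUnit_iff_isUnit_det, det_of_isUpperTriangular]
  · simp [h.1]
  · intro i j hij
    exact h.2 i j hij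

theorem IsUnipUpper.mul_apply_succ {u u' : Matrix (Fin N) (Fin N) F} (h : IsUnipUpper u)
    (h' : IsUnipUpper u') {i j : Fin N} (hij : (j : ℕ) = i + 1) :
    (u * u') i j = u i j + u' i j := by
  have hne : i ≠ j := fun e => by simp [e] at hij
  rw [mul_apply, ← Finset.sum_subset (Finset.subset_univ {i, j}), Finset.sum_pair hne, h.1, h'.1,
    one_mul, mul_one, add_comm]
  intro k _ hk
  simp only [Finset.mem_insert, Finset.mem_singleton, not_or] at hk
  have h1 := Fin.val_ne_of_ne hk.1
  have h2 := Fin.val_ne_of_ne hk.2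
  rcases lt_or_ge (k : ℕ) (i : ℕ) with hlt | hle
  · rw [h.2 _ _ hlt, zero_mul]
  · rw [h'.2 _ _ (by omega), mul_zero]

theorem psiU_mul (ψ : AddChar F ℂ) {u u' : Matrix (Fin N) (Fin N) F} (h : IsUnipUpper u)
    (h' : IsUnipUpper u') : psiU ψ (u * u') = psiU ψ u * psiU ψ u' := by
  unfold psiU
  rw [← AddChar.map_add_eq_mul, ← Finset.sum_add_distrib]
  congr 1
  exact Finset.sum_congr rfl fun i _ => h.mul_apply_succ h' rfl

theorem psiU_ne_zero (ψ : AddChar F ℂ) (u : Matrix (Fin N) (Fin N) F) : psiU ψ u ≠ 0 :=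
  (ψ.val_isUnit _).ne_zero

theorem IsUnipUpper.transvection {a b : Fin N} (hab : a < b) (x : F) :
    IsUnipUpper (transvection a b x) := by
  refine ⟨fun i => ?_, fun i j hij => ?_⟩
  · have : ¬ (a = i ∧ b = i) := fun h => hab.ne (h.1.trans h.2.symm)
    simp [Matrix.transvection, this]
  · have h1 : i ≠ j := fun e => by simp [e] at hij
    have h2 : ¬ (a = i ∧ b = j) := fun h => by
      rw [← h.1, ← h.2] at hij
      exact lt_asymm hij hab
    simp [Matrix.transvection, h1, h2]

theorem psiU_transvection (ψ : AddChar F ℂ) (a b : Fin N) (x : F) :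
    psiU ψ (transvection a b x) = if (b : ℕ) = a + 1 then ψ x else 1 := by
  unfold psiU
  split_ifs with h
  · congr 1
    rw [Finset.sum_eq_single ⟨a, by omega⟩]
    · simp [h, Matrix.transvection, one_apply, single_apply, Fin.ext_iff]
    · intro i _ hi
      have h1 : (a : ℕ) ≠ i := fun e => hi (Fin.ext e.symm)
      simp [Matrix.transvection, one_apply, Fin.ext_iff, h1]
    · simp
  · rw [Finset.sum_eq_zero, AddChar.map_zero_eq_one]
    intro i _
    have h1 : ¬ ((a : ℕ) = i ∧ (b : ℕ) = i + 1) := fun e => h (by omega)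
    simp [Matrix.transvection, one_apply, Fin.ext_iff, h1]

/-- Reflection of a square matrix in its antidiagonal. -/
def antiTranspose {R : Type*} {N : ℕ} (A : Matrix (Fin N) (Fin N) R) :
    Matrix (Fin N) (Fin N) R :=
  Aᵀ.submatrix Fin.rev Fin.rev

theorem antiTranspose_apply {R : Type*} {N : ℕ} (A : Matrix (Fin N) (Fin N) R) (i j : Fin N) :
    antiTranspose A i j = A j.rev i.rev := rfl

theorem antiTranspose_mul (A B : Matrix (Fin N) (Fin N) F) :
    antiTranspose (A * B) = antiTranspose B * antiTranspose A := by
  ext i j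
  simp only [antiTranspose_apply, mul_apply]
  rw [← Equiv.sum_comp Fin.revPerm]
  exact Finset.sum_congr rfl fun k _ => mul_comm _ _

theorem antiTranspose_antiTranspose {R : Type*} {N : ℕ} (A : Matrix (Fin N) (Fin N) R) :
    antiTranspose (antiTranspose A) = A := by
  ext i j
  simp [antiTranspose_apply]

theorem IsUnipUpper.antiTranspose {u : Matrix (Fin N) (Fin N) F} (h : IsUnipUpper u) :
    IsUnipUpper (antiTranspose u) := by
  refine ⟨fun i => h.1 _, fun i j hij => h.2 _ _ ?_⟩
  simp only [Fin.val_rev]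
  omega

theorem psiU_antiTranspose (ψ : AddChar F ℂ) (u : Matrix (Fin N) (Fin N) F) :
    psiU ψ (antiTranspose u) = psiU ψ u := by
  unfold psiU
  congr 1
  rw [← Equiv.sum_comp Fin.revPerm]
  refine Finset.sum_congr rfl fun i _ => ?_
  rw [antiTranspose_apply]
  congr 1 <;> apply Fin.ext <;> simp only [Fin.revPerm_apply, Fin.val_rev] <;> omega

/-- Clearing a column above and a row to the right of a pivot by unitriangular matrices. -/
theorem exists_clear_pivot (g : Matrix (Fin N) (Fin N) F) {i k : Fin N} (hik : g i k ≠ 0)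
    (hcol : ∀ a, i < a → g a k = 0) (hrow : ∀ b, b < k → g i b = 0) :
    ∃ u u' : Matrix (Fin N) (Fin N) F, IsUnipUpper u ∧ IsUnipUpper u' ∧
      ∀ a b, (u * g * u') a b =
        if a = i then (if b = k then g i k else 0)
        else if b = k then 0 else g a b - g a k * g i b / g i k := by
  let x : Fin N → F := fun a => if a = i then 0 else g a k / g i k
  let y : Fin N → F := fun b => if b = k then 0 else g i b / g i k
  have hx : ∀ a b : Fin N, (1 - vecMulVec x (Pi.single i 1) : Matrix (Fin N) (Fin N) F) a b =
      (1 : Matrix (Fin N) (Fin N) F) a b - x a * (Pi.single i 1 : Fin N → F) b := fun a b => by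
    rw [Matrix.sub_apply, vecMulVec_apply]
  have hy : ∀ a b : Fin N, (1 - vecMulVec (Pi.single k 1) y : Matrix (Fin N) (Fin N) F) a b =
      (1 : Matrix (Fin N) (Fin N) F) a b - (Pi.single k 1 : Fin N → F) a * y b := fun a b => by
    rw [Matrix.sub_apply, vecMulVec_apply]
  refine ⟨1 - vecMulVec x (Pi.single i 1), 1 - vecMulVec (Pi.single k 1) y,
    ⟨fun a => ?_, fun a b hab => ?_⟩, ⟨fun a => ?_, fun a b hab => ?_⟩, fun a b => ?_⟩
  · rw [hx]
    by_cases h : a = i <;> simp [x, h]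
  · rw [hx, one_apply_ne (fun e => by simp [e] at hab)]
    by_cases h : b = i
    · subst h
      have : a ≠ b := fun e => by simp [e] at hab
      simp [x, hcol a hab]
    · simp [h]
  · rw [hy]
    by_cases h : a = k <;> simp [y, h]
  · rw [hy, one_apply_ne (fun e => by simp [e] at hab)]
    by_cases h : a = k
    · subst h
      have : b ≠ a := fun e => by simp [e] at hab
      simp [y, hrow b hab]
    · simp [h]
  · have h1 : ∀ a b, ((1 - vecMulVec x (Pi.single i 1)) * g) a b = g a b - x a * g i b := by
      intro a b
      simp [Matrix.sub_mul, vecMulVec_mul, vecMulVec_apply]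
    have h2 : ∀ (B : Matrix (Fin N) (Fin N) F) a b,
        (B * (1 - vecMulVec (Pi.single k 1) y)) a b = B a b - B a k * y b := by
      intro B a b
      simp [Matrix.mul_sub, mul_vecMulVec, vecMulVec_apply]
    rw [h2, h1, h1]
    by_cases ha : a = i <;> by_cases hb : b = k
    · simp [x, y, ha, hb]
    · simp only [x, y, ha, hb, if_true, if_false]
      field_simp
      ring
    · simp only [x, y, ha, hb, if_true, if_false]
      field_simp
      ring
    · simp only [x, y, ha, hb, if_false]
      field_simp
      ring

/-- The entry `(i, j)` is nonzero and is the only nonzero entry in its row and its column. -/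
def IsIsolated (g : Matrix (Fin N) (Fin N) F) (i j : Fin N) : Prop :=
  g i j ≠ 0 ∧ (∀ a, a ≠ i → g a j = 0) ∧ ∀ b, b ≠ j → g i b = 0

theorem injective_of_isIsolated {g : Matrix (Fin N) (Fin N) F} {w : Fin N → Fin N}
    (hw : ∀ j, IsIsolated g (w j) j) : Function.Injective w := fun j k hjk => by
  by_contra hcon
  exact (hw j).1 ((hjk ▸ (hw k).2.2 j hcon))

theorem exists_isIsolated_antiTranspose {g : Matrix (Fin N) (Fin N) F}
    (hg : ∀ j, ∃ i, IsIsolated g i j) (j : Fin N) : ∃ i, IsIsolated (antiTranspose g) i j := by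
  choose w hw using hg
  obtain ⟨k, hk⟩ := Finite.surjective_of_injective (injective_of_isIsolated hw) j.rev
  have h := hw k
  rw [hk] at h
  refine ⟨k.rev, ?_, fun a ha => ?_, fun b hb => ?_⟩
  · rw [antiTranspose_apply, Fin.rev_rev]
    exact h.1
  · rw [antiTranspose_apply]
    exact h.2.2 _ fun e => ha (by rw [← e, Fin.rev_rev])
  · rw [antiTranspose_apply, Fin.rev_rev]
    exact h.2.1 _ fun e => hb (Fin.rev_injective e)

/-- Bruhat decomposition: an invertible matrix is monomial up to unitriangular matrices. -/
theorem exists_monomial {g : Matrix (Fin N) (Fin N) F} (hg : IsUnit g) :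
    ∃ u u' : Matrix (Fin N) (Fin N) F, IsUnipUpper u ∧ IsUnipUpper u' ∧
      ∀ j, ∃ i, IsIsolated (u * g * u') i j := by
  suffices H : ∀ k : ℕ, k ≤ N → ∃ u u' : Matrix (Fin N) (Fin N) F,
      IsUnipUpper u ∧ IsUnipUpper u' ∧ ∀ j : Fin N, (j : ℕ) < k →
        ∃ i, IsIsolated (u * g * u') i j by
    obtain ⟨u, u', hu, hu', h⟩ := H N le_rfl
    exact ⟨u, u', hu, hu', fun j => h j j.isLt⟩
  intro k
  induction k with
  | zero => exact fun _ => ⟨1, 1, .one, .one, fun j hj => absurd hj (Nat.not_lt_zero _)⟩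
  | succ k ih =>
    intro hk
    obtain ⟨u, u', hu, hu', h⟩ := ih (by omega)
    set A := u * g * u' with hA
    have hAunit : IsUnit A := (hu.isUnit.mul hg).mul hu'.isUnit
    let c : Fin N := ⟨k, hk⟩
    obtain ⟨i, hic, himax⟩ : ∃ i, A i c ≠ 0 ∧ ∀ a, i < a → A a c = 0 := by
      classical
      have hne : (Finset.univ.filter fun a => A a c ≠ 0).Nonempty := by
        rw [Finset.nonempty_iff_ne_empty]
        intro hemp
        have h0 : ∀ a, A a c = 0 := fun a => by
          by_contra hcon
          have : a ∈ Finset.univ.filter fun a => A a c ≠ 0 := by simp [hcon]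
          rw [hemp] at this
          exact absurd this (Finset.notMem_empty _)
        exact ((isUnit_iff_isUnit_det A).1 hAunit).ne_zero (det_eq_zero_of_column_eq_zero c h0)
      refine ⟨_, (Finset.mem_filter.1 (Finset.max'_mem _ hne)).2, fun a ha => ?_⟩
      by_contra hcon
      exact absurd (Finset.le_max' _ a (by simp [hcon])) (not_le.2 ha)
    have hrow : ∀ b, b < c → A i b = 0 := by
      intro b hb
      obtain ⟨r, hr⟩ := h b hb
      by_contra hcon
      have : i = r := by
        by_contra hir
        exact hcon (hr.2.1 i hir)
      subst this
      exact hic (hr.2.2 c hb.ne')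
    obtain ⟨w, w', hw, hw', hww⟩ := exists_clear_pivot A hic himax hrow
    have hprod : w * u * g * (u' * w') = w * A * w' := by simp only [hA, Matrix.mul_assoc]
    refine ⟨w * u, u' * w', hw.mul hu, hu'.mul hw', fun j hj => ?_⟩
    rw [hprod]
    rcases Nat.lt_succ_iff_lt_or_eq.1 hj with hj | hj
    · obtain ⟨r, hr⟩ := h j hj
      have hjc : j ≠ c := fun e => by simp [e, c] at hj
      have hri : r ≠ i := fun e => hr.1 (e ▸ hrow j hj)
      have hrc : A r c = 0 := hr.2.2 c hjc.symm
      have hij : A i j = 0 := hr.2.1 i hri.symm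
      refine ⟨r, ?_, fun a ha => ?_, fun b hb => ?_⟩
      · rw [hww, if_neg hri, if_neg hjc, hij]
        simpa using hr.1
      · rw [hww, if_neg hjc, hr.2.1 a ha, hij]
        simp
      · rw [hww, if_neg hri, hr.2.2 b hb, hrc]
        simp
    · have hjc : j = c := Fin.ext hj
      subst hjc
      refine ⟨i, ?_, fun a ha => ?_, fun b hb => ?_⟩
      · rw [hww]
        simpa using hic
      · rw [hww, if_neg ha, if_pos rfl]
      · rw [hww, if_pos rfl, if_neg hb]

end Unipotent

section Hecke

open Matrix

noncomputable section

variable {F : Type} [Field F] {N : ℕ}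

open scoped Classical in
/-- The multiplicative map from matrices to the group algebra of the general linear group which
vanishes on singular matrices. -/
def matOf (F : Type) [Field F] (N : ℕ) :
    Matrix (Fin N) (Fin N) F →* MonoidAlgebra ℂ (Matrix (Fin N) (Fin N) F)ˣ where
  toFun A := if h : IsUnit A then MonoidAlgebra.of ℂ _ h.unit else 0
  map_one' := by
    rw [dif_pos isUnit_one, ← map_one (MonoidAlgebra.of ℂ (Matrix (Fin N) (Fin N) F)ˣ)]
    congr 1
    exact Units.ext rfl
  map_mul' A B := by
    by_cases hA : IsUnit A
    · by_cases hB : IsUnit B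
      · rw [dif_pos hA, dif_pos hB, dif_pos (hA.mul hB), ← map_mul]
        congr 1
        exact Units.ext rfl
      · rw [dif_neg hB, mul_zero, dif_neg]
        rw [isUnit_iff_isUnit_det] at hB ⊢
        rw [det_mul]
        exact fun h => hB (isUnit_of_mul_isUnit_right h)
    · rw [dif_neg hA, zero_mul, dif_neg]
      rw [isUnit_iff_isUnit_det] at hA ⊢
      rw [det_mul]
      exact fun h => hA (isUnit_of_mul_isUnit_left h)

theorem matOf_units (g : (Matrix (Fin N) (Fin N) F)ˣ) :
    matOf F N g = MonoidAlgebra.of ℂ _ g := by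
  classical
  refine (dif_pos g.isUnit).trans ?_
  congr 1
  exact Units.ext rfl

variable [Fintype F]

theorem mem_unipFinset {u : Matrix (Fin N) (Fin N) F} :
    u ∈ unipFinset F N ↔ IsUnipUpper u := by
  simp [unipFinset]

theorem card_unipFinset_ne_zero : ((unipFinset F N).card : ℂ) ≠ 0 :=
  Nat.cast_ne_zero.2 (Finset.card_ne_zero_of_mem (mem_unipFinset.2 .one))

theorem sum_unipFinset_comp {M : Type*} [AddCommMonoid M]
    {s : Matrix (Fin N) (Fin N) F → Matrix (Fin N) (Fin N) F} (hs : Function.Injective s)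
    (hu : ∀ u, IsUnipUpper u → IsUnipUpper (s u)) (f : Matrix (Fin N) (Fin N) F → M) :
    ∑ u ∈ unipFinset F N, f (s u) = ∑ u ∈ unipFinset F N, f u := by
  have hmaps : Set.MapsTo s (unipFinset F N) (unipFinset F N) := fun u h =>
    mem_unipFinset.2 (hu u (mem_unipFinset.1 h))
  exact Finset.sum_nbij s hmaps hs.injOn
    (Finset.surjOn_of_injOn_of_card_le s hmaps hs.injOn le_rfl) fun _ _ => rfl

/-- The idempotent of the group algebra projecting to the `ψ`-equivariant vectors of the
unitriangular group. -/
def whittakerIdem (ψ : AddChar F ℂ) (N : ℕ) : MonoidAlgebra ℂ (Matrix (Fin N) (Fin N) F)ˣ :=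
  ((unipFinset F N).card : ℂ)⁻¹ • ∑ u ∈ unipFinset F N, (psiU ψ u)⁻¹ • matOf F N u

theorem whittakerIdem_mul_matOf (ψ : AddChar F ℂ) {w : Matrix (Fin N) (Fin N) F}
    (hw : IsUnipUpper w) :
    whittakerIdem ψ N * matOf F N w = psiU ψ w • whittakerIdem ψ N := by
  unfold whittakerIdem
  have h := sum_unipFinset_comp (s := fun u => u * w) hw.isUnit.mul_left_injective
    (fun u hu => hu.mul hw) fun u => (psiU ψ u)⁻¹ • matOf F N u
  rw [smul_mul_assoc, smul_comm (psiU ψ w), Finset.sum_mul, ← h]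
  congr 1
  rw [Finset.smul_sum]
  refine Finset.sum_congr rfl fun u hu => ?_
  rw [psiU_mul ψ (mem_unipFinset.1 hu) hw, map_mul, smul_mul_assoc, smul_smul, _root_.mul_inv_rev,
    mul_inv_cancel_left₀ (psiU_ne_zero ψ w)]

theorem matOf_mul_whittakerIdem (ψ : AddChar F ℂ) {w : Matrix (Fin N) (Fin N) F}
    (hw : IsUnipUpper w) :
    matOf F N w * whittakerIdem ψ N = psiU ψ w • whittakerIdem ψ N := by
  unfold whittakerIdem
  have h := sum_unipFinset_comp (s := fun u => w * u) hw.isUnit.mul_right_injective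
    (fun u hu => hw.mul hu) fun u => (psiU ψ u)⁻¹ • matOf F N u
  rw [mul_smul_comm, smul_comm (psiU ψ w), Finset.mul_sum, ← h]
  congr 1
  rw [Finset.smul_sum]
  refine Finset.sum_congr rfl fun u hu => ?_
  rw [psiU_mul ψ hw (mem_unipFinset.1 hu), map_mul, mul_smul_comm, smul_smul, mul_inv,
    mul_inv_cancel_left₀ (psiU_ne_zero ψ w)]

theorem whittakerIdem_mul_self (ψ : AddChar F ℂ) :
    whittakerIdem ψ N * whittakerIdem ψ N = whittakerIdem ψ N := by
  conv_lhs => enter [2]; unfold whittakerIdem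
  rw [mul_smul_comm, Finset.mul_sum, Finset.sum_congr rfl (g := fun _ => whittakerIdem ψ N),
    Finset.sum_const, ← Nat.cast_smul_eq_nsmul ℂ, smul_smul,
    inv_mul_cancel₀ card_unipFinset_ne_zero, one_smul]
  intro u hu
  rw [mul_smul_comm, whittakerIdem_mul_matOf ψ (mem_unipFinset.1 hu), smul_smul,
    inv_mul_cancel₀ (psiU_ne_zero ψ u), one_smul]

theorem whittakerIdem_sandwich_mul (ψ : AddChar F ℂ) {u u' : Matrix (Fin N) (Fin N) F}
    (hu : IsUnipUpper u) (hu' : IsUnipUpper u') (g : Matrix (Fin N) (Fin N) F) :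
    whittakerIdem ψ N * matOf F N (u * g * u') * whittakerIdem ψ N =
      (psiU ψ u * psiU ψ u') • (whittakerIdem ψ N * matOf F N g * whittakerIdem ψ N) := by
  rw [map_mul, map_mul, ← mul_assoc, ← mul_assoc, whittakerIdem_mul_matOf ψ hu, mul_assoc,
    matOf_mul_whittakerIdem ψ hu', mul_smul_comm, smul_mul_assoc, smul_mul_assoc, smul_smul,
    mul_comm (psiU ψ u')]

/-- A monomial matrix supporting a bi-equivariant function is symmetric about the antidiagonal. -/
theorem antiTranspose_eq_of_sandwich_ne_zero {ψ : AddChar F ℂ} (hψ : ψ ≠ 1)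
    {g : Matrix (Fin N) (Fin N) F} (hmon : ∀ j, ∃ i, IsIsolated g i j)
    (hne : whittakerIdem ψ N * matOf F N g * whittakerIdem ψ N ≠ 0) : antiTranspose g = g := by
  choose w hw using hmon
  have hinj := injective_of_isIsolated hw
  have hg : ∀ i j, g i j = if i = w j then g (w j) j else 0 := fun i j => by
    split_ifs with h
    · rw [h]
    · exact (hw j).2.1 i h
  have key : ∀ i k : Fin N, (k : ℕ) = i + 1 → w i < w k →
      (w k : ℕ) = w i + 1 ∧ g (w k) k = g (w i) i := by
    intro i k hik hlt
    have hik' : i < k := Fin.lt_def.2 (by omega)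
    have hcomm : ∀ x, transvection (w i) (w k) (x * g (w i) i / g (w k) k) * g =
        g * transvection i k x := by
      intro x
      ext a b
      have hk0 := (hw k).1
      by_cases ha : a = w i <;> by_cases hb : b = k
      · subst ha hb
        rw [transvection_mul_apply_same, mul_transvection_apply_same]
        field_simp
      · subst ha
        rw [transvection_mul_apply_same, mul_transvection_apply_of_ne _ _ _ _ hb,
          (hw k).2.2 b hb, mul_zero, add_zero]
      · subst hb
        rw [transvection_mul_apply_of_ne _ _ _ _ ha, mul_transvection_apply_same,
          (hw i).2.1 a ha, mul_zero, add_zero]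
      · rw [transvection_mul_apply_of_ne _ _ _ _ ha, mul_transvection_apply_of_ne _ _ _ _ hb]
    have hpsi : ∀ x, psiU ψ (transvection (w i) (w k) (x * g (w i) i / g (w k) k)) = ψ x := by
      intro x
      have h1 := whittakerIdem_sandwich_mul ψ
        (IsUnipUpper.transvection hlt (x * g (w i) i / g (w k) k)) .one g
      have h2 := whittakerIdem_sandwich_mul ψ .one (IsUnipUpper.transvection hik' x) g
      rw [mul_one, hcomm] at h1
      rw [one_mul, h1] at h2
      have h3 := smul_left_injective ℂ hne h2
      have h4 : psiU ψ (1 : Matrix (Fin N) (Fin N) F) ≠ 0 := psiU_ne_zero ψ _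
      simp only [mul_comm _ (psiU ψ (1 : Matrix (Fin N) (Fin N) F))] at h3
      rw [mul_right_inj' h4, psiU_transvection ψ i k, if_pos hik] at h3
      exact h3
    have hsucc : (w k : ℕ) = w i + 1 := by
      by_contra hcon
      apply hψ
      ext x
      rw [← hpsi x, psiU_transvection ψ, if_neg hcon, AddChar.one_apply]
    refine ⟨hsucc, ?_⟩
    by_contra hcon
    have hr : g (w i) i / g (w k) k - 1 ≠ 0 := by
      rw [sub_ne_zero, Ne, div_eq_one_iff_eq (hw k).1]
      exact fun h => hcon h.symm
    apply hψ
    ext y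
    have h1 := hpsi (y / (g (w i) i / g (w k) k - 1))
    rw [psiU_transvection ψ, if_pos hsucc] at h1
    have h2 : y / (g (w i) i / g (w k) k - 1) * g (w i) i / g (w k) k =
        y + y / (g (w i) i / g (w k) k - 1) := by
      rw [mul_div_assoc]
      generalize g (w i) i / g (w k) k = r at hr ⊢
      field_simp
      ring
    rw [h2, AddChar.map_add_eq_mul] at h1
    rw [AddChar.one_apply]
    exact mul_right_cancel₀ (ψ.val_isUnit _).ne_zero (h1.trans (one_mul _).symm)
  have hinv := involutive_of_descents (v := fun j => (w j).rev) (t := fun j => g (w j) j)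
    (Fin.rev_injective.comp hinj) (fun i k hik hlt => by
      have hlt' : w i < w k := Fin.rev_lt_rev.1 hlt
      obtain ⟨h1, h2⟩ := key i k hik hlt'
      refine ⟨?_, h2⟩
      simp only [Fin.val_rev]
      omega)
  ext i j
  rw [antiTranspose_apply, hg j.rev, hg i]
  have h1 : j.rev = w i.rev ↔ i = w j := by
    constructor
    · intro h
      have h2 := (hinv i.rev).1
      simp only [← h, Fin.rev_rev] at h2
      exact (Fin.rev_injective h2).symm
    · intro h
      have h2 := (hinv j).1
      simp only [← h] at h2
      rw [← h2, Fin.rev_rev]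
  by_cases h : i = w j
  · rw [if_pos h, if_pos (h1.2 h)]
    have := (hinv j).2
    simp only [← h] at this
    rw [← h]
    exact this
  · rw [if_neg h, if_neg fun h' => h (h1.1 h')]

theorem whittakerIdem_sandwich_antiTranspose {ψ : AddChar F ℂ} (hψ : ψ ≠ 1)
    {g : Matrix (Fin N) (Fin N) F} (hg : IsUnit g) :
    whittakerIdem ψ N * matOf F N (antiTranspose g) * whittakerIdem ψ N =
      whittakerIdem ψ N * matOf F N g * whittakerIdem ψ N := by
  obtain ⟨u, u', hu, hu', hmon⟩ := exists_monomial hg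
  have h1 := whittakerIdem_sandwich_mul ψ hu hu' g
  have h2 := whittakerIdem_sandwich_mul ψ hu'.antiTranspose hu.antiTranspose (antiTranspose g)
  rw [← antiTranspose_mul, ← antiTranspose_mul, ← mul_assoc, psiU_antiTranspose,
    psiU_antiTranspose, mul_comm (psiU ψ u')] at h2
  have h0 : psiU ψ u * psiU ψ u' ≠ 0 := mul_ne_zero (psiU_ne_zero ψ u) (psiU_ne_zero ψ u')
  by_cases hz : whittakerIdem ψ N * matOf F N (u * g * u') * whittakerIdem ψ N = 0
  · have hz1 : whittakerIdem ψ N * matOf F N g * whittakerIdem ψ N = 0 :=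
      (smul_eq_zero.1 (h1.symm.trans hz)).resolve_left h0
    rw [hz1]
    by_contra hcon
    have h3 := antiTranspose_eq_of_sandwich_ne_zero hψ (exists_isIsolated_antiTranspose hmon)
      (h2.symm ▸ smul_ne_zero h0 hcon)
    rw [antiTranspose_antiTranspose] at h3
    rw [← h3, hz] at h2
    exact smul_ne_zero h0 hcon h2.symm
  · rw [antiTranspose_eq_of_sandwich_ne_zero hψ hmon hz, h1] at h2
    exact (smul_right_injective _ h0 h2).symm

/-- The Gelfand–Graev Hecke algebra is commutative. -/
theorem whittakerIdem_sandwich_commute {ψ : AddChar F ℂ} (hψ : ψ ≠ 1)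
    (g h : (Matrix (Fin N) (Fin N) F)ˣ) :
    Commute (whittakerIdem ψ N * MonoidAlgebra.of ℂ _ g * whittakerIdem ψ N)
      (whittakerIdem ψ N * MonoidAlgebra.of ℂ _ h * whittakerIdem ψ N) := by
  have expand : ∀ A B : Matrix (Fin N) (Fin N) F,
      (whittakerIdem ψ N * matOf F N A * whittakerIdem ψ N) *
        (whittakerIdem ψ N * matOf F N B * whittakerIdem ψ N) =
      ((unipFinset F N).card : ℂ)⁻¹ • ∑ u ∈ unipFinset F N, (psiU ψ u)⁻¹ •
        (whittakerIdem ψ N * matOf F N (A * u * B) * whittakerIdem ψ N) := by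
    intro A B
    have h1 : (whittakerIdem ψ N * matOf F N A * whittakerIdem ψ N) *
        (whittakerIdem ψ N * matOf F N B * whittakerIdem ψ N) =
        whittakerIdem ψ N * matOf F N A * whittakerIdem ψ N *
          (matOf F N B * whittakerIdem ψ N) := by
      rw [mul_assoc (whittakerIdem ψ N) (matOf F N B), ← mul_assoc _ (whittakerIdem ψ N),
        mul_assoc _ (whittakerIdem ψ N) (whittakerIdem ψ N), whittakerIdem_mul_self]
    have h2 : whittakerIdem ψ N * matOf F N A * whittakerIdem ψ N =
        ((unipFinset F N).card : ℂ)⁻¹ • ∑ u ∈ unipFinset F N, (psiU ψ u)⁻¹ •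
          (whittakerIdem ψ N * matOf F N (A * u)) := by
      conv_lhs => enter [2]; unfold whittakerIdem
      simp only [mul_smul_comm, Finset.mul_sum, map_mul, mul_assoc]
    rw [h1, h2]
    simp only [smul_mul_assoc, Finset.sum_mul, map_mul, mul_assoc]
  have hs : Function.Injective (antiTranspose : Matrix (Fin N) (Fin N) F → _) :=
    Function.LeftInverse.injective antiTranspose_antiTranspose
  rw [← matOf_units, ← matOf_units, Commute, SemiconjBy, expand]
  conv_rhs => rw [← whittakerIdem_sandwich_antiTranspose hψ g.isUnit,
    ← whittakerIdem_sandwich_antiTranspose hψ h.isUnit, expand]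
  rw [← sum_unipFinset_comp hs (fun u hu => hu.antiTranspose) fun u => (psiU ψ u)⁻¹ •
    (whittakerIdem ψ N * matOf F N (antiTranspose (h : Matrix (Fin N) (Fin N) F) * u *
      antiTranspose (g : Matrix (Fin N) (Fin N) F)) * whittakerIdem ψ N)]
  refine congrArg _ (Finset.sum_congr rfl fun u hu => ?_)
  rw [psiU_antiTranspose, ← antiTranspose_mul, ← antiTranspose_mul, ← mul_assoc,
    whittakerIdem_sandwich_antiTranspose hψ
      ((g.isUnit.mul (mem_unipFinset.1 hu).isUnit).mul h.isUnit)]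

end

end Hecke

section Representations

open Matrix

noncomputable section

variable {F : Type} [Field F] {N : ℕ}

/-- The action of the group algebra in a representation. -/
def FinRep.alg (π : FinRep N F) :
    MonoidAlgebra ℂ (Matrix (Fin N) (Fin N) F)ˣ →ₐ[ℂ] Matrix (Fin π.d) (Fin π.d) ℂ :=
  MonoidAlgebra.lift ℂ (Matrix (Fin π.d) (Fin π.d) ℂ) (Matrix (Fin N) (Fin N) F)ˣ
    ((Units.coeHom _).comp π.ρ)

theorem FinRep.alg_of (π : FinRep N F) (g : (Matrix (Fin N) (Fin N) F)ˣ) :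
    π.alg (MonoidAlgebra.of ℂ _ g) = π.ρ g := by
  unfold FinRep.alg
  rw [MonoidAlgebra.lift_of]
  rfl

theorem FinRep.Irreducible.mem_of_invariant {π : FinRep N F} (hπ : π.Irreducible)
    {W : Submodule ℂ (Fin π.d → ℂ)}
    (hW : ∀ g : (Matrix (Fin N) (Fin N) F)ˣ, ∀ v ∈ W, π.alg (MonoidAlgebra.of ℂ _ g) *ᵥ v ∈ W)
    {v : Fin π.d → ℂ} (hv : v ∈ W) (hv0 : v ≠ 0) (w : Fin π.d → ℂ) : w ∈ W := by
  rcases hπ.2 W (fun g v hv => by rw [← π.alg_of]; exact hW g v hv) with h | h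
  · rw [h, Submodule.mem_bot] at hv
    exact absurd hv hv0
  · rw [h]
    exact Submodule.mem_top

/-- Schur's lemma for a matrix commuting with an irreducible representation. -/
theorem FinRep.Irreducible.exists_eq_smul_one {π : FinRep N F} (hπ : π.Irreducible)
    {A : Matrix (Fin π.d) (Fin π.d) ℂ}
    (hA : ∀ g : (Matrix (Fin N) (Fin N) F)ˣ, Commute A (π.alg (MonoidAlgebra.of ℂ _ g))) :
    ∃ c : ℂ, A = c • 1 := by
  have : Nonempty (Fin π.d) := ⟨⟨0, hπ.1⟩⟩
  obtain ⟨c, hc⟩ := Module.End.exists_eigenvalue (K := ℂ) (V := Fin π.d → ℂ) A.mulVecLin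
  obtain ⟨v, hv⟩ := hc.exists_hasEigenvector
  refine ⟨c, ?_⟩
  refine Matrix.ext_of_mulVec_single fun i => ?_
  rw [smul_mulVec, one_mulVec]
  have h := hπ.mem_of_invariant (W := Module.End.eigenspace A.mulVecLin c) (fun g w hw => by
    rw [Module.End.mem_eigenspace_iff, mulVecLin_apply] at hw ⊢
    rw [mulVec_mulVec, (hA g).eq, ← mulVec_mulVec, hw, mulVec_smul]) hv.1 hv.2 (Pi.single i 1)
  rwa [Module.End.mem_eigenspace_iff, mulVecLin_apply] at h

/-- Schur's lemma for intertwining matrices. -/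
theorem FinRep.iso_of_intertwiner_ne_zero {τ σ : FinRep N F} (hτ : τ.Irreducible)
    (hσ : σ.Irreducible) {A : Matrix (Fin τ.d) (Fin σ.d) ℂ} (hA0 : A ≠ 0)
    (hA : ∀ g : (Matrix (Fin N) (Fin N) F)ˣ,
      τ.alg (MonoidAlgebra.of ℂ _ g) * A = A * σ.alg (MonoidAlgebra.of ℂ _ g)) : σ.Iso τ := by
  have hker : LinearMap.ker A.mulVecLin = ⊥ := by
    rw [LinearMap.ker_eq_bot']
    intro v hv
    by_contra hv0
    apply hA0
    refine Matrix.ext_of_mulVec_single fun i => ?_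
    rw [zero_mulVec]
    exact hσ.mem_of_invariant (W := LinearMap.ker A.mulVecLin) (fun g w hw => by
      rw [LinearMap.mem_ker, mulVecLin_apply] at hw ⊢
      rw [mulVec_mulVec, ← hA g, ← mulVec_mulVec, hw, mulVec_zero]) hv hv0 _
  have hrange : LinearMap.range A.mulVecLin = ⊤ := by
    obtain ⟨v, hv⟩ : ∃ v, A *ᵥ v ≠ 0 := by
      by_contra! h
      exact hA0 (Matrix.ext_of_mulVec_single fun i => by rw [h, zero_mulVec])
    rw [Submodule.eq_top_iff']
    refine hτ.mem_of_invariant (fun g w hw => ?_) (LinearMap.mem_range_self A.mulVecLin v) hv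
    obtain ⟨x, rfl⟩ := hw
    refine ⟨σ.alg (MonoidAlgebra.of ℂ _ g) *ᵥ x, ?_⟩
    rw [mulVecLin_apply, mulVecLin_apply, mulVec_mulVec, mulVec_mulVec, hA g]
  refine ⟨LinearEquiv.ofBijective A.mulVecLin
    ⟨LinearMap.ker_eq_bot.1 hker, LinearMap.range_eq_top.1 hrange⟩, fun g v => ?_⟩
  change A *ᵥ _ = _ *ᵥ (A *ᵥ v)
  rw [mulVec_mulVec, mulVec_mulVec, ← τ.alg_of, ← σ.alg_of, hA g]

variable [Fintype F]

theorem traceChar_eq (π : FinRep N F) (A : Matrix (Fin N) (Fin N) F) :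
    traceChar π A = trace (π.alg (matOf F N A)) := by
  unfold traceChar
  split_ifs with h
  · conv_rhs => rw [← h.unit_spec, matOf_units, π.alg_of]
  · have : matOf F N A = 0 := dif_neg h
    rw [this, map_zero, trace_zero]

theorem bessel_eq_trace (ψ : AddChar F ℂ) (π : FinRep N F) (A : Matrix (Fin N) (Fin N) F) :
    Bessel ψ π A = trace (π.alg (matOf F N A * whittakerIdem ψ N)) := by
  simp only [Bessel, whittakerIdem, traceChar_eq, mul_smul_comm, Finset.mul_sum, map_smul, map_sum,
    map_mul, trace_smul, trace_sum, smul_eq_mul]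

theorem FinRep.Generic.alg_ne_zero {ψ : AddChar F ℂ} {π : FinRep N F} (h : π.Generic ψ) :
    π.alg (whittakerIdem ψ N) ≠ 0 := by
  obtain ⟨ℓ, hℓ0, hℓ⟩ := h
  intro hz
  apply hℓ0
  ext1 i
  have key : ∀ v, ℓ (π.alg (whittakerIdem ψ N) *ᵥ v) = ℓ v := by
    intro v
    have hu : ∀ u ∈ unipFinset F N,
        ℓ (((psiU ψ u)⁻¹ • π.alg (matOf F N u)) *ᵥ v) = ℓ v := by
      intro u hu
      have hu' := mem_unipFinset.1 hu
      have h1 := hℓ hu'.isUnit.unit hu' v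
      rw [← π.alg_of, ← matOf_units] at h1
      rw [smul_mulVec, map_smul]
      refine (congrArg _ h1).trans ?_
      rw [smul_eq_mul]
      exact inv_mul_cancel_left₀ (psiU_ne_zero ψ u) _
    rw [whittakerIdem, map_smul, map_sum, smul_mulVec, sum_mulVec, map_smul, map_sum]
    simp only [map_smul]
    rw [Finset.sum_congr rfl hu, Finset.sum_const, nsmul_eq_mul, smul_eq_mul,
      inv_mul_cancel_left₀ card_unipFinset_ne_zero]
  ext
  simp only [LinearMap.comp_apply, LinearMap.zero_apply]
  rw [← key, hz, zero_mulVec, map_zero]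

theorem FinRep.generic_of_alg_ne_zero {ψ : AddChar F ℂ} {π : FinRep N F}
    (h : π.alg (whittakerIdem ψ N) ≠ 0) : π.Generic ψ := by
  obtain ⟨i, hi⟩ : ∃ i, π.alg (whittakerIdem ψ N) i ≠ 0 := by
    by_contra! hcon
    exact h (funext hcon)
  refine ⟨(LinearMap.proj i).comp (π.alg (whittakerIdem ψ N)).mulVecLin, fun hz => hi ?_,
    fun u hu v => ?_⟩
  · ext j
    have := LinearMap.congr_fun hz (Pi.single j 1)
    simpa using this
  · rw [← π.alg_of, ← matOf_units]
    simp only [LinearMap.comp_apply, LinearMap.proj_apply, mulVecLin_apply]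
    rw [mulVec_mulVec, ← map_mul, whittakerIdem_mul_matOf ψ hu, map_smul, smul_mulVec,
      Pi.smul_apply, smul_eq_mul]

/-- Uniqueness of Whittaker models. -/
theorem FinRep.Irreducible.trace_whittakerIdem {ψ : AddChar F ℂ} (hψ : ψ ≠ 1) {π : FinRep N F}
    (hπ : π.Irreducible) (hgen : π.Generic ψ) : trace (π.alg (whittakerIdem ψ N)) = 1 := by
  set E := π.alg (whittakerIdem ψ N) with hE
  have hEE : E * E = E := by rw [hE, ← map_mul, whittakerIdem_mul_self]
  let R : (Matrix (Fin N) (Fin N) F)ˣ → Matrix (Fin π.d) (Fin π.d) ℂ := fun g =>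
    π.alg (MonoidAlgebra.of ℂ _ g)
  have hR : ∀ g h, R (g * h) = R g * R h := fun g h => by simp only [R, map_mul]
  have hcomm : ∀ g h, E * R g * E * (E * R h * E) = E * R h * E * (E * R g * E) := by
    intro g h
    have := congrArg π.alg (whittakerIdem_sandwich_commute (N := N) hψ g h).eq
    simpa only [map_mul] using this
  obtain ⟨v₀, hv₀⟩ : ∃ v, E *ᵥ v ≠ 0 := by
    by_contra! h
    exact hgen.alg_ne_zero (Matrix.ext_of_mulVec_single fun i => by rw [← hE, h, zero_mulVec])
  have hscalar : ∀ g, ∃ c : ℂ, E * R g * E = c • E := by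
    intro g
    let T := (E * R g * E).mulVecLin
    let W := LinearMap.range E.mulVecLin
    have hW : ∀ w ∈ W, E *ᵥ w = w := by
      rintro _ ⟨x, rfl⟩
      rw [mulVecLin_apply, mulVec_mulVec, hEE]
    have hTW : ∀ x ∈ W, T x ∈ W := fun x _ => ⟨(R g * E) *ᵥ x, by
      simp only [T, mulVecLin_apply, mulVec_mulVec, mul_assoc]⟩
    have : Nontrivial W := ⟨⟨⟨_, LinearMap.mem_range_self _ v₀⟩, 0, fun h =>
      hv₀ (congrArg Subtype.val h)⟩⟩
    obtain ⟨c, hc⟩ := Module.End.exists_eigenvalue (K := ℂ) (T.restrict hTW)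
    obtain ⟨⟨w, hwW⟩, hw⟩ := hc.exists_hasEigenvector
    have hw0 : w ≠ 0 := fun h => hw.2 (Subtype.ext h)
    have hTw : (E * R g * E) *ᵥ w = c • w := congrArg Subtype.val hw.apply_eq_smul
    let X : Submodule ℂ (Fin π.d → ℂ) :=
      ⨅ h, LinearMap.ker ((E * R g * E - c • E) * R h).mulVecLin
    have hX : ∀ x, x ∈ X ↔ ∀ h, (E * R g * E - c • E) *ᵥ (R h *ᵥ x) = 0 := fun x => by
      simp only [X, Submodule.mem_iInf, LinearMap.mem_ker, mulVecLin_apply, mulVec_mulVec]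
    have hwX : w ∈ X := by
      rw [hX]
      intro h
      have h1 := congrArg (· *ᵥ w) (hcomm g h)
      simp only [← mulVec_mulVec, hW w hwW] at h1 hTw ⊢
      rw [hTw] at h1
      have h2 : E *ᵥ E *ᵥ R h *ᵥ w = E *ᵥ R h *ᵥ w := by rw [mulVec_mulVec _ E E, hEE]
      rw [sub_mulVec, smul_mulVec, sub_eq_zero]
      simp only [← mulVec_mulVec]
      simp only [h2, mulVec_smul, hW w hwW] at h1
      exact h1
    refine ⟨c, Matrix.ext_of_mulVec_single fun i => ?_⟩
    have h1 := (hX _).1 (hπ.mem_of_invariant (W := X) (fun h x hx => by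
      rw [hX] at hx ⊢
      intro k
      rw [mulVec_mulVec _ (R k)]
      exact hR k h ▸ hx (k * h)) hwX hw0 (Pi.single i 1)) 1
    have hR1 : R 1 = 1 := by simp only [R, map_one]
    rwa [hR1, one_mulVec, sub_mulVec, sub_eq_zero] at h1
  have hspan : ∀ x, E *ᵥ x ∈ Submodule.span ℂ {E *ᵥ v₀} := by
    intro x
    let X : Submodule ℂ (Fin π.d → ℂ) :=
      ⨅ h, (Submodule.span ℂ {E *ᵥ v₀}).comap (E * R h).mulVecLin
    have hX : ∀ x, x ∈ X ↔ ∀ h, E *ᵥ (R h *ᵥ x) ∈ Submodule.span ℂ {E *ᵥ v₀} := fun x => by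
      simp only [X, Submodule.mem_iInf, Submodule.mem_comap, mulVecLin_apply, mulVec_mulVec]
    have hmem : E *ᵥ v₀ ∈ X := by
      rw [hX]
      intro h
      obtain ⟨c, hc⟩ := hscalar h
      rw [mulVec_mulVec, mulVec_mulVec, hc, smul_mulVec]
      exact Submodule.smul_mem _ _ (Submodule.mem_span_singleton_self _)
    have h1 := (hX _).1 (hπ.mem_of_invariant (W := X) (fun h x hx => by
      rw [hX] at hx ⊢
      intro k
      rw [mulVec_mulVec _ (R k)]
      exact hR k h ▸ hx (k * h)) hmem hv₀ x) 1
    have hR1 : R 1 = 1 := by simp only [R, map_one]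
    rwa [hR1, one_mulVec] at h1
  have hrange : LinearMap.range E.mulVecLin = Submodule.span ℂ {E *ᵥ v₀} := by
    apply le_antisymm
    · rintro _ ⟨x, rfl⟩
      exact hspan x
    · rw [Submodule.span_singleton_le_iff_mem]
      exact LinearMap.mem_range_self E.mulVecLin v₀
  have hidem : IsIdempotentElem E.mulVecLin := by
    rw [IsIdempotentElem, Module.End.mul_eq_comp, ← mulVecLin_mul, hEE]
  have h1 := (LinearMap.IsIdempotentElem.isProj_range _ hidem).trace
  rw [hrange, finrank_span_singleton hv₀, Nat.cast_one, ← toLin'_apply', trace_toLin'_eq] at h1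
  exact h1

/-- The central element of the group algebra attached to the character of a representation. -/
def FinRep.centralElem (σ : FinRep N F) : MonoidAlgebra ℂ (Matrix (Fin N) (Fin N) F)ˣ := by
  classical
  exact ∑ h, trace (σ.alg (MonoidAlgebra.of ℂ _ h⁻¹)) • MonoidAlgebra.of ℂ _ h

theorem FinRep.intertwiner_average (τ σ : FinRep N F) [Fintype (Matrix (Fin N) (Fin N) F)ˣ]
    (M : Matrix (Fin τ.d) (Fin σ.d) ℂ) (g : (Matrix (Fin N) (Fin N) F)ˣ) :
    τ.alg (MonoidAlgebra.of ℂ _ g) * (∑ h : (Matrix (Fin N) (Fin N) F)ˣ,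
        τ.alg (MonoidAlgebra.of ℂ _ h) * M * σ.alg (MonoidAlgebra.of ℂ _ h⁻¹)) =
      (∑ h : (Matrix (Fin N) (Fin N) F)ˣ,
        τ.alg (MonoidAlgebra.of ℂ _ h) * M * σ.alg (MonoidAlgebra.of ℂ _ h⁻¹)) *
        σ.alg (MonoidAlgebra.of ℂ _ g) := by
  rw [Matrix.mul_sum, Matrix.sum_mul, ← Equiv.sum_comp (Equiv.mulLeft g)
    fun h => τ.alg (MonoidAlgebra.of ℂ _ h) * M * σ.alg (MonoidAlgebra.of ℂ _ h⁻¹) *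
      σ.alg (MonoidAlgebra.of ℂ _ g)]
  refine Finset.sum_congr rfl fun h _ => ?_
  rw [Equiv.coe_mulLeft, Matrix.mul_assoc _ (σ.alg _) (σ.alg _), ← map_mul σ.alg, ← map_mul,
    _root_.mul_inv_rev, inv_mul_cancel_right, map_mul, map_mul]
  simp only [Matrix.mul_assoc]

theorem FinRep.alg_centralElem_apply (τ σ : FinRep N F) [Fintype (Matrix (Fin N) (Fin N) F)ˣ]
    (a b : Fin τ.d) :
    τ.alg σ.centralElem a b = ∑ k : Fin σ.d, (∑ h : (Matrix (Fin N) (Fin N) F)ˣ,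
      τ.alg (MonoidAlgebra.of ℂ _ h) * Matrix.single b k (1 : ℂ) *
        σ.alg (MonoidAlgebra.of ℂ _ h⁻¹) : Matrix (Fin τ.d) (Fin σ.d) ℂ) a k := by
  unfold FinRep.centralElem
  simp only [map_sum, map_smul, Matrix.sum_apply, Matrix.smul_apply, smul_eq_mul, trace,
    diag_apply]
  rw [Finset.sum_comm]
  convert Finset.sum_congr rfl fun h _ => ?_
  rw [Finset.sum_mul]
  refine Finset.sum_congr rfl fun k _ => ?_
  rw [mul_comm, mul_apply, Finset.sum_eq_single k]
  · rw [mul_single_apply_same, mul_one]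
  · intro j _ hj
    rw [mul_single_apply_of_ne _ _ _ _ _ hj, zero_mul]
  · simp

theorem FinRep.Irreducible.alg_centralElem_of_not_iso {τ σ : FinRep N F} (hτ : τ.Irreducible)
    (hσ : σ.Irreducible) (hiso : ¬ σ.Iso τ) : τ.alg σ.centralElem = 0 := by
  classical
  ext a b
  rw [τ.alg_centralElem_apply]
  refine Finset.sum_eq_zero fun k _ => ?_
  have h : (∑ h : (Matrix (Fin N) (Fin N) F)ˣ, τ.alg (MonoidAlgebra.of ℂ _ h) *
      Matrix.single b k (1 : ℂ) * σ.alg (MonoidAlgebra.of ℂ _ h⁻¹) :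
        Matrix (Fin τ.d) (Fin σ.d) ℂ) = 0 := by
    by_contra hne
    exact hiso (FinRep.iso_of_intertwiner_ne_zero hτ hσ hne (τ.intertwiner_average σ _))
  rw [h, Matrix.zero_apply]

theorem FinRep.Irreducible.alg_centralElem_self {σ : FinRep N F} (hσ : σ.Irreducible) :
    σ.alg σ.centralElem =
      ((Nat.card (Matrix (Fin N) (Fin N) F)ˣ : ℂ) / σ.d) • 1 := by
  classical
  have hd : (σ.d : ℂ) ≠ 0 := Nat.cast_ne_zero.2 hσ.1.ne'
  have key : ∀ M : Matrix (Fin σ.d) (Fin σ.d) ℂ, (∑ h : (Matrix (Fin N) (Fin N) F)ˣ,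
      σ.alg (MonoidAlgebra.of ℂ _ h) * M * σ.alg (MonoidAlgebra.of ℂ _ h⁻¹)) =
      ((Nat.card (Matrix (Fin N) (Fin N) F)ˣ : ℂ) / σ.d * trace M) • 1 := by
    intro M
    obtain ⟨c, hc⟩ := hσ.exists_eq_smul_one fun g => (σ.intertwiner_average σ M g).symm
    have ht := congrArg trace hc
    rw [trace_sum, trace_smul, trace_one, Fintype.card_fin, Finset.sum_congr rfl
      (g := fun _ => trace M), Finset.sum_const, Finset.card_univ, nsmul_eq_mul, smul_eq_mul] at ht
    · rw [hc, Nat.card_eq_fintype_card, div_mul_eq_mul_div, ht, mul_div_cancel_right₀ _ hd]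
    · intro h _
      rw [trace_mul_cycle, ← map_mul, ← map_mul, inv_mul_cancel, map_one, map_one, one_mul]
  ext a b
  rw [σ.alg_centralElem_apply, Finset.sum_congr rfl fun k _ => by rw [key]]
  simp only [Matrix.smul_apply, smul_eq_mul]
  rw [Finset.sum_eq_single a]
  · by_cases hab : a = b
    · subst hab
      rw [trace_single_eq_same, mul_one]
    · rw [trace_single_eq_of_ne _ _ _ (Ne.symm hab), one_apply_ne hab]
      simp
  · intro k _ hk
    rw [one_apply_ne hk.symm, mul_zero]
  · simp

theorem FinRep.Iso.alg_mulVec {τ σ : FinRep N F} {e : (Fin τ.d → ℂ) ≃ₗ[ℂ] (Fin σ.d → ℂ)}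
    (he : ∀ (g : (Matrix (Fin N) (Fin N) F)ˣ) (v : Fin τ.d → ℂ),
      e ((τ.ρ g : Matrix (Fin τ.d) (Fin τ.d) ℂ) *ᵥ v) =
        (σ.ρ g : Matrix (Fin σ.d) (Fin σ.d) ℂ) *ᵥ e v)
    (y : MonoidAlgebra ℂ (Matrix (Fin N) (Fin N) F)ˣ) (v : Fin τ.d → ℂ) :
    e (τ.alg y *ᵥ v) = σ.alg y *ᵥ e v := by
  induction y using MonoidAlgebra.induction_on with
  | of g => rw [τ.alg_of, σ.alg_of, he]
  | add a b ha hb => rw [map_add, map_add, add_mulVec, add_mulVec, map_add, ha, hb]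
  | smul c a ha => rw [map_smul, map_smul, smul_mulVec, smul_mulVec, map_smul, ha]

/-- An element of the group algebra acting by zero in every irreducible representation is zero. -/
theorem eq_zero_of_forall_irreducible {y : MonoidAlgebra ℂ (Matrix (Fin N) (Fin N) F)ˣ}
    (hy : ∀ τ : FinRep N F, τ.Irreducible → τ.alg y = 0) : y = 0 := by
  classical
  let G := (Matrix (Fin N) (Fin N) F)ˣ
  have : NeZero (Nat.card G : ℂ) := ⟨Nat.cast_ne_zero.2 Nat.card_pos.ne'⟩
  have hmem : y ∈ (⊤ : Submodule (MonoidAlgebra ℂ G) (MonoidAlgebra ℂ G)).annihilator := by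
    rw [← IsSemisimpleModule.sSup_simples_eq_top, sSup_eq_iSup', Submodule.annihilator_iSup,
      Submodule.mem_iInf]
    rintro ⟨S, hS⟩
    have hS' : IsSimpleModule (MonoidAlgebra ℂ G) S := hS
    have hfin : Module.Finite ℂ (MonoidAlgebra ℂ G) := inferInstance
    have hfinS : Module.Finite ℂ S :=
      Module.Finite.of_injective (S.subtype.restrictScalars ℂ) Subtype.val_injective
    let b := Module.finBasis ℂ S
    let Φ : MonoidAlgebra ℂ G →ₐ[ℂ] Matrix (Fin (Module.finrank ℂ S)) (Fin (Module.finrank ℂ S)) ℂ :=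
      (LinearMap.toMatrixAlgEquiv b).toAlgHom.comp (Algebra.lsmul ℂ ℂ S)
    let τ : FinRep N F := ⟨Module.finrank ℂ S,
      ((Φ : MonoidAlgebra ℂ G →* _).comp (MonoidAlgebra.of ℂ G)).toHomUnits⟩
    have hΦ : τ.alg = Φ := by
      refine AlgHom.ext fun a => ?_
      induction a using MonoidAlgebra.induction_on with
      | of g => exact τ.alg_of g
      | add a c ha hc => rw [map_add, map_add, ha, hc]
      | smul c a ha => rw [map_smul, map_smul, ha]
    have hact : ∀ (a : MonoidAlgebra ℂ G) (s : S), Φ a *ᵥ b.equivFun s = b.equivFun (a • s) := by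
      intro a s
      exact LinearMap.toMatrix_mulVec_repr b b (Algebra.lsmul ℂ ℂ S a) s
    have hirr : τ.Irreducible := by
      have : Nontrivial S := IsSimpleModule.nontrivial (MonoidAlgebra ℂ G) S
      refine ⟨Module.finrank_pos (R := ℂ) (M := S), fun W hW => ?_⟩
      have hWΦ : ∀ (a : MonoidAlgebra ℂ G), ∀ v ∈ W, Φ a *ᵥ v ∈ W := by
        intro a v hv
        induction a using MonoidAlgebra.induction_on with
        | of g =>
          have := hW g v hv
          rwa [← τ.alg_of, hΦ] at this
        | add a c ha hc =>
          rw [map_add, add_mulVec]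
          exact W.add_mem ha hc
        | smul c a ha =>
          rw [map_smul, smul_mulVec]
          exact W.smul_mem c ha
      let W' : Submodule (MonoidAlgebra ℂ G) S :=
        { carrier := {s | b.equivFun s ∈ W}
          add_mem' := fun {s t} hs ht => by
            simp only [Set.mem_ofPred_eq, map_add] at *
            exact W.add_mem hs ht
          zero_mem' := by
            simp only [Set.mem_ofPred_eq, map_zero]
            exact W.zero_mem
          smul_mem' := fun a s hs => by
            simp only [Set.mem_ofPred_eq] at *
            rw [← hact]
            exact hWΦ a _ hs }
      rcases eq_bot_or_eq_top W' with h | h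
      · left
        rw [Submodule.eq_bot_iff]
        intro v hv
        have h1 : b.equivFun.symm v ∈ W' := by
          change b.equivFun (b.equivFun.symm v) ∈ W
          rwa [LinearEquiv.apply_symm_apply]
        rw [h, Submodule.mem_bot] at h1
        exact (LinearEquiv.map_eq_zero_iff _).1 h1
      · right
        rw [Submodule.eq_top_iff']
        intro v
        have h1 : b.equivFun.symm v ∈ W' := h ▸ Submodule.mem_top
        have h2 : b.equivFun (b.equivFun.symm v) ∈ W := h1
        rwa [LinearEquiv.apply_symm_apply] at h2
    rw [Submodule.mem_annihilator]
    intro s hs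
    have h0 := hact y ⟨s, hs⟩
    rw [← hΦ, hy τ hirr, zero_mulVec] at h0
    exact congrArg Subtype.val ((LinearEquiv.map_eq_zero_iff _).1 h0.symm)
  rw [Submodule.mem_annihilator] at hmem
  simpa using hmem 1 Submodule.mem_top

theorem FinRep.coeff_centralElem_mul (σ : FinRep N F)
    (a : MonoidAlgebra ℂ (Matrix (Fin N) (Fin N) F)ˣ) (g : (Matrix (Fin N) (Fin N) F)ˣ) :
    (σ.centralElem * a).coeff g = trace (σ.alg (a * MonoidAlgebra.of ℂ _ g⁻¹)) := by
  classical
  have hc : ∀ k, σ.centralElem.coeff k = trace (σ.alg (MonoidAlgebra.of ℂ _ k⁻¹)) := by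
    intro k
    simp only [FinRep.centralElem, MonoidAlgebra.coeff_sum, MonoidAlgebra.coeff_smul,
      Finsupp.finsetSum_apply, Finsupp.smul_apply, MonoidAlgebra.of_apply,
      MonoidAlgebra.coeff_single, smul_eq_mul]
    rw [Finset.sum_eq_single k]
    · rw [Finsupp.single_eq_same, mul_one]
    · intro j _ hj
      rw [Finsupp.single_eq_of_ne hj.symm, mul_zero]
    · simp
  induction a using MonoidAlgebra.induction_on with
  | of k =>
    change (σ.centralElem * MonoidAlgebra.single k 1).coeff g = _
    rw [MonoidAlgebra.coeff_mul_single_apply, mul_one, hc, ← map_mul, _root_.mul_inv_rev, inv_inv]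
  | add a b ha hb =>
    rw [mul_add, add_mul, map_add, trace_add, ← ha, ← hb, MonoidAlgebra.coeff_add,
      Finsupp.add_apply]
  | smul c a ha =>
    rw [mul_smul_comm, smul_mul_assoc, map_smul, trace_smul, ← ha, MonoidAlgebra.coeff_smul,
      Finsupp.smul_apply]

theorem IsUnipUpper.of_mul_eq_one {u w : Matrix (Fin N) (Fin N) F} (hu : IsUnipUpper u)
    (h : u * w = 1) : IsUnipUpper w := by
  have hmaps : Set.MapsTo (fun x => u * x) (unipFinset F N) (unipFinset F N) := fun x hx =>
    mem_unipFinset.2 (hu.mul (mem_unipFinset.1 hx))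
  have hinj := hu.isUnit.mul_right_injective
  obtain ⟨x, hx, hx1⟩ := Finset.surjOn_of_injOn_of_card_le _ hmaps hinj.injOn le_rfl
    (mem_unipFinset.2 IsUnipUpper.one)
  have : x = w := hinj (hx1.trans h.symm)
  exact this ▸ mem_unipFinset.1 hx

theorem coeff_whittakerIdem_eq_zero (ψ : AddChar F ℂ) {g : (Matrix (Fin N) (Fin N) F)ˣ}
    (hg : ¬ IsUnipUpper (g : Matrix (Fin N) (Fin N) F)) : (whittakerIdem ψ N).coeff g = 0 := by
  rw [whittakerIdem, MonoidAlgebra.coeff_smul, MonoidAlgebra.coeff_sum, Finsupp.smul_apply,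
    Finsupp.finsetSum_apply, Finset.sum_eq_zero, smul_zero]
  intro u hu
  have hu' := mem_unipFinset.1 hu
  rw [MonoidAlgebra.coeff_smul, Finsupp.smul_apply, ← hu'.isUnit.unit_spec, matOf_units,
    MonoidAlgebra.of_apply, MonoidAlgebra.coeff_single, Finsupp.single_eq_of_ne, smul_zero]
  intro h
  apply hg
  rw [h]
  exact hu'

/-- The Plancherel-weighted sum of the Bessel functions of the generic irreducible representations
is supported on the unitriangular group. -/
theorem sum_dim_mul_bessel_eq_zero (ψ : AddChar F ℂ) {ι : Type} [Fintype ι]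
    {σ : ι → FinRep N F} (hσ : ∀ i, (σ i).Irreducible ∧ (σ i).Generic ψ)
    (hpairwise : ∀ i j, (σ i).Iso (σ j) → i = j)
    (hcomplete : ∀ τ : FinRep N F, τ.Irreducible → τ.Generic ψ → ∃ i, τ.Iso (σ i))
    {A : Matrix (Fin N) (Fin N) F} (hA : ¬ IsUnipUpper A) :
    ∑ i, ((σ i).d : ℂ) * Bessel ψ (σ i) A = 0 := by
  classical
  by_cases hAu : IsUnit A
  swap
  · refine Finset.sum_eq_zero fun i _ => ?_
    have : matOf F N A = 0 := dif_neg hAu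
    rw [bessel_eq_trace, this, zero_mul, map_zero, trace_zero, mul_zero]
  obtain ⟨g, rfl⟩ := hAu
  set q : ℂ := ((Nat.card (Matrix (Fin N) (Fin N) F)ˣ : ℕ) : ℂ) with hq
  have hq0 : q ≠ 0 := Nat.cast_ne_zero.2 Nat.card_pos.ne'
  let z : MonoidAlgebra ℂ (Matrix (Fin N) (Fin N) F)ˣ :=
    ∑ i, (((σ i).d : ℂ) / q) • (σ i).centralElem
  have hz : z * whittakerIdem ψ N - whittakerIdem ψ N = 0 := by
    refine eq_zero_of_forall_irreducible fun τ hτ => ?_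
    by_cases hE : τ.alg (whittakerIdem ψ N) = 0
    · rw [map_sub, map_mul, hE, mul_zero, sub_zero]
    obtain ⟨i, e, he⟩ := hcomplete τ hτ (FinRep.generic_of_alg_ne_zero hE)
    have hzi : τ.alg z = 1 := by
      refine Matrix.ext_of_mulVec_single fun j => e.injective ?_
      rw [FinRep.Iso.alg_mulVec he, one_mulVec]
      have : (σ i).alg z = 1 := by
        simp only [z, map_sum, map_smul]
        rw [Finset.sum_eq_single i]
        · rw [(hσ i).1.alg_centralElem_self, smul_smul, ← hq, div_mul_div_cancel₀ hq0,
            div_self (Nat.cast_ne_zero.2 (hσ i).1.1.ne'), one_smul]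
        · intro j _ hj
          rw [(hσ i).1.alg_centralElem_of_not_iso (hσ j).1 fun h => hj (hpairwise _ _ h), smul_zero]
        · simp
      rw [this, one_mulVec]
    rw [map_sub, map_mul, hzi, one_mul, sub_self]
  have h1 := congrArg (fun y => y.coeff g⁻¹) (sub_eq_zero.1 hz)
  simp only [z, Finset.sum_mul, smul_mul_assoc, MonoidAlgebra.coeff_sum, MonoidAlgebra.coeff_smul,
    Finsupp.finsetSum_apply, Finsupp.smul_apply, FinRep.coeff_centralElem_mul, inv_inv,
    smul_eq_mul] at h1
  rw [coeff_whittakerIdem_eq_zero ψ fun h => hA (h.of_mul_eq_one (Units.inv_mul g))] at h1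
  have h2 : ∀ i, ((σ i).d : ℂ) * Bessel ψ (σ i) g = q * (((σ i).d : ℂ) / q *
      trace ((σ i).alg (whittakerIdem ψ N * MonoidAlgebra.of ℂ _ g))) := by
    intro i
    rw [bessel_eq_trace, matOf_units, map_mul, trace_mul_comm, ← map_mul, ← mul_assoc,
      mul_div_cancel₀ _ hq0]
  rw [Finset.sum_congr rfl fun i _ => h2 i, ← Finset.mul_sum, h1, mul_zero]

/-- Scalar matrices act in an irreducible representation by complex numbers of modulus one. -/
theorem FinRep.Irreducible.exists_central_character {π : FinRep N F} (hπ : π.Irreducible)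
    (c : Fˣ) : ∃ ω : ℂ, ω * starRingEnd ℂ ω = 1 ∧
      π.alg (matOf F N ((c : F) • 1)) = ω • 1 := by
  let z : (Matrix (Fin N) (Fin N) F)ˣ := ⟨(c : F) • 1, ((c⁻¹ : Fˣ) : F) • 1,
    by simp [smul_smul], by simp [smul_smul]⟩
  have hz : ((c : F) • 1 : Matrix (Fin N) (Fin N) F) = z := rfl
  have hcomm : ∀ g, z * g = g * z := fun g => by
    apply Units.ext
    simp [z]
  obtain ⟨ω, hω⟩ := hπ.exists_eq_smul_one (A := π.alg (MonoidAlgebra.of ℂ _ z)) fun g => by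
    rw [Commute, SemiconjBy, ← map_mul, ← map_mul, hcomm, map_mul, map_mul]
  refine ⟨ω, ?_, by rw [hz, matOf_units, hω]⟩
  have hpow : ω ^ orderOf z = 1 := by
    have h1 : π.alg (MonoidAlgebra.of ℂ _ (z ^ orderOf z)) = 1 := by
      rw [pow_orderOf_eq_one, map_one, map_one]
    rw [map_pow, map_pow, hω, smul_pow, one_pow] at h1
    have h2 := congrFun (congrFun h1 ⟨0, hπ.1⟩) ⟨0, hπ.1⟩
    simpa using h2
  have hnorm : ‖ω‖ = 1 := Complex.norm_eq_one_of_pow_eq_one hpow (orderOf_pos z).ne'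
  rw [Complex.mul_conj, Complex.normSq_eq_norm_sq, hnorm]
  simp

end

end Representations

/-- the recursive expression for the Bessel function of an irreducible generic
representation of `GL_n(F)`, in the case `m > n`, evaluated at central elements: the sum
vanishes. -/
theorem bessel_recursive_gt
    (F : Type) [Field F] [Fintype F] [DecidableEq F]
    (ψ : AddChar F ℂ) (hψ : ψ ≠ 1)
    (n : ℕ) (hn : 1 ≤ n)
    (π : FinRep n F) (hπirr : π.Irreducible) (hπgen : π.Generic ψ)
    (m : ℕ) (hm : n < m)
    (ι : Type) [Fintype ι] (σ : ι → FinRep m F)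
    (hσ : ∀ i, (σ i).Irreducible ∧ (σ i).Generic ψ)
    (hpairwise : ∀ i j, (σ i).Iso (σ j) → i = j)
    (hcomplete : ∀ τ : FinRep m F, τ.Irreducible → τ.Generic ψ → ∃ i, τ.Iso (σ i))
    (c : Fˣ) :
    ∑ i : ι, ((σ i).d : ℂ) *
        (∑ h : (Matrix (Fin n) (Fin n) F)ˣ,
          Bessel ψ π (h : Matrix (Fin n) (Fin n) F) *
            (starRingEnd ℂ)
              (Bessel ψ (σ i) (cornerBlock F m n (-1) (h : Matrix (Fin n) (Fin n) F)))) *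
        Bessel ψ (σ i) ((c : F) • (1 : Matrix (Fin m) (Fin m) F)) = 0 := by
  have hnot : ∀ (h : (Matrix (Fin n) (Fin n) F)ˣ), ¬ IsUnipUpper
      (((c⁻¹ : Fˣ) : F) • (1 : Matrix (Fin m) (Fin m) F) *
        cornerBlock F m n (-1) (h : Matrix (Fin n) (Fin n) F)) := by
    intro h hu
    have h0 := hu.1 ⟨0, by omega⟩
    have h1 : 0 < m - n := by omega
    have h2 : (0 : ℕ) ≠ n := by omega
    rw [Matrix.smul_mul, Matrix.one_mul, Matrix.smul_apply] at h0
    simp [cornerBlock, h1, h2] at h0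
  have hterm : ∀ (h : (Matrix (Fin n) (Fin n) F)ˣ) (i : ι),
      ((σ i).d : ℂ) * (starRingEnd ℂ)
          (Bessel ψ (σ i) (cornerBlock F m n (-1) (h : Matrix (Fin n) (Fin n) F))) *
        Bessel ψ (σ i) ((c : F) • (1 : Matrix (Fin m) (Fin m) F)) =
      (starRingEnd ℂ) (((σ i).d : ℂ) * Bessel ψ (σ i)
        (((c⁻¹ : Fˣ) : F) • (1 : Matrix (Fin m) (Fin m) F) *
          cornerBlock F m n (-1) (h : Matrix (Fin n) (Fin n) F))) := by
    intro h i
    obtain ⟨ω, hω, hωc⟩ := (hσ i).1.exists_central_character c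
    have hinv : (σ i).alg (matOf F m (((c⁻¹ : Fˣ) : F) • 1)) = (starRingEnd ℂ ω) • 1 := by
      have h1 : (σ i).alg (matOf F m ((c : F) • 1)) *
          (σ i).alg (matOf F m (((c⁻¹ : Fˣ) : F) • 1)) = 1 := by
        rw [← map_mul, ← map_mul]
        simp [smul_smul]
      rw [hωc, smul_mul_assoc, one_mul] at h1
      rw [← h1, smul_smul, mul_comm, hω, one_smul]
    have hb1 : Bessel ψ (σ i) ((c : F) • (1 : Matrix (Fin m) (Fin m) F)) = ω := by
      rw [bessel_eq_trace, map_mul, hωc, smul_mul_assoc, one_mul, Matrix.trace_smul,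
        (hσ i).1.trace_whittakerIdem hψ (hσ i).2, smul_eq_mul, mul_one]
    have hb2 : ∀ v : Matrix (Fin m) (Fin m) F,
        Bessel ψ (σ i) (((c⁻¹ : Fˣ) : F) • (1 : Matrix (Fin m) (Fin m) F) * v) =
          starRingEnd ℂ ω * Bessel ψ (σ i) v := by
      intro v
      rw [bessel_eq_trace, bessel_eq_trace, map_mul (matOf F m), mul_assoc,
        map_mul (σ i).alg (matOf F m (_ • 1)), hinv, smul_mul_assoc, one_mul, Matrix.trace_smul,
        smul_eq_mul]
    rw [hb1, hb2, map_mul, map_mul, Complex.conj_conj, Complex.conj_natCast]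
    ring
  have hzero : ∀ h : (Matrix (Fin n) (Fin n) F)ˣ,
      ∑ i, ((σ i).d : ℂ) * (starRingEnd ℂ)
          (Bessel ψ (σ i) (cornerBlock F m n (-1) (h : Matrix (Fin n) (Fin n) F))) *
        Bessel ψ (σ i) ((c : F) • (1 : Matrix (Fin m) (Fin m) F)) = 0 := by
    intro h
    rw [Finset.sum_congr rfl fun i _ => hterm h i, ← map_sum,
      sum_dim_mul_bessel_eq_zero ψ hσ hpairwise hcomplete (hnot h), map_zero]
  calc _ = ∑ h : (Matrix (Fin n) (Fin n) F)ˣ, Bessel ψ π (h : Matrix (Fin n) (Fin n) F) *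
        ∑ i, ((σ i).d : ℂ) * (starRingEnd ℂ)
          (Bessel ψ (σ i) (cornerBlock F m n (-1) (h : Matrix (Fin n) (Fin n) F))) *
        Bessel ψ (σ i) ((c : F) • (1 : Matrix (Fin m) (Fin m) F)) := by
        simp only [Finset.mul_sum, Finset.sum_mul]
        rw [Finset.sum_comm]
        refine Finset.sum_congr rfl fun h _ => Finset.sum_congr rfl fun i _ => ?_
        ring
    _ = 0 := Finset.sum_eq_zero fun h _ => by rw [hzero h, mul_zero]
end

section
/- Let F be a finite field with q elements, ψ a nontrivial additive character of F, n, m ≥ 1, d = gcd(n,m), l = lcm(n,m). Let α : F_{q^n}^× → ℂ^× and β : F_{q^m}^× → ℂ^× be multiplicative characters. Then for every integer i ≥ 0: τ( (α ∘ N_{F_{q^l}/F_{q^n}}) · (β^{q^{i+d}} ∘ N_{F_{q^l}/F_{q^m}}), ψ_l ) = τ( (α ∘ N_{F_{q^l}/F_{q^n}}) · (β^{q^{i}} ∘ N_{F_{q^l}/F_{q^m}}), ψ_l ), where β^{q^j} denotes the character x ↦ β(x^{q^j}). -/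
noncomputable section

open scoped BigOperators

/-- The Gauss sum `τ(γ, ψK) = -Σ_{ξ ∈ Kˣ} γ(ξ)⁻¹ · ψK(ξ)` attached to a multiplicative
character `γ` of a finite field `K` and an additive character `ψK` of `K`. -/
def tau {K : Type} [Field K] [Fintype K] [DecidableEq K] (γ : Kˣ →* ℂˣ) (ψK : K → ℂ) : ℂ :=
  -∑ ξ : Kˣ, ((γ ξ : ℂ))⁻¹ * ψK (ξ : K)

/-- The `k`-th power of the Frobenius of `L` over `F`, on the units of `L`. -/
def frobeniusPowUnits (F L : Type*) [Field F] [Fintype F] [Field L] [Algebra F L]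
    [Algebra.IsAlgebraic F L] (k : ℕ) : Lˣ ≃* Lˣ :=
  Units.mapEquiv ((FiniteField.frobeniusAlgEquivOfAlgebraic F L ^ k : Gal(L/F)) : L ≃* L)

theorem frobeniusPowUnits_apply (F L : Type*) [Field F] [Fintype F] [Field L] [Algebra F L]
    [Algebra.IsAlgebraic F L] (k : ℕ) (x : Lˣ) :
    frobeniusPowUnits F L k x = x ^ Fintype.card F ^ k := by
  ext
  change (FiniteField.frobeniusAlgEquivOfAlgebraic F L ^ k) (x : L) = _
  rw [AlgEquiv.coe_pow, FiniteField.coe_frobeniusAlgEquivOfAlgebraic_iterate,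
    Units.val_pow_eq_pow_val]

theorem trace_pow_card_pow (F L : Type*) [Field F] [Fintype F] [Field L] [Algebra F L]
    [Algebra.IsAlgebraic F L] (k : ℕ) (x : L) :
    Algebra.trace F L (x ^ Fintype.card F ^ k) = Algebra.trace F L x := by
  rw [← Algebra.trace_eq_of_algEquiv (FiniteField.frobeniusAlgEquivOfAlgebraic F L ^ k) x,
    AlgEquiv.coe_pow, FiniteField.coe_frobeniusAlgEquivOfAlgebraic_iterate]

theorem units_pow_card_pow_finrank_mul (F K : Type*) [Field F] [Fintype F] [Field K] [Fintype K]
    [Algebra F K] (k : ℕ) (x : Kˣ) :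
    x ^ Fintype.card F ^ (Module.finrank F K * k) = x := by
  ext
  rw [pow_mul, ← Module.card_eq_pow_finrank, Units.val_pow_eq_pow_val, FiniteField.pow_card_pow]

theorem Nat.exists_mul_eq_gcd_add_mul {n m : ℕ} (hn : 1 ≤ n) (hm : 1 ≤ m) :
    ∃ k j : ℕ, n * k = n.gcd m + m * j := by
  have bezout := Nat.gcd_eq_gcd_ab n m
  set a := n.gcdA m
  set b := n.gcdB m
  have hk : 0 ≤ a + m * (|a| + |b|) := by
    have : (1 : ℤ) ≤ m := by exact_mod_cast hm
    nlinarith [neg_abs_le a, abs_nonneg a, abs_nonneg b]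
  have hj : 0 ≤ -b + n * (|a| + |b|) := by
    have : (1 : ℤ) ≤ n := by exact_mod_cast hn
    nlinarith [le_abs_self b, abs_nonneg a, abs_nonneg b]
  obtain ⟨k, hk⟩ := Int.eq_ofNat_of_zero_le hk
  obtain ⟨j, hj⟩ := Int.eq_ofNat_of_zero_le hj
  refine ⟨k, j, ?_⟩
  zify
  rw [← hk, ← hj, bezout]
  ring

/-- the Gauss sum `τ((α∘N_{l/n})·(β^{q^{i+d}}∘N_{l/m}), ψ_l)` only depends on
`i` modulo `d = gcd(n,m)`. -/
theorem gauss_sum_invariant_under_gcd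
    (F Kn Km Kl : Type) [Field F] [Fintype F]
    [Field Kn] [Fintype Kn] [DecidableEq Kn]
    [Field Km] [Fintype Km] [DecidableEq Km]
    [Field Kl] [Fintype Kl] [DecidableEq Kl]
    [Algebra F Kn] [Algebra F Km] [Algebra F Kl]
    [Algebra Kn Kl] [Algebra Km Kl]
    [IsScalarTower F Kn Kl] [IsScalarTower F Km Kl]
    (ψ : AddChar F ℂ) (hψ : ψ ≠ 1)
    (n m : ℕ) (hn : 1 ≤ n) (hm : 1 ≤ m)
    (hKn : Module.finrank F Kn = n) (hKm : Module.finrank F Km = m)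
    (hKl : Module.finrank F Kl = Nat.lcm n m)
    (α : Knˣ →* ℂˣ) (β : Kmˣ →* ℂˣ) (i : ℕ) :
    tau ((α.comp (Units.map (Algebra.norm Kn : Kl →* Kn))) *
          ((β.comp (powMonoidHom (Fintype.card F ^ (i + Nat.gcd n m)))).comp
            (Units.map (Algebra.norm Km : Kl →* Km))))
        (fun x => ψ (Algebra.trace F Kl x)) =
      tau ((α.comp (Units.map (Algebra.norm Kn : Kl →* Kn))) *
            ((β.comp (powMonoidHom (Fintype.card F ^ i))).comp
              (Units.map (Algebra.norm Km : Kl →* Km))))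
          (fun x => ψ (Algebra.trace F Kl x)) := by
  subst hKn hKm
  have : FiniteDimensional F Kl := Module.finite_of_finrank_pos <| by
    rw [hKl]; exact Nat.lcm_pos hn hm
  obtain ⟨k, j, hkj⟩ := Nat.exists_mul_eq_gcd_add_mul hn hm
  have norm_n (y : Knˣ) : y ^ Fintype.card F ^ (Module.finrank F Kn * k) = y :=
    units_pow_card_pow_finrank_mul F Kn k y
  have norm_m (y : Kmˣ) : y ^ Fintype.card F ^ (Module.finrank F Kn * k) =
      y ^ Fintype.card F ^ (Module.finrank F Kn).gcd (Module.finrank F Km) := by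
    rw [hkj, pow_add, pow_mul, units_pow_card_pow_finrank_mul F Km j]
  unfold tau
  congr 1
  refine Fintype.sum_equiv (frobeniusPowUnits F Kl (Module.finrank F Kn * k)).toEquiv _ _
    fun ξ => ?_
  simp only [MulEquiv.toEquiv_eq_coe, MulEquiv.coe_toEquiv, frobeniusPowUnits_apply,
    MonoidHom.mul_apply, MonoidHom.comp_apply, map_pow (Units.map _), norm_n, norm_m,
    powMonoidHom_apply, Units.val_pow_eq_pow_val, trace_pow_card_pow, ← pow_mul, ← pow_add,
    add_comm i]
end
end

section
/- Let F be a finite field with q elements, ψ a nontrivial additive character of F, and m ≥ 1. Let β : F_{q^{2m}}^× → ℂ^× be a nontrivial multiplicative character whose restriction to F_{q^m}^× is trivial, and let z ∈ F_{q^{2m}}^× satisfy z^{q^m − 1} = −1. Then Σ_{x ∈ F_{q^{2m}}^×} β(x)^{-1} · ψ(Tr_{F_{q^{2m}}/F}(x)) = q^m · β(z)^{-1}; equivalently, τ(β, ψ_{2m}) = −q^m · β(z)^{-1}. -/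
/-- A sum over a finite field is the value at zero plus the sum over the units. -/
theorem sum_eq_zero_add_sum_units {K M : Type*} [Field K] [Fintype K] [DecidableEq K]
    [AddCommMonoid M] (f : K → M) : ∑ y, f y = f 0 + ∑ y : Kˣ, f y := by
  rw [Fintype.sum_eq_add_sum_subtype_ne f 0, ← Equiv.sum_comp unitsEquivNeZero]
  simp

/-- In a quadratic extension of finite fields, the trace-zero elements form a line. -/
theorem exists_smul_eq_of_trace_eq_zero {K L : Type*} [Field K] [Finite K] [Field L]
    [Algebra K L] (h2 : Module.finrank K L = 2) {z : L} (hz0 : z ≠ 0)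
    (hz : Algebra.trace K L z = 0) {x : L} (hx : Algebra.trace K L x = 0) :
    ∃ c : K, c • z = x := by
  have : FiniteDimensional K L := Module.finite_of_finrank_pos (by omega)
  have hrank := (Algebra.trace K L).finrank_range_add_finrank_ker
  rw [LinearMap.range_eq_top.2 (Algebra.trace_surjective K L), finrank_top,
    Module.finrank_self, h2] at hrank
  have hker : Module.finrank K (LinearMap.ker (Algebra.trace K L)) = 1 := by omega
  obtain ⟨c, hc⟩ := (finrank_eq_one_iff_of_nonzero' (⟨z, hz⟩ : LinearMap.ker (Algebra.trace K L))
    (by simpa [Subtype.ext_iff] using hz0)).1 hker ⟨x, hx⟩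
  exact ⟨c, congrArg Subtype.val hc⟩

/-- The trace of a quadratic extension of finite fields kills `z` when `z ^ (#K - 1) = -1`. -/
theorem trace_eq_zero_of_pow_card_sub_one {K L : Type*} [Field K] [Fintype K] [Field L] [Finite L]
    [Algebra K L] (h2 : Module.finrank K L = 2) {z : L} (hz : z ^ (Fintype.card K - 1) = -1) :
    Algebra.trace K L z = 0 := by
  apply (algebraMap K L).injective
  rw [FiniteField.algebraMap_trace_eq_sum_pow, h2, Finset.sum_range_succ, Finset.sum_range_one,
    Nat.card_eq_fintype_card, pow_zero, pow_one, pow_one, map_zero,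
    ← Nat.sub_add_cancel (Fintype.card_pos (α := K)), pow_succ, hz]
  ring

/-- The Gauss sum over a quadratic extension `L / K` of finite fields, for a nontrivial
multiplicative character trivial on `Kˣ` and an additive character lifted from `K`. -/
theorem gauss_sum_quadratic_extension {K L : Type*} [Field K] [Fintype K] [DecidableEq K]
    [Field L] [Fintype L] [DecidableEq L] [Algebra K L] (h2 : Module.finrank K L = 2)
    {φ : AddChar K ℂ} (hφ : φ ≠ 1) {β : Lˣ →* ℂˣ} (hβ : β ≠ 1)
    (hβK : ∀ y : Kˣ, β (Units.map (algebraMap K L).toMonoidHom y) = 1)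
    {z : Lˣ} (hz : Algebra.trace K L (z : L) = 0) :
    ∑ x : Lˣ, ((β x : ℂ))⁻¹ * φ (Algebra.trace K L x) =
      (Fintype.card K : ℂ) * ((β z : ℂ))⁻¹ := by
  set ι : Kˣ →* Lˣ := Units.map (algebraMap K L).toMonoidHom
  have hιval (y : Kˣ) : (ι y : L) = algebraMap K L y := rfl
  have hscale (y : Kˣ) : ∑ x : Lˣ, ((β x : ℂ))⁻¹ * φ (Algebra.trace K L x) =
      ∑ x : Lˣ, ((β x : ℂ))⁻¹ * φ (y * Algebra.trace K L x) := by
    rw [← Equiv.sum_comp (Equiv.mulLeft (ι y))]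
    refine Finset.sum_congr rfl fun x _ => ?_
    rw [Equiv.coe_mulLeft, map_mul, hβK, one_mul, Units.val_mul, hιval, ← Algebra.smul_def,
      map_smul, smul_eq_mul]
  have hunits (t : K) : ∑ y : Kˣ, φ (y * t) =
      (if t = 0 then (Fintype.card K : ℂ) else 0) - 1 := by
    have h := AddChar.sum_mulShift t (AddChar.IsPrimitive.of_ne_one hφ)
    rw [sum_eq_zero_add_sum_units, zero_mul, AddChar.map_zero_eq_one] at h
    push_cast at h
    rw [← h]
    ring
  have hsum : ∑ x : Lˣ, ((β x : ℂ))⁻¹ = 0 := by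
    have h := sum_hom_units_eq_zero ((Units.coeHom ℂ).comp β⁻¹) (fun h => hβ <| by
      ext x
      simpa using DFunLike.congr_fun h x)
    simpa using h
  have hker :
      ∑ x ∈ ({x : Lˣ | Algebra.trace K L (x : L) = 0} : Finset Lˣ), ((β x : ℂ))⁻¹ =
      ∑ _y : Kˣ, ((β z : ℂ))⁻¹ := by
    symm
    refine Finset.sum_bij (fun y _ => ι y * z) ?_ ?_ ?_ ?_
    · intro y _
      simp [hιval, ← Algebra.smul_def, hz]
    · intro y _ y' _ h
      exact Units.map_injective (algebraMap K L).injective (mul_right_cancel h)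
    · intro x hx
      obtain ⟨c, hc⟩ := exists_smul_eq_of_trace_eq_zero h2 z.ne_zero hz (Finset.mem_filter.1 hx).2
      have hc0 : c ≠ 0 := by
        rintro rfl
        exact x.ne_zero (by rw [← hc, zero_smul])
      refine ⟨Units.mk0 c hc0, Finset.mem_univ _, Units.ext ?_⟩
      rw [Units.val_mul, hιval, Units.val_mk0, ← Algebra.smul_def, hc]
    · intro y _
      rw [map_mul, hβK, one_mul]
  have hne : (Fintype.card Kˣ : ℂ) ≠ 0 := Nat.cast_ne_zero.2 Fintype.card_ne_zero
  apply mul_left_cancel₀ hne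
  calc (Fintype.card Kˣ : ℂ) * ∑ x : Lˣ, ((β x : ℂ))⁻¹ * φ (Algebra.trace K L x)
      = ∑ y : Kˣ, ∑ x : Lˣ, ((β x : ℂ))⁻¹ * φ (y * Algebra.trace K L x) := by
        simp_rw [← hscale]
        simp
    _ = ∑ x : Lˣ, ((β x : ℂ))⁻¹ *
          ((if Algebra.trace K L (x : L) = 0 then (Fintype.card K : ℂ) else 0) - 1) := by
        rw [Finset.sum_comm]
        simp_rw [← Finset.mul_sum, hunits]
    _ = (∑ x ∈ ({x : Lˣ | Algebra.trace K L (x : L) = 0} : Finset Lˣ), ((β x : ℂ))⁻¹) *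
          Fintype.card K := by
        simp_rw [mul_sub, mul_one, Finset.sum_sub_distrib, hsum, sub_zero, mul_ite, mul_zero]
        rw [← Finset.sum_filter, Finset.sum_mul]
    _ = (Fintype.card Kˣ : ℂ) * (Fintype.card K * ((β z : ℂ))⁻¹) := by
        rw [hker, Finset.sum_const, Finset.card_univ, nsmul_eq_mul]
        ring


noncomputable section

open scoped BigOperators

/-- the Gauss sum of a nontrivial multiplicative character of `F_{q^{2m}}`
which is trivial on `F_{q^m}ˣ`. -/
theorem gauss_sum_even_extension
    (F Km K2m : Type) [Field F] [Fintype F]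
    [Field Km] [Fintype Km] [DecidableEq Km]
    [Field K2m] [Fintype K2m] [DecidableEq K2m]
    [Algebra F Km] [Algebra F K2m] [Algebra Km K2m] [IsScalarTower F Km K2m]
    (ψ : AddChar F ℂ) (hψ : ψ ≠ 1)
    (m : ℕ) (hm : 1 ≤ m)
    (hKm : Module.finrank F Km = m) (hK2m : Module.finrank F K2m = 2 * m)
    (β : K2mˣ →* ℂˣ) (hβ : β ≠ 1)
    (hβtriv : ∀ x : Kmˣ, β (Units.map ((algebraMap Km K2m) : Km →+* K2m).toMonoidHom x) = 1)
    (z : K2mˣ) (hz : (z : K2m) ^ (Fintype.card F ^ m - 1) = -1) :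
    (∑ x : K2mˣ, ((β x : ℂ))⁻¹ * ψ (Algebra.trace F K2m (x : K2m))) =
        (Fintype.card F : ℂ) ^ m * ((β z : ℂ))⁻¹ ∧
      tau β (fun x => ψ (Algebra.trace F K2m x)) =
        -((Fintype.card F : ℂ) ^ m) * ((β z : ℂ))⁻¹ := by
  have hF : FiniteDimensional F Km := Module.finite_of_finrank_pos (by omega)
  have h2 : Module.finrank Km K2m = 2 := by
    have h := Module.finrank_mul_finrank F Km K2m
    rw [hKm, hK2m, mul_comm 2 m] at h
    exact Nat.eq_of_mul_eq_mul_left hm h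
  have hcard : Fintype.card Km = Fintype.card F ^ m := by
    rw [Module.card_eq_pow_finrank (K := F), hKm]
  let φ : AddChar Km ℂ := ψ.compAddMonoidHom (Algebra.trace F Km).toAddMonoidHom
  have hφ : φ ≠ 1 := fun h => hψ <| by
    ext a
    obtain ⟨b, rfl⟩ := Algebra.trace_surjective F Km a
    exact DFunLike.congr_fun h b
  have hsum : (∑ x : K2mˣ, ((β x : ℂ))⁻¹ * ψ (Algebra.trace F K2m (x : K2m))) =
      (Fintype.card F : ℂ) ^ m * ((β z : ℂ))⁻¹ := by
    have h := gauss_sum_quadratic_extension h2 hφ hβ hβtriv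
      (trace_eq_zero_of_pow_card_sub_one h2 (by rw [hcard, hz]))
    rw [hcard, Nat.cast_pow] at h
    rw [← h]
    refine Finset.sum_congr rfl fun x _ => ?_
    rw [← Algebra.trace_trace (S := Km)]
    rfl
  exact ⟨hsum, by rw [tau, hsum, neg_mul]⟩
end
end

section
/- Let F be a finite field with q elements, ψ a nontrivial additive character of F, n ≥ 1, and let α : F_{q^n}^× → ℂ^× be a regular multiplicative character, i.e. the n characters x ↦ α(x^{q^i}) for 0 ≤ i ≤ n−1 are pairwise distinct. Then Π_{i=0}^{n−1} τ(α^{1−q^i}, ψ_n) = (−1)^{n+1} · α(−1)^{n−1} · q^{n(n−1)/2}, where α^{1−q^i} denotes the multiplicative character ξ ↦ α(ξ) · α(ξ^{q^i})^{-1}. -/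
noncomputable section

open scoped BigOperators

theorem sum_eq_add_sum_units {k M : Type*} [Field k] [Fintype k] [DecidableEq k]
    [AddCommMonoid M] (f : k → M) : ∑ c, f c = f 0 + ∑ c : kˣ, f c := by
  rw [Fintype.sum_eq_add_sum_subtype_ne f 0]
  congr 1
  exact (Fintype.sum_equiv unitsEquivNeZero _ _ fun _ => rfl).symm

/-- The sum of a nontrivial character of a finite group vanishes. -/
theorem sum_units_inv_eq_zero {G : Type*} [Group G] [Fintype G] {γ : G →* ℂˣ}
    (hγ : γ ≠ 1) : ∑ ξ, ((γ ξ : ℂ))⁻¹ = 0 := by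
  have h : (Units.coeHom ℂ).comp γ⁻¹ ≠ 1 := by
    contrapose! hγ
    ext ξ
    simpa using DFunLike.congr_fun hγ ξ
  simpa using sum_hom_units_eq_zero _ h

/-- The trace form of a finite extension of finite fields turns a nontrivial additive character
into a nontrivial one. -/
theorem compTrace_ne_one {F K : Type*} [Field F] [Finite F] [Field K] [Algebra F K]
    [FiniteDimensional F K] {ψ : AddChar F ℂ} (hψ : ψ ≠ 1) :
    ψ.compAddMonoidHom (Algebra.trace F K).toAddMonoidHom ≠ 1 := by
  contrapose! hψ
  ext c
  obtain ⟨x, rfl⟩ := Algebra.trace_surjective F K c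
  simpa using DFunLike.congr_fun hψ x

theorem tau_eq_neg_gaussSum {K : Type} [Field K] [Fintype K] [DecidableEq K] (γ : Kˣ →* ℂˣ)
    (Ψ : AddChar K ℂ) : tau γ Ψ = -gaussSum (MulChar.ofUnitHom γ⁻¹) Ψ := by
  rw [tau, gaussSum, sum_eq_add_sum_units (fun a : K => _ * Ψ a),
    MulChar.map_zero]
  simp

theorem tau_one {K : Type} [Field K] [Fintype K] [DecidableEq K] {Ψ : AddChar K ℂ}
    (hΨ : Ψ ≠ 1) : tau 1 Ψ = 1 := by
  have h := AddChar.sum_eq_zero_of_ne_one hΨ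
  rw [sum_eq_add_sum_units, AddChar.map_zero_eq_one] at h
  simp only [tau, MonoidHom.one_apply, Units.val_one, inv_one, one_mul]
  linear_combination -h

theorem tau_mul_tau_inv {K : Type} [Field K] [Fintype K] [DecidableEq K] {γ : Kˣ →* ℂˣ}
    (hγ : γ ≠ 1) {Ψ : AddChar K ℂ} (hΨ : Ψ ≠ 1) :
    tau γ Ψ * tau γ⁻¹ Ψ = γ (-1) * Fintype.card K := by
  set χ : MulChar K ℂ := MulChar.ofUnitHom γ⁻¹ with hχ
  have hχ1 : χ ≠ 1 := by
    contrapose! hγ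
    ext ξ
    have := congrArg (fun φ : MulChar K ℂ => φ ξ) hγ
    simpa [hχ] using this
  have hinv : MulChar.ofUnitHom γ = χ⁻¹ := by
    ext ξ
    simp [hχ, MulChar.inv_apply_eq_inv]
  have hneg : χ⁻¹ (-1) = γ (-1) := by
    rw [← hinv, ← Units.coe_neg_one, MulChar.ofUnitHom_coe]
  rw [tau_eq_neg_gaussSum, tau_eq_neg_gaussSum, inv_inv, hinv, neg_mul_neg,
    ← mul_gaussSum_inv_eq_gaussSum χ⁻¹, mul_left_comm,
    gaussSum_mul_gaussSum_eq_card hχ1 (AddChar.IsPrimitive.of_ne_one hΨ), hneg]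

/-- Gauss sums of Frobenius-conjugate characters agree. -/
theorem tau_comp_powMonoidHom {F K : Type} [Field F] [Fintype F] [Field K] [Fintype K]
    [DecidableEq K] [Algebra F K] (γ : Kˣ →* ℂˣ) (f : F → ℂ) (i : ℕ) :
    tau (γ.comp (powMonoidHom (Fintype.card F ^ i))) (fun x => f (Algebra.trace F K x)) =
      tau γ (fun x => f (Algebra.trace F K x)) := by
  let σ : K ≃ₐ[F] K := FiniteField.frobeniusAlgEquivOfAlgebraic F K ^ i
  have hσ (x : K) : σ x = x ^ Fintype.card F ^ i := by
    simp only [σ]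
    rw [AlgEquiv.coe_pow, FiniteField.coe_frobeniusAlgEquivOfAlgebraic_iterate]
  rw [tau, tau, neg_inj]
  refine Fintype.sum_equiv (Units.mapEquiv (σ : K ≃* K)).toEquiv _ _ fun ξ => ?_
  have hξ : Units.mapEquiv (σ : K ≃* K) ξ = ξ ^ Fintype.card F ^ i := by
    ext
    exact (hσ ξ).trans (Units.val_pow_eq_pow_val _ _).symm
  have htr : Algebra.trace F K ((ξ : K) ^ Fintype.card F ^ i) = Algebra.trace F K ξ := by
    rw [← hσ, Algebra.trace_eq_of_algEquiv]
  simp [hξ, htr]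

/-- Stickelberger's evaluation of the Gauss sum over a quadratic extension `K / k` of a character
that is trivial on the units of `k`. -/
theorem tau_of_trivial_on_subfield {k K : Type} [Field k] [Fintype k] [Field K] [Fintype K]
    [DecidableEq K] [Algebra k K] (h2 : Module.finrank k K = 2) {ψ : AddChar k ℂ} (hψ : ψ ≠ 1)
    {γ : Kˣ →* ℂˣ} (hγ : γ ≠ 1) (hk : ∀ c : kˣ, γ (Units.map (algebraMap k K) c) = 1)
    {x₀ : Kˣ} (hx₀ : Algebra.trace k K x₀ = 0) :
    tau γ (fun x => ψ (Algebra.trace k K x)) = -(Fintype.card k * ((γ x₀ : ℂ))⁻¹) := by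
  classical
  have hker : Module.finrank k (LinearMap.ker (Algebra.trace k K)) = 1 := by
    have h := (Algebra.trace k K).finrank_range_add_finrank_ker
    rw [LinearMap.range_eq_top.2 (Algebra.trace_surjective k K), finrank_top,
      Module.finrank_self, h2] at h
    omega
  have hspan (x : K) (hx : Algebra.trace k K x = 0) : ∃ c : k, c • (x₀ : K) = x := by
    obtain ⟨c, hc⟩ := exists_smul_eq_of_finrank_eq_one hker
      (x := (⟨x₀, hx₀⟩ : LinearMap.ker (Algebra.trace k K)))
      (by simp [Subtype.ext_iff]) ⟨x, hx⟩
    exact ⟨c, congrArg Subtype.val hc⟩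
  set S : ℂ := ∑ ξ : Kˣ, ((γ ξ : ℂ))⁻¹ * ψ (Algebra.trace k K ξ)
  have hshift (c : kˣ) :
      ∑ ξ : Kˣ, ((γ ξ : ℂ))⁻¹ * ψ (c * Algebra.trace k K ξ) = S := by
    refine Fintype.sum_equiv (Equiv.mulLeft (Units.map (algebraMap k K : k →* K) c)) _ _
      fun ξ => ?_
    have : γ (Units.map (algebraMap k K : k →* K) c) = 1 := hk c
    simp [this, ← Algebra.smul_def]
  have hinner (x : K) : ∑ c : kˣ, ψ (c * Algebra.trace k K x) =
      (if Algebra.trace k K x = 0 then (Fintype.card k : ℂ) else 0) - 1 := by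
    have h := AddChar.sum_mulShift (Algebra.trace k K x) (AddChar.IsPrimitive.of_ne_one hψ)
    rw [sum_eq_add_sum_units, zero_mul, AddChar.map_zero_eq_one] at h
    rw [eq_sub_iff_add_eq', h]
    split_ifs <;> simp
  have hzero : ∑ ξ : Kˣ, ((γ ξ : ℂ))⁻¹ * (if Algebra.trace k K ξ = 0 then 1 else 0) =
      Fintype.card kˣ * ((γ x₀ : ℂ))⁻¹ := by
    simp only [mul_ite, mul_one, mul_zero]
    rw [← Finset.sum_filter, ← nsmul_eq_mul, ← Finset.card_univ, ← Finset.sum_const]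
    symm
    refine Finset.sum_bij (fun c _ => Units.map (algebraMap k K : k →* K) c * x₀)
      (fun c _ => ?_) (fun c _ d _ h => ?_) (fun ξ hξ => ?_) (fun c _ => ?_)
    · simp [← Algebra.smul_def, hx₀]
    · exact Units.map_injective (algebraMap k K).injective (mul_right_cancel h)
    · obtain ⟨c, hc⟩ := hspan ξ (by simpa using hξ)
      have hc0 : c ≠ 0 := by
        rintro rfl
        exact ξ.ne_zero (by simpa using hc.symm)
      refine ⟨Units.mk0 c hc0, Finset.mem_univ _, Units.ext ?_⟩
      simpa [Algebra.smul_def] using hc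
    · have : γ (Units.map (algebraMap k K : k →* K) c) = 1 := hk c
      simp [this]
  have hmain : (Fintype.card kˣ : ℂ) * S =
      Fintype.card kˣ * (Fintype.card k * ((γ x₀ : ℂ))⁻¹) := calc
    _ = ∑ c : kˣ, ∑ ξ : Kˣ, ((γ ξ : ℂ))⁻¹ * ψ (c * Algebra.trace k K ξ) := by
      simp [hshift]
    _ = ∑ ξ : Kˣ, (Fintype.card k * (((γ ξ : ℂ))⁻¹ *
          (if Algebra.trace k K ξ = 0 then 1 else 0)) - ((γ ξ : ℂ))⁻¹) := by
      rw [Finset.sum_comm]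
      refine Finset.sum_congr rfl fun ξ _ => ?_
      rw [← Finset.mul_sum, hinner]
      split_ifs <;> ring
    _ = _ := by
      rw [Finset.sum_sub_distrib, ← Finset.mul_sum, hzero, sum_units_inv_eq_zero hγ]
      ring
  rw [tau, neg_inj]
  exact mul_left_cancel₀ (Nat.cast_ne_zero.2 Fintype.card_ne_zero) hmain

/-- For `[K : F] = 2m`, the Gauss sum of `α ^ (1 - q ^ m)` is `-α(-1) q ^ m`. -/
theorem tau_middle {F K : Type} [Field F] [Fintype F] [Field K] [Fintype K] [DecidableEq K]
    [Algebra F K] {ψ : AddChar F ℂ} (hψ : ψ ≠ 1) {m : ℕ} (hm : Module.finrank F K = 2 * m)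
    {α : Kˣ →* ℂˣ} (hα : α * (α.comp (powMonoidHom (Fintype.card F ^ m)))⁻¹ ≠ 1) :
    tau (α * (α.comp (powMonoidHom (Fintype.card F ^ m)))⁻¹)
      (fun x => ψ (Algebra.trace F K x)) = -(α (-1) * (Fintype.card F : ℂ) ^ m) := by
  classical
  have hm0 : m ≠ 0 := by
    rintro rfl
    exact (Module.finrank_pos (R := F) (M := K)).ne' hm
  let φ := FiniteField.frobeniusAlgEquivOfAlgebraic F K ^ m
  have hord : orderOf φ = 2 := by
    rw [orderOf_pow, FiniteField.orderOf_frobeniusAlgEquivOfAlgebraic, hm,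
      Nat.gcd_mul_left_left, Nat.mul_div_cancel _ (Nat.pos_of_ne_zero hm0)]
  let k : IntermediateField F K := IntermediateField.fixedField (Subgroup.zpowers φ)
  let : Fintype k := Fintype.ofFinite k
  have h2 : Module.finrank k K = 2 := by
    rw [IntermediateField.finrank_fixedField_eq_card, Nat.card_zpowers, hord]
  have hcard : Fintype.card k = Fintype.card F ^ m := by
    have h := Module.finrank_mul_finrank F k K
    rw [h2, hm] at h
    rw [Module.card_eq_pow_finrank (K := F) (V := k)]
    congr 1
    omega
  have htower (x : K) : ψ (Algebra.trace F K x) =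
      ψ.compAddMonoidHom (Algebra.trace F k).toAddMonoidHom (Algebra.trace k K x) := by
    simp
  have hpow (c : k) : c ^ Fintype.card F ^ m = c := by
    rw [← hcard, FiniteField.pow_card]
  obtain ⟨x₀, hx₀, hx₀'⟩ : ∃ x₀ : K, x₀ ≠ 0 ∧ Algebra.trace k K x₀ = 0 := by
    have h := (Algebra.trace k K).finrank_range_add_finrank_ker
    rw [LinearMap.range_eq_top.2 (Algebra.trace_surjective k K), finrank_top,
      Module.finrank_self, h2] at h
    have : LinearMap.ker (Algebra.trace k K) ≠ ⊥ := by
      intro hbot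
      rw [hbot, finrank_bot] at h
      omega
    obtain ⟨x, hx, hx0⟩ := Submodule.exists_mem_ne_zero_of_ne_bot this
    exact ⟨x, hx0, hx⟩
  have hneg : x₀ ^ Fintype.card F ^ m = -x₀ := by
    have h := FiniteField.algebraMap_trace_eq_sum_pow k K x₀
    rw [hx₀', h2, Finset.sum_range_succ, Finset.sum_range_one, Nat.card_eq_fintype_card,
      hcard, map_zero] at h
    simpa using eq_neg_of_add_eq_zero_right h.symm
  have hu : (Units.mk0 x₀ hx₀) ^ Fintype.card F ^ m = -1 * Units.mk0 x₀ hx₀ := by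
    ext
    simp [hneg]
  simp only [htower]
  rw [tau_of_trivial_on_subfield h2 (compTrace_ne_one hψ) hα (fun c => ?_)
    (x₀ := Units.mk0 x₀ hx₀) hx₀', hcard]
  · have h1 : (α (-1) : ℂ) * α (-1) = 1 := by
      rw [← Units.val_mul, ← map_mul]
      simp
    simp only [MonoidHom.mul_apply, MonoidHom.inv_apply, MonoidHom.comp_apply,
      powMonoidHom_apply, hu, map_mul]
    simp [mul_comm]
  · have hc : c ^ Fintype.card F ^ m = c := by
      ext
      simpa using congrArg Subtype.val (hpow c)
    rw [MonoidHom.mul_apply, MonoidHom.inv_apply, MonoidHom.comp_apply, powMonoidHom_apply,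
      ← map_pow, hc, mul_inv_cancel]

/-- for a regular multiplicative character `α` of `F_{q^n}`,
`Π_{i=0}^{n-1} τ(α^{1-q^i}, ψ_n) = (-1)^{n+1} α(-1)^{n-1} q^{n(n-1)/2}`. -/
theorem gauss_sum_product_regular_character
    (F Kn : Type) [Field F] [Fintype F]
    [Field Kn] [Fintype Kn] [DecidableEq Kn] [Algebra F Kn]
    (ψ : AddChar F ℂ) (hψ : ψ ≠ 1)
    (n : ℕ) (hn : 1 ≤ n) (hKn : Module.finrank F Kn = n)
    (α : Knˣ →* ℂˣ)
    (hreg : ∀ i j : ℕ, i < n → j < n →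
        α.comp (powMonoidHom (Fintype.card F ^ i)) =
          α.comp (powMonoidHom (Fintype.card F ^ j)) → i = j) :
    ∏ i ∈ Finset.range n,
        tau (α * (α.comp (powMonoidHom (Fintype.card F ^ i)))⁻¹)
          (fun x => ψ (Algebra.trace F Kn x)) =
      (-1 : ℂ) ^ (n + 1) * ((α (-1) : ℂ)) ^ (n - 1) *
        (Fintype.card F : ℂ) ^ (n * (n - 1) / 2) := by
  classical
  set q := Fintype.card F
  set Ψ : AddChar Kn ℂ := ψ.compAddMonoidHom (Algebra.trace F Kn).toAddMonoidHom
  have hΨ : Ψ ≠ 1 := compTrace_ne_one hψ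
  have hcoe : (fun x => ψ (Algebra.trace F Kn x)) = Ψ := rfl
  have hcardK : Fintype.card Kn = q ^ n := hKn ▸ Module.card_eq_pow_finrank
  set γ : ℕ → Knˣ →* ℂˣ := fun i => α * (α.comp (powMonoidHom (q ^ i)))⁻¹ with hγdef
  set t : ℕ → ℂ := fun i => tau (γ i) (fun x => ψ (Algebra.trace F Kn x)) with ht
  have hγ (i : ℕ) (hi0 : i ≠ 0) (hi : i < n) : γ i ≠ 1 := by
    intro h
    refine hi0 (hreg 0 i hn hi ?_).symm
    rw [← mul_inv_eq_one, ← h]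
    ext
    simp [hγdef]
  have hα1 : (α (-1) : ℂ) ^ 2 = 1 := by
    rw [← Units.val_pow_eq_pow_val, ← map_pow]
    simp
  have hneg (i : ℕ) : (-1 : Knˣ) ^ q ^ i = -1 := by
    let σ : Kn ≃ₐ[F] Kn := FiniteField.frobeniusAlgEquivOfAlgebraic F Kn ^ i
    have hσ : σ (-1) = (-1) ^ q ^ i := by
      simp only [σ]
      rw [AlgEquiv.coe_pow, FiniteField.coe_frobeniusAlgEquivOfAlgebraic_iterate]
    ext
    simpa using hσ.symm
  have ht0 : t 0 = 1 := by
    have : γ 0 = 1 := by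
      ext
      simp [hγdef]
    simp only [ht, this, hcoe, tau_one hΨ]
  have hpair (i j : ℕ) (hi : i ≠ 0) (hj : j ≠ 0) (hij : i + j = n) : t i * t j = (q : ℂ) ^ n := by
    have hconj : (γ j).comp (powMonoidHom (q ^ i)) = (γ i)⁻¹ := by
      ext ξ
      have h : (ξ ^ q ^ i) ^ q ^ j = ξ := by
        ext
        rw [← pow_mul, ← pow_add, hij, ← hcardK]
        simp [FiniteField.pow_card]
      simp [hγdef, h, -map_pow]
    have htj : t j = tau (γ i)⁻¹ Ψ := by
      simp only [ht]
      rw [← tau_comp_powMonoidHom (γ j) ψ i, hconj, hcoe]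
    have hval : γ i (-1) = 1 := by
      simp only [hγdef, MonoidHom.mul_apply, MonoidHom.inv_apply, MonoidHom.comp_apply,
        powMonoidHom_apply, hneg, mul_inv_cancel]
    rw [htj]
    simp only [ht, hcoe]
    rw [tau_mul_tau_inv (hγ i hi (by omega)) hΨ, hval, hcardK]
    simp
  change ∏ i ∈ Finset.range n, t i = _
  obtain ⟨l, rfl | rfl⟩ : ∃ l, n = 2 * l + 1 ∨ n = 2 * l + 2 := ⟨(n - 1) / 2, by omega⟩
  · have hprod : ∏ i ∈ Finset.range (2 * l + 1), t i =
        ∏ i ∈ Finset.range l, t (i + 1) * t (l + (l - 1 - i) + 1) := by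
      rw [Finset.prod_range_succ', ht0, mul_one, two_mul, Finset.prod_range_add,
        Finset.prod_mul_distrib, Finset.prod_range_reflect (fun i => t (l + i + 1))]
    rw [hprod, Finset.prod_congr rfl fun i hi => hpair _ _ (by omega) (by omega) (by
      have := Finset.mem_range.1 hi; omega)]
    have h1 : (2 * l + 1) * (2 * l + 1 - 1) / 2 = (2 * l + 1) * l := by
      rw [Nat.add_sub_cancel, mul_left_comm, Nat.mul_div_cancel_left _ two_pos]
    have h2 : (-1 : ℂ) ^ (2 * l + 1 + 1) = 1 := Even.neg_one_pow ⟨l + 1, by ring⟩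
    rw [h1, h2, Nat.add_sub_cancel, pow_mul _ 2 l, hα1]
    simp [pow_mul]
  · have hmid : t (l + 1) = -(α (-1) * (q : ℂ) ^ (l + 1)) :=
      tau_middle hψ (hKn.trans (by ring)) (hγ (l + 1) (by omega) (by omega))
    have hprod : ∏ i ∈ Finset.range (2 * l + 2), t i =
        t (l + 1) * ∏ i ∈ Finset.range l, t (i + 1) * t (l + 1 + (l - 1 - i) + 1) := by
      rw [Finset.prod_range_succ', ht0, mul_one, show 2 * l + 1 = l + 1 + l by ring,
        Finset.prod_range_add, Finset.prod_range_succ, Finset.prod_mul_distrib,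
        Finset.prod_range_reflect (fun i => t (l + 1 + i + 1))]
      ring
    rw [hprod, hmid, Finset.prod_congr rfl fun i hi => hpair _ _ (by omega) (by omega) (by
      have := Finset.mem_range.1 hi; omega)]
    have h1 : (2 * l + 2) * (2 * l + 2 - 1) / 2 = (l + 1) + (2 * l + 2) * l := by
      rw [show (2 * l + 2) * (2 * l + 2 - 1) = 2 * ((l + 1) + (2 * l + 2) * l) by
        rw [show 2 * l + 2 - 1 = 2 * l + 1 by omega]; ring, Nat.mul_div_cancel_left _ two_pos]
    have h2 : (-1 : ℂ) ^ (2 * l + 2 + 1) = -1 := Odd.neg_one_pow ⟨l + 1, by ring⟩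
    rw [h1, h2, show 2 * l + 2 - 1 = 2 * l + 1 by omega, pow_succ (α (-1) : ℂ), pow_mul _ 2 l, hα1,
      one_pow, one_mul, Finset.prod_const, Finset.card_range]
    ring
end
end

section
/- Let F be a finite field with q elements and ψ a nontrivial additive character of F. Let n, m ≥ 1, and let d' | n and u' | m be positive divisors. Let α' : F_{q^{d'}}^× → ℂ^× and β' : F_{q^{u'}}^× → ℂ^× be multiplicative characters and set α = α' ∘ N_{F_{q^n}/F_{q^{d'}}} and β = β' ∘ N_{F_{q^m}/F_{q^{u'}}}. Then Π_{k=1}^{gcd(n,m)} τ( (α ∘ N_{F_{q^{lcm(n,m)}}/F_{q^n}}) · (β^{q^k} ∘ N_{F_{q^{lcm(n,m)}}/F_{q^m}}), ψ_{lcm(n,m)} ) = [ Π_{k=1}^{gcd(d',u')} τ( (α' ∘ N_{F_{q^{lcm(d',u')}}/F_{q^{d'}}}) · (β'^{q^k} ∘ N_{F_{q^{lcm(d',u')}}/F_{q^{u'}}}), ψ_{lcm(d',u')} ) ]^{nm/(d'u')}, where γ^{q^k} denotes the character x ↦ γ(x^{q^k}). -/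
noncomputable section

open scoped BigOperators

open Polynomial

namespace HasseDavenport

section Polynomials

variable {F : Type*} [Field F] (χ : MulChar F ℂ) (ψ : AddChar F ℂ)

/-- The completely multiplicative function on monic polynomials attached to `χ` and `ψ`: on
`∏ (X - rᵢ)` its value is `χ (∏ rᵢ) * ψ (∑ rᵢ)`. -/
def charValue (f : F[X]) : ℂ :=
  χ ((-1) ^ f.natDegree * f.coeff 0) * ψ (-f.nextCoeff)

lemma charValue_one : charValue χ ψ 1 = 1 := by
  simp [charValue, nextCoeff]

lemma charValue_mul {f g : F[X]} (hf : f.Monic) (hg : g.Monic) :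
    charValue χ ψ (f * g) = charValue χ ψ f * charValue χ ψ g := by
  simp only [charValue, hf.natDegree_mul hg, mul_coeff_zero, hf.nextCoeff_mul hg, neg_add,
    AddChar.map_add_eq_mul, pow_add, map_mul]
  ring

lemma charValue_pow {f : F[X]} (hf : f.Monic) (j : ℕ) :
    charValue χ ψ (f ^ j) = charValue χ ψ f ^ j := by
  induction j with
  | zero => simp [charValue_one]
  | succ j ih => rw [pow_succ, charValue_mul χ ψ (hf.pow j) hf, ih, pow_succ]

lemma charValue_X_sub_C (a : F) : charValue χ ψ (X - C a) = χ a * ψ a := by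
  simp [charValue]

lemma charValue_add_C_mul_X_pow {f : F[X]} {n : ℕ} (hn : f.natDegree = n + 2) (a : F) :
    charValue χ ψ (f + C a * X ^ (n + 1)) = charValue χ ψ f * ψ (-a) := by
  have hlt : (C a * X ^ (n + 1)).natDegree < f.natDegree := by
    have := natDegree_C_mul_X_pow_le a (n + 1)
    omega
  have hdeg : (f + C a * X ^ (n + 1)).natDegree = f.natDegree :=
    natDegree_add_eq_left_of_natDegree_lt hlt
  rw [charValue, charValue, nextCoeff_of_natDegree_pos (by omega),
    nextCoeff_of_natDegree_pos (by omega), hdeg, hn]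
  simp [AddChar.map_add_eq_mul, coeff_X_pow, mul_assoc, mul_comm (ψ (-a))]

end Polynomials

section Finite

variable {F : Type*} [Field F] [Finite F] (χ : MulChar F ℂ) (ψ : AddChar F ℂ)

lemma finite_setOf_natDegree_le (n : ℕ) : {f : F[X] | f.natDegree ≤ n}.Finite := by
  have : Finite (degreeLT F (n + 1)) :=
    Finite.of_equiv _ (degreeLTEquiv F (n + 1)).symm.toEquiv
  refine (Set.toFinite (degreeLT F (n + 1) : Set F[X])).subset fun f hf => ?_
  exact mem_degreeLT.2 ((degree_le_of_natDegree_le hf).trans_lt (mod_cast n.lt_succ_self))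

variable (F) in
/-- The monic polynomials of degree `n`. -/
def monics (n : ℕ) : Finset F[X] :=
  ((finite_setOf_natDegree_le n).subset
    (fun _ hf => hf.2.le : {f : F[X] | f.Monic ∧ f.natDegree = n} ⊆ _)).toFinset

variable (F) in
/-- The monic irreducible polynomials of degree at most `n`. -/
def irreds (n : ℕ) : Finset F[X] :=
  ((finite_setOf_natDegree_le n).subset
    (fun _ hf => hf.2.2 : {f : F[X] | f.Monic ∧ Irreducible f ∧ f.natDegree ≤ n} ⊆ _)).toFinset

@[simp] lemma mem_monics {n : ℕ} {f : F[X]} : f ∈ monics F n ↔ f.Monic ∧ f.natDegree = n := by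
  simp [monics]

@[simp] lemma mem_irreds {n : ℕ} {f : F[X]} :
    f ∈ irreds F n ↔ f.Monic ∧ Irreducible f ∧ f.natDegree ≤ n := by
  simp [irreds]

lemma sum_monics_zero : ∑ f ∈ monics F 0, charValue χ ψ f = 1 := by
  have : monics F 0 = {1} := by
    ext f
    simp only [mem_monics, Finset.mem_singleton]
    exact ⟨fun h => h.1.natDegree_eq_zero.1 h.2, fun h => by simp [h]⟩
  rw [this, Finset.sum_singleton, charValue_one]

lemma sum_monics_one [Fintype F] :
    ∑ f ∈ monics F 1, charValue χ ψ f = ∑ a : F, χ a * ψ a := by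
  symm
  refine Finset.sum_bij (fun a _ => X - C a) (fun a _ => ?_) (fun a _ b _ h => ?_)
    (fun f hf => ?_) (fun a _ => (charValue_X_sub_C χ ψ a).symm)
  · simp [monic_X_sub_C]
  · simpa using h
  · rw [mem_monics] at hf
    refine ⟨-f.coeff 0, Finset.mem_univ _, ?_⟩
    conv_rhs => rw [hf.1.eq_X_add_C hf.2]
    simp

lemma sum_monics_add_two (hψ : ψ ≠ 1) (n : ℕ) :
    ∑ f ∈ monics F (n + 2), charValue χ ψ f = 0 := by
  obtain ⟨a, ha⟩ := AddChar.ne_one_iff.1 hψ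
  have hmem : ∀ b : F, ∀ f ∈ monics F (n + 2), f + C b * X ^ (n + 1) ∈ monics F (n + 2) := by
    intro b f hf
    rw [mem_monics] at hf ⊢
    have hlt : (C b * X ^ (n + 1)).natDegree < f.natDegree := by
      have := natDegree_C_mul_X_pow_le b (n + 1)
      omega
    exact ⟨hf.1.add_of_left (degree_lt_degree hlt),
      (natDegree_add_eq_left_of_natDegree_lt hlt).trans hf.2⟩
  have key : ∑ f ∈ monics F (n + 2), charValue χ ψ f * ψ a =
      ∑ f ∈ monics F (n + 2), charValue χ ψ f := by
    refine Finset.sum_bij' (fun f _ => f + C (-a) * X ^ (n + 1))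
      (fun f _ => f + C a * X ^ (n + 1)) (hmem _) (hmem _) ?_ ?_ ?_
    · intro f _; simp
    · intro f _; simp
    · intro f hf
      rw [mem_monics] at hf
      rw [charValue_add_C_mul_X_pow χ ψ hf.2, neg_neg]
  rw [← Finset.sum_mul] at key
  by_contra h
  exact ha (mul_left_cancel₀ h (key.trans (mul_one _).symm))

open UniqueFactorizationMonoid in
open scoped Classical in
lemma natDegree_eq_sum_irreds {n : ℕ} {f : F[X]} (hfn : f ∈ monics F n) :
    n = ∑ P ∈ irreds F n, ∑ j ∈ Finset.Icc 1 n, if P ^ j ∣ f then P.natDegree else 0 := by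
  obtain ⟨hf, rfl⟩ := mem_monics.1 hfn
  have hcount : ∀ P ∈ irreds F f.natDegree,
      (∑ j ∈ Finset.Icc 1 f.natDegree, if P ^ j ∣ f then P.natDegree else 0) =
        (normalizedFactors f).count P * P.natDegree := by
    intro P hP
    obtain ⟨hPm, hPi, -⟩ := mem_irreds.1 hP
    have hdvd : ∀ j, P ^ j ∣ f ↔ j ≤ (normalizedFactors f).count P := by
      intro j
      have := emultiplicity_eq_count_normalizedFactors hPi hf.ne_zero
      rw [hPm.normalize_eq_self] at this
      rw [pow_dvd_iff_le_emultiplicity, this, Nat.cast_le]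
    have hle : (normalizedFactors f).count P ≤ f.natDegree := by
      have h1 := natDegree_le_of_dvd ((hdvd _).2 le_rfl) hf.ne_zero
      rw [natDegree_pow] at h1
      exact (Nat.le_mul_of_pos_right _ hPi.natDegree_pos).trans h1
    rw [← Finset.sum_filter, Finset.sum_const, smul_eq_mul]
    congr 1
    have : {j ∈ Finset.Icc 1 f.natDegree | P ^ j ∣ f} =
        Finset.Icc 1 ((normalizedFactors f).count P) := by
      ext j
      simp only [Finset.mem_filter, Finset.mem_Icc, hdvd]
      omega
    rw [this, Nat.card_Icc, Nat.add_sub_cancel]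
  rw [Finset.sum_congr rfl hcount]
  have hmonic : ∀ P ∈ normalizedFactors f, P.Monic := fun P hP => by
    have h := normalize_normalized_factor P hP
    rw [← h]
    exact monic_normalize (irreducible_of_normalized_factor P hP).ne_zero
  have hprod : (normalizedFactors f).prod = f := by
    rw [prod_normalizedFactors_eq hf.ne_zero, hf.normalize_eq_self]
  conv_lhs => rw [← hprod, natDegree_multiset_prod_of_monic _ hmonic,
    Finset.sum_multiset_map_count]
  simp only [smul_eq_mul]
  refine Finset.sum_subset (fun P hP => ?_) (fun P _ hP => ?_)
  · rw [Multiset.mem_toFinset] at hP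
    exact mem_irreds.2 ⟨hmonic P hP, irreducible_of_normalized_factor P hP,
      natDegree_le_of_dvd (dvd_of_mem_normalizedFactors hP) hf.ne_zero⟩
  · rw [Multiset.mem_toFinset] at hP
    simp [Multiset.count_eq_zero_of_notMem hP]

open scoped Classical in
lemma sum_monics_of_dvd {Q : F[X]} (hQ : Q.Monic) (n : ℕ) :
    (∑ f ∈ monics F n, if Q ∣ f then charValue χ ψ f else 0) =
      if Q.natDegree ≤ n then
        charValue χ ψ Q * ∑ g ∈ monics F (n - Q.natDegree), charValue χ ψ g else 0 := by
  rw [← Finset.sum_filter]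
  split_ifs with h
  · rw [Finset.mul_sum]
    symm
    refine Finset.sum_bij (fun g _ => Q * g) (fun g hg => ?_) (fun a _ b _ hab => ?_)
      (fun f hf => ?_) (fun g hg => (charValue_mul χ ψ hQ (mem_monics.1 hg).1).symm)
    · rw [mem_monics] at hg
      rw [Finset.mem_filter, mem_monics, hQ.natDegree_mul hg.1]
      exact ⟨⟨hQ.mul hg.1, by omega⟩, dvd_mul_right _ _⟩
    · exact mul_left_cancel₀ hQ.ne_zero hab
    · rw [Finset.mem_filter, mem_monics] at hf
      obtain ⟨⟨hfm, hfd⟩, g, rfl⟩ := hf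
      have hg := hQ.of_mul_monic_left hfm
      rw [hQ.natDegree_mul hg] at hfd
      exact ⟨g, mem_monics.2 ⟨hg, by omega⟩, rfl⟩
  · rw [Finset.filter_eq_empty_iff.2, Finset.sum_empty]
    intro f hf hdvd
    rw [mem_monics] at hf
    exact h (hf.2 ▸ natDegree_le_of_dvd hdvd hf.1.ne_zero)

/-- The sum over irreducible `P` of degree dividing `s` of `deg P * λ(P) ^ (s / deg P)`, where
`λ` is `charValue χ ψ`. -/
def powerSum (s : ℕ) : ℂ :=
  ∑ P ∈ irreds F s with P.natDegree ∣ s, P.natDegree * charValue χ ψ P ^ (s / P.natDegree)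

lemma powerSum_eq {n s : ℕ} (hs : 1 ≤ s) (hsn : s ≤ n) :
    powerSum χ ψ s = ∑ P ∈ irreds F n, ∑ j ∈ Finset.Icc 1 n,
      if j * P.natDegree = s then P.natDegree * charValue χ ψ P ^ j else 0 := by
  rw [powerSum]
  have hinner : ∀ P ∈ irreds F n, (∑ j ∈ Finset.Icc 1 n,
      if j * P.natDegree = s then P.natDegree * charValue χ ψ P ^ j else 0) =
      if P.natDegree ∣ s then P.natDegree * charValue χ ψ P ^ (s / P.natDegree) else 0 := by
    intro P hP
    have hpos := (mem_irreds.1 hP).2.1.natDegree_pos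
    split_ifs with h
    · obtain ⟨j, rfl⟩ := h
      rw [Nat.mul_div_cancel_left _ hpos, Finset.sum_eq_single j]
      · rw [if_pos (mul_comm _ _)]
      · intro i _ hij
        rw [if_neg]
        intro h
        rw [mul_comm] at h
        exact hij (Nat.eq_of_mul_eq_mul_left hpos h)
      · intro hj
        refine (hj (Finset.mem_Icc.2 ⟨?_, ?_⟩)).elim
        · exact Nat.pos_of_mul_pos_left hs
        · exact (Nat.le_mul_of_pos_left _ hpos).trans hsn
    · exact Finset.sum_eq_zero fun j _ => if_neg fun hj => h ⟨j, by rw [← hj, mul_comm]⟩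
  rw [Finset.sum_congr rfl hinner, ← Finset.sum_filter]
  congr 1
  ext P
  simp only [Finset.mem_filter, mem_irreds]
  exact ⟨fun ⟨⟨a, b, c⟩, d⟩ => ⟨⟨a, b, c.trans hsn⟩, d⟩,
    fun ⟨⟨a, b, _⟩, d⟩ => ⟨⟨a, b, Nat.le_of_dvd hs d⟩, d⟩⟩

lemma newton_identity (n : ℕ) :
    n * ∑ f ∈ monics F n, charValue χ ψ f =
      ∑ P ∈ irreds F n, ∑ j ∈ Finset.Icc 1 n, if j * P.natDegree ≤ n then
        P.natDegree * (charValue χ ψ P ^ j *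
          ∑ g ∈ monics F (n - j * P.natDegree), charValue χ ψ g) else 0 := by
  classical
  calc n * ∑ f ∈ monics F n, charValue χ ψ f
      = ∑ f ∈ monics F n, ∑ P ∈ irreds F n, ∑ j ∈ Finset.Icc 1 n,
          P.natDegree * if P ^ j ∣ f then charValue χ ψ f else 0 := by
        rw [Finset.mul_sum]
        refine Finset.sum_congr rfl fun f hf => ?_
        conv_lhs => rw [natDegree_eq_sum_irreds hf]
        push_cast
        simp only [Finset.sum_mul, ite_mul, zero_mul, mul_ite, mul_zero]
    _ = _ := by
        rw [Finset.sum_comm]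
        refine Finset.sum_congr rfl fun P hP => ?_
        rw [Finset.sum_comm]
        refine Finset.sum_congr rfl fun j _ => ?_
        have hPm := (mem_irreds.1 hP).1
        rw [← Finset.mul_sum, sum_monics_of_dvd χ ψ (hPm.pow j), charValue_pow χ ψ hPm,
          natDegree_pow, mul_ite, mul_zero]

lemma powerSum_one [Fintype F] : powerSum χ ψ 1 = ∑ a : F, χ a * ψ a := by
  have h := newton_identity χ ψ 1
  rw [Nat.cast_one, one_mul, sum_monics_one] at h
  rw [h, powerSum_eq χ ψ le_rfl le_rfl]
  refine Finset.sum_congr rfl fun P hP => ?_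
  have hpos := (mem_irreds.1 hP).2.1.natDegree_pos
  simp only [Finset.Icc_self, Finset.sum_singleton, one_mul]
  by_cases h1 : P.natDegree = 1
  · simp [h1, sum_monics_zero]
  · rw [if_neg h1, if_neg (by omega)]

lemma powerSum_add_two [Fintype F] (hψ : ψ ≠ 1) (n : ℕ) :
    powerSum χ ψ (n + 2) = -(∑ a : F, χ a * ψ a) * powerSum χ ψ (n + 1) := by
  have h := newton_identity χ ψ (n + 2)
  rw [sum_monics_add_two χ ψ hψ, mul_zero] at h
  suffices powerSum χ ψ (n + 2) + (∑ a : F, χ a * ψ a) * powerSum χ ψ (n + 1) = 0 by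
    linear_combination this
  rw [h, powerSum_eq χ ψ (s := n + 2) (by omega) le_rfl,
    powerSum_eq χ ψ (s := n + 1) (n := n + 2) (by omega) (by omega), Finset.mul_sum,
    ← Finset.sum_add_distrib]
  refine Finset.sum_congr rfl fun P _ => ?_
  rw [Finset.mul_sum, ← Finset.sum_add_distrib]
  refine Finset.sum_congr rfl fun j _ => ?_
  generalize j * P.natDegree = s
  rcases lt_trichotomy s (n + 1) with hs | rfl | hs
  · obtain ⟨t, ht⟩ := Nat.exists_eq_add_of_lt hs
    rw [if_neg (by omega), if_neg (by omega), if_pos (by omega),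
      show n + 2 - s = t + 2 by omega, sum_monics_add_two χ ψ hψ]
    simp
  · rw [if_neg (by omega), if_pos rfl, if_pos (by omega),
      show n + 2 - (n + 1) = 1 by omega, sum_monics_one]
    ring
  · rcases (Nat.succ_le_of_lt hs).eq_or_lt with rfl | hs
    · rw [if_pos rfl, if_neg (by omega), if_pos (by omega), Nat.succ_eq_add_one, Nat.sub_self,
        sum_monics_zero]
      ring
    · rw [if_neg (by omega), if_neg (by omega), if_neg (by omega)]
      ring

lemma neg_powerSum [Fintype F] (hψ : ψ ≠ 1) (n : ℕ) :
    -powerSum χ ψ (n + 1) = (-∑ a : F, χ a * ψ a) ^ (n + 1) := by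
  induction n with
  | zero => rw [zero_add, powerSum_one, pow_one]
  | succ n ih => rw [powerSum_add_two χ ψ hψ, pow_succ', ← ih]; ring

end Finite

section Extension

variable {F K : Type*} [Field F] [Field K] [Algebra F K] [Finite K]

lemma splits_map_of_natDegree_dvd {P : F[X]} (hP : Irreducible P)
    (h : P.natDegree ∣ Module.finrank F K) : (P.map (algebraMap F K)).Splits := by
  have : Finite F := Finite.of_injective _ (algebraMap F K).injective
  have := Fintype.ofFinite K
  have hdvd := (hP.natDegree_dvd_iff_dvd_X_pow_card_pow_sub_X).1 h
  rw [← Module.natCard_eq_pow_finrank, Nat.card_eq_fintype_card] at hdvd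
  refine (FiniteField.isSplittingField_sub K F).splits.of_dvd
    (map_ne_zero (FiniteField.X_pow_card_sub_X_ne_zero _ Fintype.one_lt_card)) ?_
  exact Polynomial.map_dvd (algebraMap F K) hdvd

lemma charValue_minpoly_pow (χ : MulChar F ℂ) (ψ : AddChar F ℂ) (x : K) :
    charValue χ ψ (minpoly F x) ^ (Module.finrank F K / (minpoly F x).natDegree) =
      χ (Algebra.norm F x) * ψ (Algebra.trace F K x) := by
  have hx : IsIntegral F x := .of_finite F x
  have hdeg : Module.finrank F K / (minpoly F x).natDegree =
      Module.finrank (IntermediateField.adjoin F {x}) K := by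
    rw [← IntermediateField.adjoin.finrank hx,
      ← Module.finrank_mul_finrank F (IntermediateField.adjoin F {x}) K,
      Nat.mul_div_cancel_left _ Module.finrank_pos]
  rw [hdeg, charValue, mul_pow, ← map_pow, ← AddChar.map_nsmul_eq_pow,
    Algebra.norm_eq_norm_adjoin, trace_eq_trace_adjoin, trace_adjoinSimpleGen hx]
  have h := Algebra.PowerBasis.norm_gen_eq_coeff_zero_minpoly
    (IntermediateField.adjoin.powerBasis hx)
  rw [IntermediateField.adjoin.powerBasis_gen, IntermediateField.minpoly_gen,
    IntermediateField.adjoin.powerBasis_dim] at h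
  rw [h]

lemma card_filter_minpoly_eq [Fintype K] [DecidableEq F[X]] {P : F[X]} (hPm : P.Monic)
    (hP : Irreducible P) (h : P.natDegree ∣ Module.finrank F K) :
    ({x : K | minpoly F x = P} : Finset K).card = P.natDegree := by
  classical
  have : Finite F := Finite.of_injective _ (algebraMap F K).injective
  rw [← card_rootSet_eq_natDegree (K := K) (PerfectField.separable_of_irreducible hP)
    (splits_map_of_natDegree_dvd hP h), ← Set.toFinset_card]
  congr 1
  ext x
  rw [Finset.mem_filter, Set.mem_toFinset, mem_rootSet]
  constructor
  · rintro ⟨-, rfl⟩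
    exact ⟨hP.ne_zero, minpoly.aeval F x⟩
  · rintro ⟨-, hx⟩
    exact ⟨Finset.mem_univ _, (minpoly.eq_of_irreducible_of_monic hP hx hPm).symm⟩

lemma sum_norm_trace_eq_powerSum [Finite F] [Fintype K] (χ : MulChar F ℂ) (ψ : AddChar F ℂ) :
    ∑ x : K, χ (Algebra.norm F x) * ψ (Algebra.trace F K x) =
      powerSum χ ψ (Module.finrank F K) := by
  classical
  rw [powerSum, ← Finset.sum_fiberwise_of_maps_to (g := minpoly F)
    (t := {P ∈ irreds F (Module.finrank F K) | P.natDegree ∣ Module.finrank F K})]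
  · refine Finset.sum_congr rfl fun P hP => ?_
    rw [Finset.mem_filter, mem_irreds] at hP
    have hsum : ∀ x ∈ ({x : K | minpoly F x = P} : Finset K),
        χ (Algebra.norm F x) * ψ (Algebra.trace F K x) =
          charValue χ ψ P ^ (Module.finrank F K / P.natDegree) := by
      intro x hx
      rw [← charValue_minpoly_pow, (Finset.mem_filter.1 hx).2]
    rw [Finset.sum_congr rfl hsum, Finset.sum_const,
      card_filter_minpoly_eq hP.1.1 hP.1.2.1 hP.2, nsmul_eq_mul]
  · intro x _
    have hx : IsIntegral F x := .of_finite F x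
    rw [Finset.mem_filter, mem_irreds]
    exact ⟨⟨minpoly.monic hx, minpoly.irreducible hx, minpoly.natDegree_le x⟩,
      minpoly.degree_dvd hx⟩

/-- The **Hasse–Davenport lifting relation**. -/
theorem neg_sum_norm_trace [Fintype F] [Fintype K] (χ : MulChar F ℂ) {ψ : AddChar F ℂ}
    (hψ : ψ ≠ 1) :
    -∑ x : K, χ (Algebra.norm F x) * ψ (Algebra.trace F K x) =
      (-∑ a : F, χ a * ψ a) ^ Module.finrank F K := by
  obtain ⟨n, hn⟩ := Nat.exists_eq_add_of_lt (Module.finrank_pos (R := F) (M := K))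
  rw [zero_add] at hn
  rw [sum_norm_trace_eq_powerSum, hn, neg_powerSum χ ψ hψ]

end Extension

end HasseDavenport

section Tau

variable {F K L : Type} [Field F] [Fintype F] [Field K] [Fintype K] [DecidableEq K]
  [Field L] [Fintype L] [DecidableEq L]

lemma tau_eq_neg_sum (γ : Kˣ →* ℂˣ) (φ : K → ℂ) :
    tau γ φ = -∑ x : K, MulChar.ofUnitHom γ⁻¹ x * φ x := by
  rw [tau, neg_inj, ← Finset.sum_subset
    (Finset.subset_univ (Finset.univ.map (⟨Units.val, Units.val_injective⟩ : Kˣ ↪ K)))]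
  · simp
  · intro x _ hx
    rw [MulChar.map_nonunit, zero_mul]
    rintro ⟨u, rfl⟩
    exact hx (Finset.mem_map_of_mem _ (Finset.mem_univ u))

lemma tau_comp_norm [Algebra F K] [Algebra F L] [Algebra K L] [IsScalarTower F K L]
    {ψ : AddChar F ℂ} (hψ : ψ ≠ 1) (γ : Kˣ →* ℂˣ) :
    tau (γ.comp (Units.map (Algebra.norm K : L →* K))) (fun x => ψ (Algebra.trace F L x)) =
      tau γ (fun x => ψ (Algebra.trace F K x)) ^ Module.finrank K L := by
  let ψK : AddChar K ℂ := ψ.compAddMonoidHom (Algebra.trace F K).toAddMonoidHom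
  have hψK : ψK ≠ 1 := by
    obtain ⟨a, ha⟩ := AddChar.ne_one_iff.1 hψ
    obtain ⟨b, rfl⟩ := Algebra.trace_surjective F K a
    exact AddChar.ne_one_iff.2 ⟨b, ha⟩
  rw [tau_eq_neg_sum γ]
  refine Eq.trans ?_ (HasseDavenport.neg_sum_norm_trace (K := L) (MulChar.ofUnitHom γ⁻¹) hψK)
  rw [tau_eq_neg_sum, neg_inj]
  refine Finset.sum_congr rfl fun x _ => ?_
  congr 1
  · by_cases hx : IsUnit x
    · obtain ⟨u, rfl⟩ := hx
      have h : Algebra.norm K (u : L) = (Units.map (Algebra.norm K : L →* K) u : Kˣ) := rfl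
      rw [h, MulChar.ofUnitHom_coe, MulChar.ofUnitHom_coe]
      simp
    · rw [MulChar.map_nonunit _ hx, MulChar.map_nonunit]
      simpa [Algebra.norm_eq_zero_iff] using hx
  · change _ = ψ (Algebra.trace F K (Algebra.trace K L x))
    rw [Algebra.trace_trace]

lemma tau_comp_pow_card [Algebra F K] (ψ : F → ℂ) (γ : Kˣ →* ℂˣ) (j : ℕ) :
    tau (γ.comp (powMonoidHom (Fintype.card F ^ j))) (fun x => ψ (Algebra.trace F K x)) =
      tau γ (fun x => ψ (Algebra.trace F K x)) := by
  let σ : Gal(K/F) := FiniteField.frobeniusAlgEquivOfAlgebraic F K ^ j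
  have hσ : ∀ x : K, σ x = x ^ Fintype.card F ^ j := fun x => by
    rw [AlgEquiv.coe_pow, FiniteField.coe_frobeniusAlgEquivOfAlgebraic_iterate]
  rw [tau, tau, neg_inj]
  conv_rhs => rw [← Equiv.sum_comp (Units.mapEquiv σ.toMulEquiv).toEquiv]
  refine Finset.sum_congr rfl fun ξ _ => ?_
  have h1 : (Units.mapEquiv σ.toMulEquiv).toEquiv ξ = ξ ^ Fintype.card F ^ j := by
    ext
    simpa using hσ ξ
  have h2 : Algebra.trace F K ((ξ : K) ^ Fintype.card F ^ j) = Algebra.trace F K ξ := by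
    rw [← hσ, Algebra.trace_eq_of_algEquiv]
  rw [h1, Units.val_pow_eq_pow_val, h2]
  rfl

end Tau

section Periodic

lemma Function.Periodic.nat_gcd {X : Type*} {T : ℕ → X} {a b : ℕ} (hb : 0 < b)
    (hTa : Function.Periodic T a) (hTb : Function.Periodic T b) :
    Function.Periodic T (a.gcd b) := by
  rcases (Nat.le_of_dvd hb (Nat.gcd_dvd_right a b)).eq_or_lt with h | h
  · rwa [h]
  obtain ⟨x, -, hx⟩ := Nat.exists_mul_mod_eq_gcd h
  intro k
  rw [← hTb.nat_mul (a * x / b) (k + a.gcd b), Nat.cast_id, add_assoc, ← hx, mul_comm _ b,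
    Nat.mod_add_div, mul_comm]
  exact hTa.nat_mul x k

variable {R : Type*} [CommMonoid R] {T : ℕ → R} {e : ℕ}

lemma Function.Periodic.prod_range_add (hT : Function.Periodic T e) (j : ℕ) :
    ∏ k ∈ Finset.range e, T (k + j) = ∏ k ∈ Finset.range e, T k := by
  induction j with
  | zero => rfl
  | succ j ih =>
    rw [← ih]
    cases e with
    | zero => rfl
    | succ e =>
      rw [Finset.prod_range_succ, Finset.prod_range_succ', zero_add]
      congr 1
      · exact Finset.prod_congr rfl fun k _ => by rw [add_right_comm, add_assoc]
      · rw [← hT j]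
        congr 1
        ring

lemma Function.Periodic.prod_range_mul (hT : Function.Periodic T e) (c : ℕ) :
    ∏ k ∈ Finset.range (c * e), T k = (∏ k ∈ Finset.range e, T k) ^ c := by
  induction c with
  | zero => simp
  | succ c ih =>
    rw [add_mul, one_mul, Finset.prod_range_add, ih, pow_succ]
    congr 1
    refine Finset.prod_congr rfl fun k _ => ?_
    rw [add_comm]
    exact hT.nat_mul c k

lemma prod_Icc_one_eq_prod_range (f : ℕ → R) (n : ℕ) :
    ∏ k ∈ Finset.Icc 1 n, f k = ∏ k ∈ Finset.range n, f (k + 1) := by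
  induction n with
  | zero => rfl
  | succ n ih => rw [Finset.prod_Icc_succ_top (by omega), ih, Finset.prod_range_succ]

end Periodic

section FiniteField

variable {F U W L : Type*} [Field F] [Field U] [Field W] [Field L]

lemma exists_algHom_eq_algebraMap_pow [Fintype F] [Finite L] [Algebra F U] [Algebra F L]
    [Algebra U L] [IsScalarTower F U L] (φ : U →ₐ[F] L) :
    ∃ j : ℕ, ∀ x, φ x = algebraMap U L x ^ Fintype.card F ^ j := by
  obtain ⟨j, hj⟩ := (FiniteField.bijective_frobeniusAlgHom_pow F L).2 (φ.liftNormal L)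
  refine ⟨j, fun x => ?_⟩
  have h := φ.liftNormal_commutes L x
  rw [← hj] at h
  simpa [AlgHom.coe_pow, FiniteField.coe_frobeniusAlgHom, pow_iterate] using h.symm

lemma units_pow_card_pow_finrank [Fintype F] [Fintype U] [Algebra F U] (x : Uˣ) :
    x ^ Fintype.card F ^ Module.finrank F U = x := by
  ext
  rw [← Module.card_eq_pow_finrank, Units.val_pow_eq_pow_val, FiniteField.pow_card]

lemma algebraMap_norm_norm_eq_pow_sum [Finite L] [Algebra U W] [Algebra W L] (x : L) :
    algebraMap W L (algebraMap U W (Algebra.norm U (Algebra.norm W x))) =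
      x ^ ∑ i ∈ Finset.range (Module.finrank U W * Module.finrank W L), Nat.card U ^ i := by
  let : Algebra U L := ((algebraMap W L).comp (algebraMap U W)).toAlgebra
  have : IsScalarTower U W L := .of_algebraMap_eq fun _ => rfl
  have : Finite W := Finite.of_injective _ (algebraMap W L).injective
  rw [Algebra.norm_norm, ← IsScalarTower.algebraMap_apply, FiniteField.algebraMap_norm_eq_pow_sum,
    Module.finrank_mul_finrank]

end FiniteField

section TwistedCharacter

variable {F D U W : Type} [Field F] [Fintype F] [Field D] [Fintype D] [Field U] [Fintype U]
  [Field W] [Fintype W] [DecidableEq W] [Algebra F D] [Algebra F U] [Algebra F W]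
  [Algebra D W] [Algebra U W]

variable (F W) in
/-- The character `(α ∘ N_{W/D}) * (β ^ (q ^ k) ∘ N_{W/U})` of `W`, where `q` is the order
of `F`. -/
abbrev twistedCharacter (α : Dˣ →* ℂˣ) (β : Uˣ →* ℂˣ) (k : ℕ) : Wˣ →* ℂˣ :=
  (α.comp (Units.map (Algebra.norm D : W →* D))) *
    ((β.comp (powMonoidHom (Fintype.card F ^ k))).comp (Units.map (Algebra.norm U : W →* U)))

lemma periodic_tau_twistedCharacter (ψ : F → ℂ) (α : Dˣ →* ℂˣ) (β : Uˣ →* ℂˣ) :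
    Function.Periodic
      (fun k => tau (twistedCharacter F W α β k) (fun x => ψ (Algebra.trace F W x)))
      ((Module.finrank F D).gcd (Module.finrank F U)) := by
  refine Function.Periodic.nat_gcd Module.finrank_pos (fun k => ?_) (fun k => ?_)
  · rw [← tau_comp_pow_card ψ (twistedCharacter F W α β k) (Module.finrank F D)]
    refine congrArg (fun γ => tau γ _) (MonoidHom.ext fun ξ => ?_)
    simp [twistedCharacter, units_pow_card_pow_finrank (F := F), ← pow_mul, ← pow_add, add_comm]
  · refine congrArg (fun γ => tau γ _) (MonoidHom.ext fun ξ => ?_)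
    simp [twistedCharacter, units_pow_card_pow_finrank (F := F), pow_add, pow_mul]

end TwistedCharacter

/-- the Hasse–Davenport-type factorization of products of Gauss sums through
the orbits of the inducing characters: here `α = α' ∘ N_{F_{q^n}/F_{q^{d'}}}` and
`β = β' ∘ N_{F_{q^m}/F_{q^{u'}}}`. `D, U, N, M, L, W` are the extensions of `F` of degrees
`d'`, `u'`, `n`, `m`, `lcm(n,m)`, `lcm(d',u')`, respectively. -/
theorem gauss_sum_product_factorization
    (F D U N M L W : Type) [Field F] [Fintype F]
    [Field D] [Fintype D] [DecidableEq D]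
    [Field U] [Fintype U] [DecidableEq U]
    [Field N] [Fintype N] [DecidableEq N]
    [Field M] [Fintype M] [DecidableEq M]
    [Field L] [Fintype L] [DecidableEq L]
    [Field W] [Fintype W] [DecidableEq W]
    [Algebra F D] [Algebra F U] [Algebra F N] [Algebra F M] [Algebra F L] [Algebra F W]
    [Algebra D N] [Algebra U M] [Algebra N L] [Algebra M L] [Algebra D W] [Algebra U W]
    [IsScalarTower F D N] [IsScalarTower F U M] [IsScalarTower F N L]
    [IsScalarTower F M L] [IsScalarTower F D W] [IsScalarTower F U W]
    (ψ : AddChar F ℂ) (hψ : ψ ≠ 1)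
    (n m d' u' : ℕ) (hn : 1 ≤ n) (hm : 1 ≤ m)
    (hd' : d' ∣ n) (hu' : u' ∣ m)
    (hD : Module.finrank F D = d') (hU : Module.finrank F U = u')
    (hN : Module.finrank F N = n) (hM : Module.finrank F M = m)
    (hL : Module.finrank F L = Nat.lcm n m) (hW : Module.finrank F W = Nat.lcm d' u')
    (α' : Dˣ →* ℂˣ) (β' : Uˣ →* ℂˣ) :
    ∏ k ∈ Finset.Icc 1 (Nat.gcd n m),
        tau (((α'.comp (Units.map (Algebra.norm D : N →* D))).comp
                (Units.map (Algebra.norm N : L →* N))) *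
              (((β'.comp (Units.map (Algebra.norm U : M →* U))).comp
                  (powMonoidHom (Fintype.card F ^ k))).comp
                (Units.map (Algebra.norm M : L →* M))))
          (fun x => ψ (Algebra.trace F L x)) =
      (∏ k ∈ Finset.Icc 1 (Nat.gcd d' u'),
          tau ((α'.comp (Units.map (Algebra.norm D : W →* D))) *
                ((β'.comp (powMonoidHom (Fintype.card F ^ k))).comp
                  (Units.map (Algebra.norm U : W →* U))))
            (fun x => ψ (Algebra.trace F W x))) ^ ((n * m) / (d' * u')) := by
  subst hD hU hN hM
  have hD0 : 0 < Module.finrank F D := Module.finrank_pos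
  have hU0 : 0 < Module.finrank F U := Module.finrank_pos
  let : Algebra D L := ((algebraMap N L).comp (algebraMap D N)).toAlgebra
  let : Algebra U L := ((algebraMap M L).comp (algebraMap U M)).toAlgebra
  have : IsScalarTower D N L := .of_algebraMap_eq fun _ => rfl
  have : IsScalarTower U M L := .of_algebraMap_eq fun _ => rfl
  have : IsScalarTower F D L := .to₁₂₄ F D N L
  have : IsScalarTower F U L := .to₁₂₄ F U M L
  have hWL : Module.finrank F W ∣ Module.finrank F L := by
    rw [hW, hL]
    exact Nat.lcm_dvd (hd'.trans (Nat.dvd_lcm_left _ _)) (hu'.trans (Nat.dvd_lcm_right _ _))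
  have hDWL : Module.finrank D W ∣ Module.finrank D L := by
    rw [← Module.finrank_mul_finrank F D W, ← Module.finrank_mul_finrank F D L] at hWL
    exact Nat.dvd_of_mul_dvd_mul_left hD0 hWL
  obtain ⟨f⟩ := FiniteField.nonempty_algHom_of_finrank_dvd hDWL
  let : Algebra W L := f.toRingHom.toAlgebra
  have : IsScalarTower D W L := .of_algebraMap_eq fun x => (f.commutes x).symm
  have : IsScalarTower F W L := .to₁₃₄ F D W L
  obtain ⟨j, hj⟩ := exists_algHom_eq_algebraMap_pow
    ((IsScalarTower.toAlgHom F W L).comp (IsScalarTower.toAlgHom F U W))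
  have hnormD (x : L) : Algebra.norm D (Algebra.norm N x) = Algebra.norm D (Algebra.norm W x) := by
    rw [Algebra.norm_norm, Algebra.norm_norm]
  have hnormU (x : L) : Algebra.norm U (Algebra.norm M x) =
      Algebra.norm U (Algebra.norm W x) ^ Fintype.card F ^ j := by
    apply (algebraMap U L).injective
    have h := algebraMap_norm_norm_eq_pow_sum (U := U) (W := W) x
    rw [map_pow, ← hj, Algebra.norm_norm, FiniteField.algebraMap_norm_eq_pow_sum]
    refine Eq.trans ?_ h.symm
    congr 3
    refine Nat.eq_of_mul_eq_mul_left hU0 ?_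
    rw [← mul_assoc, Module.finrank_mul_finrank, Module.finrank_mul_finrank,
      Module.finrank_mul_finrank]
  set T : ℕ → ℂ := fun k =>
    tau (twistedCharacter F W α' β' k) (fun x => ψ (Algebra.trace F W x))
  have hper := periodic_tau_twistedCharacter (W := W) ψ α' β'
  obtain ⟨c, hc⟩ : (Module.finrank F D).gcd (Module.finrank F U) ∣
      (Module.finrank F N).gcd (Module.finrank F M) :=
    Nat.dvd_gcd ((Nat.gcd_dvd_left _ _).trans hd') ((Nat.gcd_dvd_right _ _).trans hu')
  have hexp : Module.finrank F N * Module.finrank F M /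
      (Module.finrank F D * Module.finrank F U) = c * Module.finrank W L := by
    refine Nat.div_eq_of_eq_mul_left (Nat.mul_pos hD0 hU0) ?_
    rw [← Nat.gcd_mul_lcm (Module.finrank F N), ← Nat.gcd_mul_lcm (Module.finrank F D), hc, ← hL,
      ← hW, ← Module.finrank_mul_finrank F W L]
    ring
  have hfactor (k : ℕ) : tau _ _ = T (k + j) ^ Module.finrank W L :=
    tau_comp_norm (L := L) hψ (twistedCharacter F W α' β' (k + j))
  have hperE : Function.Periodic (fun k => T (k + 1))
      ((Module.finrank F D).gcd (Module.finrank F U)) := fun k => by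
    simpa only [add_right_comm] using hper (k + 1)
  have hperE' : Function.Periodic (fun k => T (k + 1))
      (c * (Module.finrank F D).gcd (Module.finrank F U)) := hperE.nat_mul c
  calc _ = ∏ k ∈ Finset.Icc 1 ((Module.finrank F N).gcd (Module.finrank F M)),
        T (k + j) ^ Module.finrank W L := by
        refine Finset.prod_congr rfl fun k _ => ?_
        rw [← hfactor]
        congr 1
        ext x
        have h1 : Units.map (Algebra.norm D : N →* D) (Units.map (Algebra.norm N : L →* N) x) =
            Units.map (Algebra.norm D : W →* D) (Units.map (Algebra.norm W : L →* W) x) :=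
          Units.ext (hnormD x)
        have h2 : Units.map (Algebra.norm U : M →* U) (Units.map (Algebra.norm M : L →* M) x) =
            Units.map (Algebra.norm U : W →* U) (Units.map (Algebra.norm W : L →* W) x) ^
              Fintype.card F ^ j :=
          Units.ext (hnormU x)
        simp only [MonoidHom.mul_apply, MonoidHom.comp_apply, powMonoidHom_apply, map_pow, h1, h2,
          ← pow_mul, pow_add, mul_comm]
    _ = (∏ k ∈ Finset.Icc 1 ((Module.finrank F D).gcd (Module.finrank F U)), T k) ^
        (c * Module.finrank W L) := by
        rw [Finset.prod_pow, pow_mul, prod_Icc_one_eq_prod_range, prod_Icc_one_eq_prod_range, hc,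
          mul_comm _ c, ← hperE.prod_range_mul, ← hperE'.prod_range_add j]
        simp only [add_right_comm]
    _ = _ := by rw [hexp]
end
end

section
/- Let F be a finite field with q elements, ψ a nontrivial additive character of F, n, m ≥ 1, d = gcd(n,m), l = lcm(n,m), and let α : F_{q^n}^× → ℂ^× and β : F_{q^m}^× → ℂ^× be multiplicative characters. Then Π_{k=1}^{d} τ( (α ∘ N_{F_{q^l}/F_{q^n}}) · (β^{q^{k−1}} ∘ N_{F_{q^l}/F_{q^m}}), ψ_l ) = (−1)^d · Σ_{ξ ∈ (F_{q^n} ⊗_F F_{q^m})^×} α(N_1(ξ))^{-1} · β(N_2(ξ))^{-1} · ψ(tr ξ), where the sum is over the units of the F-algebra F_{q^n} ⊗_F F_{q^m}, N_1(ξ) ∈ F_{q^n} is the determinant of multiplication by ξ viewed as an F_{q^n}-linear map (via the left tensor factor), N_2(ξ) ∈ F_{q^m} is the determinant of multiplication by ξ viewed as an F_{q^m}-linear map (via the right tensor factor), tr ξ ∈ F is the trace of multiplication by ξ as an F-linear map, and β^{q^{k−1}} denotes x ↦ β(x^{q^{k−1}}). -/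
noncomputable section

open scoped BigOperators TensorProduct

/-- The norm map from the tensor product `A ⊗[R] B` to the right tensor factor `B`: the
determinant of the multiplication map, viewed as a `B`-linear map (where `B` acts through
the right tensor factor). -/
def tensorNormRight (R A B : Type) [CommRing R] [CommRing A] [CommRing B]
    [Algebra R A] [Algebra R B] : (A ⊗[R] B) →* B :=
  letI : Algebra B (A ⊗[R] B) := Algebra.TensorProduct.rightAlgebra
  Algebra.norm B

theorem AddChar.map_sum_eq_prod {A M ι : Type*} [AddCommMonoid A] [CommMonoid M]
    (ψ : AddChar A M) (s : Finset ι) (f : ι → A) : ψ (∑ i ∈ s, f i) = ∏ i ∈ s, ψ (f i) :=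
  map_prod ψ.toMonoidHom (fun i => Multiplicative.ofAdd (f i)) s

theorem Algebra.norm_pi_apply {R S ι : Type*} [CommRing R] [CommRing S] [Algebra R S]
    [Module.Free R S] [Module.Finite R S] [Fintype ι] (x : ι → S) :
    Algebra.norm R x = ∏ i, Algebra.norm R (x i) := by
  simp only [Algebra.norm_apply]
  rw [← LinearMap.det_pi]
  rfl

theorem Algebra.trace_pi_apply {R S ι : Type*} [CommRing R] [CommRing S] [Algebra R S]
    [Module.Free R S] [Module.Finite R S] [Fintype ι] (x : ι → S) :
    Algebra.trace R (ι → S) x = ∑ i, Algebra.trace R S (x i) := by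
  classical
  have h : Algebra.lmul R (ι → S) x = ∑ i, LinearMap.single R (fun _ : ι => S) i ∘ₗ
      (Algebra.lmul R S (x i) ∘ₗ LinearMap.proj i) := by
    ext i y j
    by_cases hij : j = i
    · subst hij
      simp [Finset.sum_apply, Pi.single_apply]
    · simp [Finset.sum_apply, Pi.single_apply, hij]
  rw [Algebra.trace_apply, h, map_sum]
  refine Finset.sum_congr rfl fun i _ => ?_
  rw [LinearMap.trace_comp_comm', LinearMap.comp_assoc, LinearMap.proj_comp_single_same,
    LinearMap.comp_id, ← Algebra.trace_apply]

section TensorProductDecomposition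

theorem frobenius_pow_apply {F Kl : Type} [Field F] [Fintype F] [Field Kl] [Fintype Kl]
    [Algebra F Kl] (j : ℕ) (x : Kl) :
    (FiniteField.frobeniusAlgEquivOfAlgebraic F Kl ^ j : Gal(Kl/F)) x = x ^ Fintype.card F ^ j := by
  rw [AlgEquiv.coe_pow, FiniteField.coe_frobeniusAlgEquivOfAlgebraic_iterate]

theorem frobenius_zpow_algebraMap {F K Kl : Type} [Field F] [Fintype F] [Field K] [Fintype K]
    [Field Kl] [Fintype Kl] [Algebra F K] [Algebra F Kl] [Algebra K Kl] (t : ℤ) (a : K) :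
    (FiniteField.frobeniusAlgEquivOfAlgebraic F Kl ^ ((Module.finrank F K : ℤ) * t) : Gal(Kl/F))
      (algebraMap K Kl a) = algebraMap K Kl a := by
  have h : FiniteField.frobeniusAlgEquivOfAlgebraic F Kl ^ Module.finrank F K ∈
      MulAction.stabilizer Gal(Kl/F) (algebraMap K Kl a) := by
    rw [MulAction.mem_stabilizer_iff, AlgEquiv.smul_def, frobenius_pow_apply, ← map_pow,
      ← Module.card_eq_pow_finrank, FiniteField.pow_card]
  rw [zpow_mul, zpow_natCast]
  exact zpow_mem h t

variable (F Kn Km Kl : Type) [Field F] [Fintype F] [Field Kn] [Field Km] [Field Kl] [Fintype Kl]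
  [Algebra F Kn] [Algebra F Km] [Algebra F Kl] [Algebra Kn Kl] [Algebra Km Kl]
  [IsScalarTower F Kn Kl] [IsScalarTower F Km Kl]

/-- The algebra map `a ⊗ b ↦ a · Frob ^ j b` from the tensor product to a common extension. -/
def frobTwist (j : ℤ) : (Kn ⊗[F] Km) →ₐ[F] Kl :=
  Algebra.TensorProduct.productMap (IsScalarTower.toAlgHom F Kn Kl)
    (((FiniteField.frobeniusAlgEquivOfAlgebraic F Kl ^ j : Gal(Kl/F)) : Kl →ₐ[F] Kl).comp
      (IsScalarTower.toAlgHom F Km Kl))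

variable {F Kn Km Kl}

theorem frobTwist_tmul (j : ℤ) (a : Kn) (b : Km) :
    frobTwist F Kn Km Kl j (a ⊗ₜ b) = algebraMap Kn Kl a *
      (FiniteField.frobeniusAlgEquivOfAlgebraic F Kl ^ j : Gal(Kl/F)) (algebraMap Km Kl b) := by
  simp [frobTwist]

theorem norm_left_eq_prod {d : ℕ} (e : (Kn ⊗[F] Km) ≃ₐ[F] (Fin d → Kl))
    (he : ∀ x k, e x k = frobTwist F Kn Km Kl (-((k : ℕ) : ℤ)) x) (x : Kn ⊗[F] Km) :
    Algebra.norm Kn x = ∏ k, Algebra.norm Kn (e x k) := by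
  let e' : (Kn ⊗[F] Km) ≃ₐ[Kn] (Fin d → Kl) :=
    AlgEquiv.ofRingEquiv (f := e.toRingEquiv) fun a => by
      funext k
      simp [he, Algebra.TensorProduct.algebraMap_apply, frobTwist_tmul]
  rw [← Algebra.norm_pi_apply, ← Algebra.norm_eq_of_algEquiv e']
  rfl

theorem tensorNormRight_eq_prod {d : ℕ} (e : (Kn ⊗[F] Km) ≃ₐ[F] (Fin d → Kl))
    (he : ∀ x k, e x k = frobTwist F Kn Km Kl (-((k : ℕ) : ℤ)) x) (x : Kn ⊗[F] Km) :
    tensorNormRight F Kn Km x =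
      ∏ k : Fin d, Algebra.norm Km (e x k) ^ Fintype.card F ^ (k : ℕ) := by
  let _ : Algebra Km (Kn ⊗[F] Km) := Algebra.TensorProduct.rightAlgebra
  let u : (Fin d → Kl) ≃ₐ[F] (Fin d → Kl) := AlgEquiv.piCongrRight fun k =>
    (FiniteField.frobeniusAlgEquivOfAlgebraic F Kl ^ (k : ℕ) : Gal(Kl/F))
  let e' : (Kn ⊗[F] Km) ≃ₐ[Km] (Fin d → Kl) :=
    AlgEquiv.ofRingEquiv (f := (e.trans u).toRingEquiv) fun b => by
      funext k
      change (FiniteField.frobeniusAlgEquivOfAlgebraic F Kl ^ (k : ℕ) : Gal(Kl/F))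
        (e (1 ⊗ₜ b) k) = algebraMap Km Kl b
      rw [he, frobTwist_tmul, map_one, one_mul, ← AlgEquiv.mul_apply, ← zpow_natCast,
        ← zpow_add, add_neg_cancel, zpow_zero, AlgEquiv.one_apply]
  change Algebra.norm Km x = _
  rw [← Algebra.norm_eq_of_algEquiv e', Algebra.norm_pi_apply]
  refine Finset.prod_congr rfl fun k _ => ?_
  rw [← map_pow, ← frobenius_pow_apply]
  rfl

variable [Fintype Km]

theorem sum_frobTwist_eq (x : Kn ⊗[F] Km) :
    ∑ j ∈ Finset.range (Module.finrank F Km), frobTwist F Kn Km Kl j x =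
      algebraMap Kn Kl (TensorProduct.rid F Kn ((Algebra.trace F Km).lTensor Kn x)) := by
  induction x with
  | zero => simp
  | add x y hx hy => simp [Finset.sum_add_distrib, hx, hy]
  | tmul a b =>
    have h : (∑ j ∈ Finset.range (Module.finrank F Km), b ^ Fintype.card F ^ j) =
        algebraMap F Km (Algebra.trace F Km b) := by
      rw [FiniteField.algebraMap_trace_eq_sum_pow, Nat.card_eq_fintype_card]
    simp only [frobTwist_tmul, zpow_natCast, frobenius_pow_apply, ← Finset.mul_sum, ← map_pow,
      ← map_sum, h]
    simp [Algebra.smul_def, mul_comm, ← IsScalarTower.algebraMap_apply]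

theorem eq_zero_of_forall_frobTwist_eq_zero {x : Kn ⊗[F] Km}
    (hx : ∀ j : ℤ, frobTwist F Kn Km Kl j x = 0) : x = 0 := by
  classical
  let b := Module.finBasis F Km
  have htr (y : Kn ⊗[F] Km) :
      TensorProduct.rid F Kn ((Algebra.trace F Km).lTensor Kn (x * y)) = 0 := by
    apply (algebraMap Kn Kl).injective
    rw [← sum_frobTwist_eq]
    simp [hx]
  let B := Algebra.TensorProduct.basis Kn b
  refine B.ext_elem_iff.mpr fun i => ?_
  have h := htr (1 ⊗ₜ b.traceDual i)
  rw [← B.sum_repr x, Finset.sum_mul, map_sum, map_sum] at h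
  simpa [B, Algebra.TensorProduct.basis_apply, TensorProduct.smul_tmul',
    Algebra.TensorProduct.tmul_mul_tmul, Module.Basis.trace_mul_traceDual] using h

variable [Fintype Kn]

theorem frobTwist_add_finrank_mul (s t j : ℤ) (x : Kn ⊗[F] Km) :
    frobTwist F Kn Km Kl (Module.finrank F Kn * s + j + Module.finrank F Km * t) x =
      (FiniteField.frobeniusAlgEquivOfAlgebraic F Kl ^ ((Module.finrank F Kn : ℤ) * s) : Gal(Kl/F))
        (frobTwist F Kn Km Kl j x) := by
  induction x with
  | zero => simp
  | add x y hx hy => simp [hx, hy]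
  | tmul a b =>
    rw [frobTwist_tmul, frobTwist_tmul, map_mul, frobenius_zpow_algebraMap, zpow_add, zpow_add,
      AlgEquiv.mul_apply, AlgEquiv.mul_apply, frobenius_zpow_algebraMap]

theorem frobTwist_eq_zero_of_forall_lt_gcd {x : Kn ⊗[F] Km}
    (hx : ∀ k < Nat.gcd (Module.finrank F Kn) (Module.finrank F Km),
      frobTwist F Kn Km Kl (-(k : ℤ)) x = 0) (j : ℤ) :
    frobTwist F Kn Km Kl j x = 0 := by
  set n := Module.finrank F Kn with hn
  set m := Module.finrank F Km with hm
  have hd : 0 < Nat.gcd n m := Nat.gcd_pos_of_pos_left _ Module.finrank_pos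
  have hd' : (0 : ℤ) < Nat.gcd n m := by exact_mod_cast hd
  obtain ⟨k, hk⟩ := Int.eq_ofNat_of_zero_le (Int.emod_nonneg (-j) hd'.ne')
  have hlt := Int.emod_lt_of_pos (-j) hd'
  have hdiv := Int.mul_ediv_add_emod (-j) (Nat.gcd n m)
  have key := frobTwist_add_finrank_mul (Kl := Kl) (-(Nat.gcdA n m * (-j / Nat.gcd n m)))
    (-(Nat.gcdB n m * (-j / Nat.gcd n m))) (-(k : ℤ)) x
  rw [hx k (by omega), map_zero] at key
  rw [← key]
  refine congrArg (fun i => frobTwist F Kn Km Kl i x) ?_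
  have hb := Nat.gcd_eq_gcd_ab n m
  rw [hk] at hdiv
  rw [← hn, ← hm]
  linear_combination hdiv - (-j / (Nat.gcd n m : ℤ)) * hb

/-- The decomposition of the tensor product of two finite fields as a product of copies of
their compositum; the `k`-th component is twisted by the `k`-th power of the inverse Frobenius. -/
theorem exists_tensorProduct_algEquiv_pi
    (hKl : Module.finrank F Kl = Nat.lcm (Module.finrank F Kn) (Module.finrank F Km)) :
    ∃ e : (Kn ⊗[F] Km) ≃ₐ[F]
        (Fin (Nat.gcd (Module.finrank F Kn) (Module.finrank F Km)) → Kl),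
      ∀ x k, e x k = frobTwist F Kn Km Kl (-((k : ℕ) : ℤ)) x := by
  let φ : (Kn ⊗[F] Km) →ₐ[F]
      (Fin (Nat.gcd (Module.finrank F Kn) (Module.finrank F Km)) → Kl) :=
    AlgHom.pi fun k => frobTwist F Kn Km Kl (-((k : ℕ) : ℤ))
  have hinj : Function.Injective φ.toLinearMap := by
    rw [← LinearMap.ker_eq_bot, LinearMap.ker_eq_bot']
    intro x hx
    exact eq_zero_of_forall_frobTwist_eq_zero (frobTwist_eq_zero_of_forall_lt_gcd
      fun k hk => congrFun hx ⟨k, hk⟩)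
  have hfin : Module.finrank F (Kn ⊗[F] Km) = Module.finrank F
      (Fin (Nat.gcd (Module.finrank F Kn) (Module.finrank F Km)) → Kl) := by
    rw [Module.finrank_tensorProduct, Module.finrank_pi_fintype]
    simp [hKl, Nat.gcd_mul_lcm]
  exact ⟨AlgEquiv.ofBijective φ
    ⟨hinj, (LinearMap.injective_iff_surjective_of_finrank_eq_finrank hfin).mp hinj⟩,
    fun _ _ => rfl⟩

end TensorProductDecomposition

set_option maxHeartbeats 1000000 in
/-- the product of Gauss sums `Π_{k=1}^{d} τ((α∘N_{l/n})·(β^{q^{k-1}}∘N_{l/m}), ψ_l)`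
equals `(-1)^d` times a character sum over the units of the étale algebra
`F_{q^n} ⊗_F F_{q^m}`. -/
theorem gauss_sum_product_as_etale_algebra_sum
    (F Kn Km Kl : Type) [Field F] [Fintype F]
    [Field Kn] [Fintype Kn] [DecidableEq Kn]
    [Field Km] [Fintype Km] [DecidableEq Km]
    [Field Kl] [Fintype Kl] [DecidableEq Kl]
    [Algebra F Kn] [Algebra F Km] [Algebra F Kl]
    [Algebra Kn Kl] [Algebra Km Kl]
    [IsScalarTower F Kn Kl] [IsScalarTower F Km Kl]
    [Fintype (Kn ⊗[F] Km)] [DecidableEq (Kn ⊗[F] Km)]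
    (ψ : AddChar F ℂ) (hψ : ψ ≠ 1)
    (n m : ℕ) (hn : 1 ≤ n) (hm : 1 ≤ m)
    (hKn : Module.finrank F Kn = n) (hKm : Module.finrank F Km = m)
    (hKl : Module.finrank F Kl = Nat.lcm n m)
    (α : Knˣ →* ℂˣ) (β : Kmˣ →* ℂˣ) :
    ∏ k ∈ Finset.Icc 1 (Nat.gcd n m),
        tau ((α.comp (Units.map (Algebra.norm Kn : Kl →* Kn))) *
              ((β.comp (powMonoidHom (Fintype.card F ^ (k - 1)))).comp
                (Units.map (Algebra.norm Km : Kl →* Km))))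
          (fun x => ψ (Algebra.trace F Kl x)) =
      (-1 : ℂ) ^ (Nat.gcd n m) *
        ∑ ξ : (Kn ⊗[F] Km)ˣ,
          ((α (Units.map (Algebra.norm Kn : (Kn ⊗[F] Km) →* Kn) ξ) : ℂ))⁻¹ *
            ((β (Units.map (tensorNormRight F Kn Km) ξ) : ℂ))⁻¹ *
            ψ (Algebra.trace F (Kn ⊗[F] Km) (ξ : Kn ⊗[F] Km)) := by
  subst hKn hKm
  obtain ⟨e, he⟩ := exists_tensorProduct_algEquiv_pi (F := F) (Kn := Kn) (Km := Km) (Kl := Kl) hKl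
  let E := (Units.mapEquiv e.toMulEquiv).trans MulEquiv.piUnits
  have hE (ξ : (Kn ⊗[F] Km)ˣ) k : ((E ξ k : Klˣ) : Kl) = e ξ k := rfl
  simp only [tau]
  rw [← Finset.Ico_succ_right_eq_Icc, Finset.prod_Ico_eq_prod_range]
  simp only [Order.succ_eq_add_one, Nat.add_sub_cancel, Nat.add_sub_cancel_left]
  rw [Finset.prod_range, Finset.prod_neg, Finset.card_univ, Fintype.card_fin,
    Finset.prod_univ_sum, Fintype.piFinset_univ]
  congr 1
  symm
  refine Fintype.sum_equiv E.toEquiv _ _ fun ξ => ?_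
  have h₁ : Units.map (Algebra.norm Kn : (Kn ⊗[F] Km) →* Kn) ξ =
      ∏ k, Units.map (Algebra.norm Kn : Kl →* Kn) (E ξ k) := by
    ext
    simp [hE, norm_left_eq_prod e he]
  have h₂ : Units.map (tensorNormRight F Kn Km) ξ =
      ∏ k : Fin _, Units.map (Algebra.norm Km : Kl →* Km) (E ξ k) ^ Fintype.card F ^ (k : ℕ) := by
    ext
    simp [hE, tensorNormRight_eq_prod e he]
  have h₃ : Algebra.trace F (Kn ⊗[F] Km) (ξ : Kn ⊗[F] Km) =
      ∑ k, Algebra.trace F Kl (E ξ k : Kl) := by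
    rw [← Algebra.trace_eq_of_algEquiv e, Algebra.trace_pi_apply]
    rfl
  rw [h₁, h₂, h₃, AddChar.map_sum_eq_prod]
  simp [Finset.prod_mul_distrib, mul_comm]
end
end

section
/- Let F be a finite field with q elements, n, m ≥ 1, d = gcd(n,m), l = lcm(n,m), and fix field extensions F ⊆ F_{q^n} ⊆ F_{q^l} and F ⊆ F_{q^m} ⊆ F_{q^l}. Then there exists an F-algebra isomorphism T : F_{q^n} ⊗_F F_{q^m} → (F_{q^l})^d (the product of d copies of F_{q^l}) such that for every x in the tensor product, writing T(x) = (x_1, …, x_d): (i) the determinant of multiplication by x viewed as an F_{q^n}-linear map equals Π_{j=1}^{d} N_{F_{q^l}/F_{q^n}}(x_j); (ii) the determinant of multiplication by x viewed as an F_{q^m}-linear map equals Π_{j=1}^{d} N_{F_{q^l}/F_{q^m}}(x_j)^{q^{j−1}}; (iii) the trace of multiplication by x as an F-linear map equals Σ_{j=1}^{d} Tr_{F_{q^l}/F}(x_j). -/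
noncomputable section

open scoped BigOperators TensorProduct

open Module (finrank)

section Pi

variable {ι : Type*} [Fintype ι] {K A L : Type*} [Field K] [CommRing A] [Algebra K A]
  [Field L] [Algebra K L] [FiniteDimensional K L]

/-- The norm of an element of a product of copies of `L` is the product of the norms of its
coordinates. -/
theorem Algebra.norm_pi_const (y : ι → L) : Algebra.norm K y = ∏ i, Algebra.norm K (y i) := by
  simp only [Algebra.norm_apply]
  rw [← LinearMap.det_pi]
  rfl

/-- The trace of an element of a product of copies of `L` is the sum of the traces of its
coordinates. -/
theorem Algebra.trace_pi_const (y : ι → L) :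
    Algebra.trace K (ι → L) y = ∑ i, Algebra.trace K L (y i) := by
  classical
  have h : LinearMap.mul K (ι → L) y =
      ∑ i, LinearMap.single K (fun _ : ι => L) i ∘ₗ
        (LinearMap.mul K L (y i) ∘ₗ LinearMap.proj i) := by
    ext i a j
    simp [Finset.sum_apply, Pi.single_apply]
  rw [Algebra.trace_apply]
  change LinearMap.trace K _ (LinearMap.mul K (ι → L) y) = _
  rw [h, map_sum]
  refine Finset.sum_congr rfl fun i _ => ?_
  rw [LinearMap.trace_comp_comm', LinearMap.comp_assoc, LinearMap.proj_comp_single_same,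
    LinearMap.comp_id]
  rfl

/-- If a finite family of algebra homomorphisms `A → L` is jointly bijective, then the norm of `A`
is the product of the norms of the images. -/
theorem Algebra.norm_eq_prod_norm_of_bijective (φ : ι → A →ₐ[K] L)
    (hφ : Function.Bijective fun x i => φ i x) (x : A) :
    Algebra.norm K x = ∏ i, Algebra.norm K (φ i x) := by
  rw [← Algebra.norm_eq_of_algEquiv (AlgEquiv.ofBijective (AlgHom.pi φ) hφ),
    Algebra.norm_pi_const]
  rfl

end Pi

/-- Surjective algebra homomorphisms onto a field with pairwise distinct kernels are jointly
surjective. -/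
theorem AlgHom.pi_surjective_of_ker_ne {ι K A L : Type*} [_root_.Finite ι] [Field K] [CommRing A]
    [Algebra K A] [Field L] [Algebra K L] (φ : ι → A →ₐ[K] L)
    (hφ : ∀ i, Function.Surjective (φ i))
    (hker : Pairwise fun i j => RingHom.ker (φ i) ≠ RingHom.ker (φ j)) :
    Function.Surjective fun x i => φ i x := by
  intro y
  choose a ha using fun i => hφ i (y i)
  have hmax (i) : (RingHom.ker (φ i)).IsMaximal := RingHom.ker_isMaximal_of_surjective _ (hφ i)
  obtain ⟨r, hr⟩ := Ideal.exists_forall_sub_mem_ideal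
    (I := fun i => RingHom.ker (φ i))
    (fun i j hij => Ideal.isCoprime_of_isMaximal (hker hij)) a
  refine ⟨r, funext fun i => ?_⟩
  have := hr i
  rw [RingHom.mem_ker, map_sub, sub_eq_zero] at this
  exact this.trans (ha i)

/-- Surjective algebra homomorphisms with the same kernel differ by an automorphism of the
target. -/
theorem AlgHom.exists_algEquiv_of_ker_eq {K A L : Type*} [CommRing K] [CommRing A]
    [Algebra K A] [CommRing L] [Algebra K L] {f g : A →ₐ[K] L} (hf : Function.Surjective f)
    (hg : Function.Surjective g) (h : RingHom.ker f = RingHom.ker g) :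
    ∃ τ : L ≃ₐ[K] L, ∀ x, τ (f x) = g x := by
  refine ⟨((Ideal.quotientKerAlgEquivOfSurjective hf).symm.trans
    (Ideal.quotientEquivAlgOfEq K h)).trans (Ideal.quotientKerAlgEquivOfSurjective hg),
    fun x => ?_⟩
  have : (Ideal.quotientKerAlgEquivOfSurjective hf).symm (f x) = Ideal.Quotient.mk _ x := by
    rw [AlgEquiv.symm_apply_eq]
    rfl
  simp only [AlgEquiv.trans_apply, this]
  rfl

section TwistedMul

open FiniteField

variable {F Kn Km Kl : Type} [Field F] [Fintype F] [Field Kn] [Field Km]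
  [Field Kl] [Finite Kl] [Algebra F Kn] [Algebra F Km] [Algebra F Kl] [Algebra Kn Kl]
  [Algebra Km Kl] [IsScalarTower F Kn Kl] [IsScalarTower F Km Kl]

/-- A power of Frobenius which agrees with another one on the subfield `K` of `L` agrees with it
modulo the degree of `K`. -/
theorem modEq_finrank_of_pow_card_pow_eq {F K L : Type*} [Field F] [Fintype F] [Field K] [Finite K]
    [Field L] [Algebra F K] [Algebra K L] {i j : ℕ}
    (h : ∀ a : K, algebraMap K L a ^ Fintype.card F ^ i = algebraMap K L a ^ Fintype.card F ^ j) :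
    i ≡ j [MOD finrank F K] := by
  rw [← orderOf_frobeniusAlgEquivOfAlgebraic F K, ← pow_eq_pow_iff_modEq]
  ext a
  apply (algebraMap K L).injective
  simpa [AlgEquiv.coe_pow, coe_frobeniusAlgEquivOfAlgebraic_iterate] using h a

variable (F Kn Km Kl) in
/-- The `Kn`-algebra homomorphism `a ⊗ b ↦ a * σ⁻ʲ b`, where `σ` is the Frobenius of `Kl`
over `F`. -/
def twistedMul (j : ℕ) : Kn ⊗[F] Km →ₐ[Kn] Kl :=
  Algebra.TensorProduct.lift (Algebra.ofId Kn Kl)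
    (((frobeniusAlgEquivOfAlgebraic F Kl ^ j).symm : Kl →ₐ[F] Kl).comp
      (IsScalarTower.toAlgHom F Km Kl)) fun _ _ => Commute.all _ _

theorem twistedMul_tmul (j : ℕ) (a : Kn) (b : Km) :
    twistedMul F Kn Km Kl j (a ⊗ₜ b) =
      algebraMap Kn Kl a * (frobeniusAlgEquivOfAlgebraic F Kl ^ j).symm (algebraMap Km Kl b) :=
  rfl

theorem frobenius_pow_apply_s11 (j : ℕ) (x : Kl) :
    (frobeniusAlgEquivOfAlgebraic F Kl ^ j) x = x ^ Fintype.card F ^ j := by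
  rw [AlgEquiv.coe_pow, coe_frobeniusAlgEquivOfAlgebraic_iterate]

theorem twistedMul_one_tmul_pow (j : ℕ) (b : Km) :
    twistedMul F Kn Km Kl j (1 ⊗ₜ b) ^ Fintype.card F ^ j = algebraMap Km Kl b := by
  rw [twistedMul_tmul, map_one, one_mul, ← frobenius_pow_apply_s11, AlgEquiv.apply_symm_apply]

theorem twistedMul_surjective
    (hKl : finrank F Kl = Nat.lcm (finrank F Kn) (finrank F Km)) (j : ℕ) :
    Function.Surjective (twistedMul F Kn Km Kl j) := by
  let f : Kn ⊗[F] Km →ₐ[F] Kl := (twistedMul F Kn Km Kl j).restrictScalars F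
  let E : IntermediateField F Kl := f.range.toIntermediateField'
    (Finite.isField_of_domain f.range)
  have hn : finrank F Kn ∣ finrank F E := by
    let g : Kn →ₐ[F] Kl := f.comp Algebra.TensorProduct.includeLeft
    rw [(AlgEquiv.ofInjectiveField g).toLinearEquiv.finrank_eq]
    refine IntermediateField.finrank_dvd_of_le_right (F := g.fieldRange) (E := E) ?_
    rintro _ ⟨a, rfl⟩
    exact ⟨_, rfl⟩
  have hm : finrank F Km ∣ finrank F E := by
    let g : Km →ₐ[F] Kl := f.comp Algebra.TensorProduct.includeRight
    rw [(AlgEquiv.ofInjectiveField g).toLinearEquiv.finrank_eq]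
    refine IntermediateField.finrank_dvd_of_le_right (F := g.fieldRange) (E := E) ?_
    rintro _ ⟨a, rfl⟩
    exact ⟨_, rfl⟩
  have hE : E = ⊤ := IntermediateField.eq_of_le_of_finrank_le le_top <| by
    rw [IntermediateField.finrank_top', hKl]
    exact Nat.le_of_dvd Module.finrank_pos (Nat.lcm_dvd hn hm)
  intro y
  have : y ∈ E := hE ▸ IntermediateField.mem_top
  exact this

theorem modEq_gcd_of_ker_twistedMul_eq [Finite Kn] [Finite Km]
    (hKl : finrank F Kl = Nat.lcm (finrank F Kn) (finrank F Km)) {i j : ℕ}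
    (h : RingHom.ker (twistedMul F Kn Km Kl i) = RingHom.ker (twistedMul F Kn Km Kl j)) :
    i ≡ j [MOD Nat.gcd (finrank F Kn) (finrank F Km)] := by
  obtain ⟨τ, hτ⟩ := AlgHom.exists_algEquiv_of_ker_eq
    (twistedMul_surjective hKl i) (twistedMul_surjective hKl j) h
  obtain ⟨k, hk⟩ := (bijective_frobeniusAlgEquivOfAlgebraic_pow F Kl).2 (τ.restrictScalars F)
  have hτk (x : Kl) : τ x = x ^ Fintype.card F ^ (k : ℕ) := by
    rw [← frobenius_pow_apply_s11]
    exact (DFunLike.congr_fun hk x).symm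
  have hn : (k : ℕ) ≡ 0 [MOD finrank F Kn] :=
    modEq_finrank_of_pow_card_pow_eq (L := Kl) fun a => by
      rw [← hτk, τ.commutes, pow_zero, pow_one]
  have hm : i ≡ k + j [MOD finrank F Km] :=
    modEq_finrank_of_pow_card_pow_eq (L := Kl) fun b => by
      have hb := hτ (1 ⊗ₜ b)
      rw [hτk] at hb
      have hi := twistedMul_one_tmul_pow (F := F) (Kn := Kn) (Kl := Kl) i b
      have hj := twistedMul_one_tmul_pow (F := F) (Kn := Kn) (Kl := Kl) j b
      rw [← hb] at hj
      conv_lhs => rw [← hj]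
      conv_rhs => rw [← hi]
      simp only [← pow_mul, ← pow_add]
      congr 2
      ring
  simpa using (hm.of_dvd (Nat.gcd_dvd_right _ _)).trans
    ((hn.of_dvd (Nat.gcd_dvd_left _ _)).add_right j)

theorem twistedMul_jointly_bijective [Finite Kn] [Finite Km]
    (hKl : finrank F Kl = Nat.lcm (finrank F Kn) (finrank F Km)) :
    Function.Bijective fun x (j : Fin (Nat.gcd (finrank F Kn) (finrank F Km))) =>
      twistedMul F Kn Km Kl j x := by
  have hsurj : Function.Surjective fun x (j : Fin (Nat.gcd (finrank F Kn) (finrank F Km))) =>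
      twistedMul F Kn Km Kl j x := by
    refine AlgHom.pi_surjective_of_ker_ne _ (fun j => twistedMul_surjective hKl j) ?_
    intro i j hij h
    exact hij (Fin.ext ((modEq_gcd_of_ker_twistedMul_eq hKl h).eq_of_lt_of_lt i.2 j.2))
  let T : Kn ⊗[F] Km →ₗ[F] (Fin (Nat.gcd (finrank F Kn) (finrank F Km)) → Kl) :=
    LinearMap.pi fun j => ((twistedMul F Kn Km Kl j).restrictScalars F).toLinearMap
  have hdim : finrank F (Kn ⊗[F] Km) =
      finrank F (Fin (Nat.gcd (finrank F Kn) (finrank F Km)) → Kl) := by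
    rw [Module.finrank_tensorProduct, Module.finrank_pi_fintype, Finset.sum_const, Finset.card_univ,
      Fintype.card_fin, hKl, smul_eq_mul, Nat.gcd_mul_lcm]
  exact ⟨(LinearMap.injective_iff_surjective_of_finrank_eq_finrank hdim (f := T)).2 hsurj, hsurj⟩

theorem tensorNormRight_eq_prod_s11 [Finite Kn] [Finite Km]
    (hKl : finrank F Kl = Nat.lcm (finrank F Kn) (finrank F Km)) (x : Kn ⊗[F] Km) :
    tensorNormRight F Kn Km x =
      ∏ j : Fin (Nat.gcd (finrank F Kn) (finrank F Km)),
        Algebra.norm Km (twistedMul F Kn Km Kl j x) ^ Fintype.card F ^ (j : ℕ) := by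
  let _ : Algebra Km (Kn ⊗[F] Km) := Algebra.TensorProduct.rightAlgebra
  let φ (j : Fin (Nat.gcd (finrank F Kn) (finrank F Km))) : Kn ⊗[F] Km →ₐ[Km] Kl :=
    { ((frobeniusAlgEquivOfAlgebraic F Kl ^ (j : ℕ) : Kl ≃ₐ[F] Kl) : Kl →+* Kl).comp
        (twistedMul F Kn Km Kl j : Kn ⊗[F] Km →+* Kl) with
      commutes' := fun b =>
        (frobenius_pow_apply_s11 _ _).trans (twistedMul_one_tmul_pow _ _) }
  have hφ (j x) : φ j x = twistedMul F Kn Km Kl j x ^ Fintype.card F ^ (j : ℕ) :=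
    frobenius_pow_apply_s11 _ _
  have hbij : Function.Bijective fun x j => φ j x :=
    (Equiv.piCongrRight fun j : Fin (Nat.gcd (finrank F Kn) (finrank F Km)) =>
      (frobeniusAlgEquivOfAlgebraic F Kl ^ (j : ℕ)).toEquiv).bijective.comp
      (twistedMul_jointly_bijective hKl)
  refine (Algebra.norm_eq_prod_norm_of_bijective φ hbij x).trans ?_
  simp only [hφ, map_pow]

end TwistedMul

/-- the tensor product `F_{q^n} ⊗_F F_{q^m}` is isomorphic, as an `F`-algebra,
to a product of `d = gcd(n,m)` copies of `F_{q^l}` (`l = lcm(n,m)`), in such a way that the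
two norms and the trace are given by the stated formulas. -/
theorem tensor_product_of_finite_fields
    (F Kn Km Kl : Type) [Field F] [Fintype F]
    [Field Kn] [Fintype Kn] [Field Km] [Fintype Km] [Field Kl] [Fintype Kl]
    [Algebra F Kn] [Algebra F Km] [Algebra F Kl]
    [Algebra Kn Kl] [Algebra Km Kl]
    [IsScalarTower F Kn Kl] [IsScalarTower F Km Kl]
    (n m : ℕ) (hn : 1 ≤ n) (hm : 1 ≤ m)
    (hKn : Module.finrank F Kn = n) (hKm : Module.finrank F Km = m)
    (hKl : Module.finrank F Kl = Nat.lcm n m) :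
    ∃ T : (Kn ⊗[F] Km) ≃ₐ[F] (Fin (Nat.gcd n m) → Kl),
      ∀ x : Kn ⊗[F] Km,
        (Algebra.norm Kn x = ∏ j : Fin (Nat.gcd n m), Algebra.norm Kn (T x j)) ∧
        (tensorNormRight F Kn Km x =
          ∏ j : Fin (Nat.gcd n m), (Algebra.norm Km (T x j)) ^ (Fintype.card F ^ (j : ℕ))) ∧
        (Algebra.trace F (Kn ⊗[F] Km) x =
          ∑ j : Fin (Nat.gcd n m), Algebra.trace F Kl (T x j)) := by
  subst hKn hKm
  have hbij := twistedMul_jointly_bijective (F := F) (Kn := Kn) (Km := Km) (Kl := Kl) hKl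
  let T := AlgEquiv.ofBijective
    (AlgHom.pi fun j : Fin (Nat.gcd (finrank F Kn) (finrank F Km)) => twistedMul F Kn Km Kl j) hbij
  refine ⟨T.restrictScalars F, fun x =>
    ⟨Algebra.norm_eq_prod_norm_of_bijective _ hbij x, tensorNormRight_eq_prod_s11 hKl x, ?_⟩⟩
  rw [← Algebra.trace_eq_of_algEquiv (T.restrictScalars F), Algebra.trace_pi_const]
end
end

section
/- Let F be a finite field with q elements, ψ a nontrivial additive character of F, k ≥ 1, and let n_1, …, n_r ≥ 1 with n = n_1 + ⋯ + n_r, with multiplicative characters α_j : F_{q^{n_j}}^× → ℂ^×. For each j set d_j = gcd(n_j, k) and l_j = lcm(n_j, k), and for 1 ≤ i ≤ d_j define the multiplicative character α'_{j,i} : F_{q^{l_j}}^× → ℂ^× by α'_{j,i}(x) = α_j( N_{F_{q^{l_j}}/F_{q^{n_j}}}(x)^{q^{i−1}} ); note F_{q^{l_j}} is the extension of F_{q^k} of degree n_j/d_j. Then for every m ≥ 1 and every a ∈ F^×: Σ_{(x_{j,i})} ( Π_{j,i} α'_{j,i}( N_1(x_{j,i}) )^{-1} ) · ψ( Tr_{F_{q^k}/F}(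 Σ_{j,i} tr_{F_{q^k}}(x_{j,i}) ) ) = Σ_{(y_j)} ( Π_j α_j( N_1(y_j) )^{-1} ) · ψ( Σ_j tr(y_j) ), where the left-hand sum is over tuples of units x_{j,i} ∈ (F_{q^{l_j}} ⊗_{F_{q^k}} F_{q^{km}})^× (for 1 ≤ j ≤ r, 1 ≤ i ≤ d_j) satisfying Π_{j,i} N_2(x_{j,i}) = a in F_{q^{km}}, with N_1 and N_2 the norms of the tensor product to F_{q^{l_j}} and to F_{q^{km}} respectively (determinants of the multiplication map over the respective tensor factor) and tr_{F_{q^k}} the trace of the multiplication map as an F_{q^k}-linear map; and the right-hand sum is over tuples of units y_j ∈ (F_{q^{n_j}} ⊗_F F_{q^{km}})^× satisfying Π_j N_2(y_j) = a in F_{q^{km}}, with N_1, N_2 the norms to F_{q^{n_j}} and F_{q^{km}} and tr the trace of the multiplication map as an F-linear map. -/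
noncomputable section

open scoped BigOperators TensorProduct

namespace Algebra

theorem norm_pi {R ι κ : Type*} {T : ι → Type*} [CommRing R] [∀ i, CommRing (T i)]
    [∀ i, Algebra R (T i)] [Fintype ι] [Fintype κ] (b : ∀ i, Module.Basis κ R (T i))
    (x : ∀ i, T i) : norm R x = ∏ i, norm R (x i) := by
  classical
  let B := (Pi.basis b).reindex <| (Equiv.sigmaEquivProd _ _).trans (Equiv.prodComm _ _)
  rw [norm_eq_matrix_det B]
  simp_rw [fun i ↦ norm_eq_matrix_det (b i)]
  rw [← Matrix.det_blockDiagonal]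
  congr 1
  ext ⟨i₁, i₂⟩ ⟨j₁, j₂⟩
  simp only [leftMulMatrix_apply, LinearMap.toMatrix_apply, Matrix.blockDiagonal_apply, B,
    Module.Basis.coe_reindex, Function.comp_apply, Module.Basis.repr_reindex_apply,
    Equiv.symm_trans_apply, Equiv.prodComm_symm, Equiv.prodComm_apply,
    Equiv.sigmaEquivProd_symm_apply, Prod.swap_prod_mk, Pi.basis_apply, Pi.basis_repr,
    coe_lmul_eq_mul, LinearMap.mul_apply', Pi.mul_apply]
  split_ifs with h
  · subst h; simp
  · simp [h]

/-- Let `S` be isomorphic as a ring to a finite power of `T`, where the `i`-th component of the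
isomorphism is linear over an automorphism `g i` of the base field `R`. Then the norm of `x : S` is
the product of the norms of its components, corrected by the `g i`. -/
theorem norm_eq_prod_of_ringEquiv_pi {R S T ι : Type*} [Field R] [CommRing S] [CommRing T]
    [Algebra R S] [hT : Algebra R T] [Module.Finite R T] [Fintype ι]
    (g : ι → R ≃+* R) (e : S ≃+* (ι → T))
    (he : ∀ i r, e (algebraMap R S r) i = algebraMap R T (g i r)) (x : S) :
    norm R x = ∏ i, (g i).symm (norm R (e x i)) := by
  let tw : ι → Algebra R T := fun i ↦ ((algebraMap R T).comp (g i : R →+* R)).toAlgebra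
  have hsmul (i) (r : R) (t : T) : (tw i).smul ((g i).symm r) t = r • t :=
    ((tw i).smul_def' _ t).trans <| by
      rw [Algebra.smul_def]
      exact congrArg (fun s ↦ algebraMap R T s * t) ((g i).apply_symm_apply r)
  have hnorm (i) (t : T) : (@norm R T _ _ (tw i)) t = (g i).symm (norm R t) := by
    rw [RingEquiv.eq_symm_apply]
    exact @norm_eq_of_ringEquiv R R T _ _ _ (tw i) hT (g i) rfl t
  let e' := @AlgEquiv.ofRingEquiv R S (ι → T) _ _ _ _ (@Pi.algebra ι R (fun _ ↦ T) _ _ tw) e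
    (fun r ↦ funext fun i ↦ he i r)
  rw [← @norm_eq_of_algEquiv R S (ι → T) _ _ _ _ (@Pi.algebra ι R (fun _ ↦ T) _ _ tw) e' x]
  refine (@norm_pi R ι _ (fun _ ↦ T) _ _ tw _ _ (fun i ↦ @Module.Basis.mapCoeffs _ R T _ _ hT.toModule
    (Module.finBasis R T) R _ (tw i).toModule (g i).symm (hsmul i)) (e' x)).trans ?_
  exact Finset.prod_congr rfl fun i _ ↦ hnorm i _

theorem trace_pi {R T ι : Type*} [Field R] [CommRing T] [Algebra R T] [Module.Finite R T]
    [Fintype ι] [DecidableEq ι] (x : ι → T) :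
    trace R (ι → T) x = ∑ i, trace R T (x i) := by
  conv_lhs => rw [← Finset.univ_sum_single x, map_sum]
  refine Finset.sum_congr rfl fun i _ ↦ ?_
  have : Algebra.lmul R (ι → T) (Pi.single i (x i)) = (LinearMap.single R (fun _ ↦ T) i) ∘ₗ
      ((Algebra.lmul R T (x i)) ∘ₗ (LinearMap.proj i)) := by
    refine LinearMap.ext fun t ↦ funext fun j ↦ ?_
    by_cases h : j = i
    · subst h; simp
    · simp [h]
  rw [trace_apply, this, LinearMap.trace_comp_comm', trace_apply]
  congr 1
  ext t
  simp

end Algebra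

theorem AlgEquiv.zpow_apply_of_semiconj {F A B : Type*} [CommSemiring F] [Semiring A] [Semiring B]
    [Algebra F A] [Algebra F B] (φ : A → B) (g : A ≃ₐ[F] A) (h : B ≃ₐ[F] B)
    (hgh : ∀ x, h (φ x) = φ (g x)) (z : ℤ) (x : A) : (h ^ z) (φ x) = φ ((g ^ z) x) := by
  have nat (n : ℕ) (x : A) : (h ^ n) (φ x) = φ ((g ^ n) x) := by
    induction n generalizing x with
    | zero => simp
    | succ n ih => rw [pow_succ, pow_succ, AlgEquiv.mul_apply, hgh, ih, AlgEquiv.mul_apply]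
  cases z with
  | ofNat n => simpa using nat n x
  | negSucc n =>
    rw [zpow_negSucc, zpow_negSucc]
    refine (h ^ (n + 1)).injective ?_
    rw [nat, ← AlgEquiv.mul_apply, ← AlgEquiv.mul_apply, mul_inv_cancel, mul_inv_cancel]
    rfl

/-- Every integer is congruent modulo `n` to `k * u - i` for some `i < gcd n k`. -/
theorem Int.exists_fin_gcd_add_eq (n k : ℕ) (hn : 0 < n) (t : ℤ) :
    ∃ (i : Fin (n.gcd k)) (u w : ℤ), t = -(i : ℤ) + k * u + n * w := by
  have hd : (0 : ℤ) < n.gcd k := by exact_mod_cast Nat.gcd_pos_of_pos_left k hn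
  have h0 := Int.emod_nonneg (-t) hd.ne'
  have h1 := Int.emod_lt_of_pos (-t) hd
  refine ⟨⟨((-t) % (n.gcd k : ℤ)).toNat, by omega⟩, -(n.gcdB k * ((-t) / (n.gcd k : ℤ))),
    -(n.gcdA k * ((-t) / (n.gcd k : ℤ))), ?_⟩
  have hb := Nat.gcd_eq_gcd_ab n k
  have hdiv := Int.emod_add_mul_ediv (-t) (n.gcd k : ℤ)
  simp only [Int.toNat_of_nonneg h0]
  generalize (-t) / (n.gcd k : ℤ) = Q at *
  generalize (-t) % (n.gcd k : ℤ) = R at *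
  rw [hb] at hdiv
  linear_combination hdiv

section FiniteFields

open FiniteField Module TensorProduct

variable (F A B C D : Type) [Field F] [Field A] [Algebra F A] [Field B] [Algebra F B]
  [Field C] [Algebra F C] [Algebra A C]

theorem frobenius_zpow_algebraMap_s12 [Fintype F] [Finite A] [Finite C] (z : ℤ) (x : A) :
    (frobeniusAlgEquivOfAlgebraic F C ^ z) (algebraMap A C x) =
      algebraMap A C ((frobeniusAlgEquivOfAlgebraic F A ^ z) x) :=
  AlgEquiv.zpow_apply_of_semiconj _ _ _ (fun x ↦ by simp) z x

theorem frobenius_zpow_finrank_mul [Fintype F] [Finite A] (z : ℤ) :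
    frobeniusAlgEquivOfAlgebraic F A ^ (finrank F A * z) = 1 := by
  rw [zpow_mul, zpow_natCast, ← orderOf_frobeniusAlgEquivOfAlgebraic, pow_orderOf_eq_one, one_zpow]

variable [Algebra B C] [IsScalarTower F A C] [IsScalarTower F B C]

/-- The map `A ⊗ B → C`, `x ⊗ y ↦ g x * y`, for subextensions `A` and `B` of `C`. -/
def twistedProductMap (g : Gal(A/F)) : A ⊗[F] B →ₐ[F] C :=
  Algebra.TensorProduct.productMap ((IsScalarTower.toAlgHom F A C).comp (g : A →ₐ[F] A))
    (IsScalarTower.toAlgHom F B C)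

@[simp]
theorem twistedProductMap_tmul (g : Gal(A/F)) (x : A) (y : B) :
    twistedProductMap F A B C g (x ⊗ₜ y) = algebraMap A C (g x) * algebraMap B C y := by
  simp [twistedProductMap]

variable [Finite A]

theorem sum_twistedProductMap (t : A ⊗[F] B) : ∑ g : Gal(A/F), twistedProductMap F A B C g t =
    algebraMap B C (TensorProduct.lid F B ((Algebra.trace F A).rTensor B t)) := by
  induction t with
  | zero => simp
  | add x y hx hy => simp only [map_add, Finset.sum_add_distrib, hx, hy]
  | tmul x y =>
    simp only [twistedProductMap_tmul, ← Finset.sum_mul, ← map_sum, LinearMap.rTensor_tmul,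
      TensorProduct.lid_tmul, Algebra.smul_def, map_mul]
    rw [← trace_eq_sum_automorphisms, ← IsScalarTower.algebraMap_apply,
      ← IsScalarTower.algebraMap_apply]

theorem eq_zero_of_forall_twistedProductMap {t : A ⊗[F] B}
    (ht : ∀ g, twistedProductMap F A B C g t = 0) : t = 0 := by
  classical
  have key (f : A →ₗ[F] F) : TensorProduct.lid F B (f.rTensor B t) = 0 := by
    obtain ⟨y, rfl⟩ := ((Algebra.traceForm F A).toDual (traceForm_nondegenerate F A)).surjective f
    have h := sum_twistedProductMap F A B C ((y ⊗ₜ 1) * t)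
    simp only [map_mul, ht, mul_zero, Finset.sum_const_zero] at h
    rw [eq_comm, map_eq_zero] at h
    rw [← h]
    congr 1
    clear h ht
    induction t with
    | zero => simp
    | add x y hx hy => simp only [map_add, mul_add, hx, hy]
    | tmul x z => simp [LinearMap.BilinForm.toDual_def, Algebra.traceForm_apply]
  let b := finBasis F A
  refine (TensorProduct.equivFinsuppOfBasisLeft b).injective (Finsupp.ext fun i ↦ ?_)
  rw [TensorProduct.equivFinsuppOfBasisLeft_apply, key]
  simp

variable [Fintype F]

/-- The product of the maps `x ⊗ y ↦ σ⁻ⁱ x * y` for `i < gcd ([A : F], [B : F])`, where `σ` is the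
Frobenius automorphism. -/
def frobeniusProductMap : A ⊗[F] B →ₐ[F] (Fin ((finrank F A).gcd (finrank F B)) → C) :=
  AlgHom.pi fun i ↦ twistedProductMap F A B C (frobeniusAlgEquivOfAlgebraic F A ^ (-(i : ℤ)))

variable [Field D] [Algebra F D] [Algebra B D] [IsScalarTower F B D]

/-- The product of the maps `x ⊗ y ↦ σ⁻ⁱ x ⊗ y` for `i < gcd ([A : F], [B : F])`, where `σ` is the
Frobenius automorphism. -/
def frobeniusTensorMap :
    A ⊗[F] D →ₐ[F] (Fin ((finrank F A).gcd (finrank F B)) → C ⊗[B] D) :=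
  AlgHom.pi fun i ↦ Algebra.TensorProduct.productMap
    ((Algebra.TensorProduct.includeLeft (R := B) (S := F) (A := C) (B := D)).comp
      ((IsScalarTower.toAlgHom F A C).comp
        ((frobeniusAlgEquivOfAlgebraic F A ^ (-(i : ℤ)) : Gal(A/F)) : A →ₐ[F] A)))
    ((Algebra.TensorProduct.includeRight (R := B) (A := C) (B := D)).restrictScalars F)

@[simp]
theorem frobeniusTensorMap_tmul (x : A) (y : D) (i) : frobeniusTensorMap F A B C D (x ⊗ₜ y) i =
    algebraMap A C ((frobeniusAlgEquivOfAlgebraic F A ^ (-(i : ℤ))) x) ⊗ₜ y := by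
  simp [frobeniusTensorMap]

variable [Finite B] [Finite C]

theorem frobeniusProductMap_injective : Function.Injective (frobeniusProductMap F A B C) := by
  rw [injective_iff_map_eq_zero]
  intro t ht
  refine eq_zero_of_forall_twistedProductMap F A B C fun g ↦ ?_
  obtain ⟨s, rfl⟩ := (bijective_frobeniusAlgEquivOfAlgebraic_pow F A).2 g
  obtain ⟨i, u, w, h⟩ := Int.exists_fin_gcd_add_eq (finrank F A) (finrank F B) finrank_pos s
  have key : twistedProductMap F A B C (frobeniusAlgEquivOfAlgebraic F A ^ (s : ℕ)) =
      ((frobeniusAlgEquivOfAlgebraic F C ^ (finrank F B * u) : Gal(C/F)) : C →ₐ[F] C).comp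
        (twistedProductMap F A B C (frobeniusAlgEquivOfAlgebraic F A ^ (-(i : ℤ)))) := by
    refine Algebra.TensorProduct.ext' fun x y ↦ ?_
    have hx := frobenius_zpow_algebraMap_s12 F A C (finrank F B * u)
      ((frobeniusAlgEquivOfAlgebraic F A ^ (-(i : ℤ))) x)
    have hy := frobenius_zpow_algebraMap_s12 F B C (finrank F B * u) y
    rw [frobenius_zpow_finrank_mul, AlgEquiv.one_apply] at hy
    simp only [AlgHom.comp_apply, twistedProductMap_tmul, map_mul]
    rw [← zpow_natCast, h, zpow_add, zpow_add, frobenius_zpow_finrank_mul, mul_one,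
      (Commute.refl (frobeniusAlgEquivOfAlgebraic F A)).zpow_zpow, AlgEquiv.mul_apply]
    exact congrArg₂ (· * ·) hx.symm hy.symm
  rw [key, AlgHom.comp_apply, show twistedProductMap F A B C _ t = 0 from congrFun ht i, map_zero]

theorem frobeniusProductMap_surjective
    (hC : finrank F C = (finrank F A).lcm (finrank F B)) :
    Function.Surjective (frobeniusProductMap F A B C) := by
  refine (LinearMap.injective_iff_surjective_of_finrank_eq_finrank
    (f := (frobeniusProductMap F A B C).toLinearMap) ?_).1 (frobeniusProductMap_injective F A B C)
  rw [finrank_tensorProduct, finrank_pi_fintype]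
  simp [hC, Nat.gcd_mul_lcm]

theorem frobeniusTensorMap_surjective
    (hC : finrank F C = (finrank F A).lcm (finrank F B)) :
    Function.Surjective (frobeniusTensorMap F A B C D) := by
  classical
  have hmap (t : A ⊗[F] B) (i) : frobeniusTensorMap F A B C D
      (Algebra.TensorProduct.map (AlgHom.id F A) (IsScalarTower.toAlgHom F B D) t) i =
        frobeniusProductMap F A B C t i ⊗ₜ 1 := by
    induction t with
    | zero => simp
    | add x y hx hy => simp only [map_add, Pi.add_apply, hx, hy, TensorProduct.add_tmul]
    | tmul x y =>
      simp only [Algebra.TensorProduct.map_tmul, frobeniusTensorMap_tmul, frobeniusProductMap,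
        AlgHom.pi_apply, twistedProductMap_tmul]
      rw [mul_comm, ← Algebra.smul_def, TensorProduct.smul_tmul, Algebra.smul_def, mul_one]
      rfl
  rw [← AlgHom.coe_toRingHom, ← RingHom.range_eq_top, eq_top_iff]
  intro v _
  rw [← Finset.univ_sum_single v]
  refine sum_mem fun i _ ↦ ?_
  induction v i with
  | zero => simp
  | add x y hx hy => rw [Pi.single_add]; exact add_mem hx hy
  | tmul c y =>
    obtain ⟨t, ht⟩ := frobeniusProductMap_surjective F A B C hC (Pi.single i c)
    refine ⟨Algebra.TensorProduct.map (AlgHom.id F A) (IsScalarTower.toAlgHom F B D) t *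
      (1 ⊗ₜ y), funext fun j ↦ ?_⟩
    rw [AlgHom.coe_toRingHom, map_mul, Pi.mul_apply, hmap, ht, frobeniusTensorMap_tmul]
    by_cases h : j = i
    · subst h; simp
    · simp [h]

variable [Finite D]

instance : Finite (C ⊗[B] D) := Module.finite_of_finite B

theorem frobeniusTensorMap_bijective
    (hC : finrank F C = (finrank F A).lcm (finrank F B)) :
    Function.Bijective (frobeniusTensorMap F A B C D) := by
  refine ⟨(LinearMap.injective_iff_surjective_of_finrank_eq_finrank
    (f := (frobeniusTensorMap F A B C D).toLinearMap) ?_).2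
    (frobeniusTensorMap_surjective F A B C D hC), frobeniusTensorMap_surjective F A B C D hC⟩
  have h1 : finrank F (C ⊗[B] D) = finrank F C * finrank B D := by
    rw [← finrank_mul_finrank F B, finrank_tensorProduct, ← mul_assoc, finrank_mul_finrank]
  rw [finrank_tensorProduct, finrank_pi_fintype]
  simp only [h1, Finset.sum_const, Finset.card_univ, Fintype.card_fin, smul_eq_mul, ← mul_assoc, hC,
    Nat.gcd_mul_lcm]
  rw [mul_assoc, finrank_mul_finrank]

/-- The isomorphism `A ⊗ D ≃ ∏ i, C ⊗ D` for `C` a compositum of `A` and `B`. -/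
def frobeniusTensorEquiv (hC : finrank F C = (finrank F A).lcm (finrank F B)) :
    A ⊗[F] D ≃ₐ[F] (Fin ((finrank F A).gcd (finrank F B)) → C ⊗[B] D) :=
  AlgEquiv.ofBijective _ (frobeniusTensorMap_bijective F A B C D hC)

theorem frobeniusTensorEquiv_tmul (hC : finrank F C = (finrank F A).lcm (finrank F B))
    (x : A) (y : D) (i) : frobeniusTensorEquiv F A B C D hC (x ⊗ₜ y) i =
      algebraMap A C ((frobeniusAlgEquivOfAlgebraic F A ^ (-(i : ℤ))) x) ⊗ₜ y :=
  frobeniusTensorMap_tmul F A B C D x y i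

theorem tensorNormRight_eq_prod_frobeniusTensorEquiv
    (hC : finrank F C = (finrank F A).lcm (finrank F B)) (t : A ⊗[F] D) :
    tensorNormRight F A D t =
      ∏ i, tensorNormRight B C D (frobeniusTensorEquiv F A B C D hC t i) := by
  let : Algebra D (A ⊗[F] D) := Algebra.TensorProduct.rightAlgebra
  let : Algebra D (C ⊗[B] D) := Algebra.TensorProduct.rightAlgebra
  refine Algebra.norm_eq_prod_of_ringEquiv_pi (fun _ ↦ RingEquiv.refl D)
    (frobeniusTensorEquiv F A B C D hC).toRingEquiv (fun i r ↦ ?_) t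
  exact (frobeniusTensorEquiv_tmul F A B C D hC 1 r i).trans (by simp; rfl)

theorem trace_eq_sum_frobeniusTensorEquiv
    (hC : finrank F C = (finrank F A).lcm (finrank F B)) (t : A ⊗[F] D) :
    Algebra.trace F (A ⊗[F] D) t = Algebra.trace F B
      (∑ i, Algebra.trace B (C ⊗[B] D) (frobeniusTensorEquiv F A B C D hC t i)) := by
  rw [← Algebra.trace_eq_of_algEquiv (frobeniusTensorEquiv F A B C D hC), Algebra.trace_pi, map_sum]
  exact Finset.sum_congr rfl fun i _ ↦ (Algebra.trace_trace _).symm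

theorem norm_eq_prod_frobeniusTensorEquiv
    (hC : finrank F C = (finrank F A).lcm (finrank F B)) (t : A ⊗[F] D) :
    Algebra.norm A t = ∏ i : Fin ((finrank F A).gcd (finrank F B)),
      Algebra.norm A (Algebra.norm C (frobeniusTensorEquiv F A B C D hC t i)) ^
        (Fintype.card F ^ (i : ℕ)) := by
  rw [Algebra.norm_eq_prod_of_ringEquiv_pi (T := C ⊗[B] D)
    (fun i : Fin ((finrank F A).gcd (finrank F B)) ↦
      (frobeniusAlgEquivOfAlgebraic F A ^ (-(i : ℤ))).toRingEquiv)
    (frobeniusTensorEquiv F A B C D hC).toRingEquiv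
    (fun i r ↦ frobeniusTensorEquiv_tmul F A B C D hC r 1 i) t]
  refine Finset.prod_congr rfl fun i _ ↦ ?_
  rw [Algebra.norm_norm, RingEquiv.symm_apply_eq]
  change Algebra.norm A (frobeniusTensorEquiv F A B C D hC t i) =
    (frobeniusAlgEquivOfAlgebraic F A ^ (-(i : ℤ))) _
  have hpow (z : A) : z ^ (Fintype.card F ^ (i : ℕ)) =
      (frobeniusAlgEquivOfAlgebraic F A ^ (i : ℕ)) z := by
    rw [AlgEquiv.coe_pow, coe_frobeniusAlgEquivOfAlgebraic_iterate]
  rw [hpow, ← AlgEquiv.mul_apply, ← zpow_natCast, ← zpow_add, neg_add_cancel, zpow_zero, AlgEquiv.one_apply]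

end FiniteFields

/-- the exotic Kloosterman sum over `F_{q^k}` attached to the base-changed
character data `α'` agrees with the exotic Kloosterman sum over `F` attached to `α`:
`J_m^{F_{q^k}}(α'^{-1}, ψ_k, a) = J_{km}(α^{-1}, ψ, a)`. Here `Kk, Kn j, Kl j, Kkm` are the
extensions of `F` of degrees `k`, `n_j`, `lcm(n_j,k)`, `km` respectively, and
`α'_{j,i}(x) = α_j(N_{F_{q^{l_j}}/F_{q^{n_j}}}(x)^{q^{i-1}})`. -/
theorem base_change_exotic_kloosterman_sum
    (F : Type) [Field F] [Fintype F]
    (ψ : AddChar F ℂ) (hψ : ψ ≠ 1)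
    (k : ℕ) (hk : 1 ≤ k)
    (r : ℕ) (nn : Fin r → ℕ) (hnn : ∀ j, 1 ≤ nn j)
    (n : ℕ) (hn : n = ∑ j, nn j)
    (Kk : Type) [Field Kk] [Fintype Kk] [Algebra F Kk]
    (hKk : Module.finrank F Kk = k)
    (Kn : Fin r → Type) [∀ j, Field (Kn j)] [∀ j, Fintype (Kn j)] [∀ j, Algebra F (Kn j)]
    (hKn : ∀ j, Module.finrank F (Kn j) = nn j)
    (Kl : Fin r → Type) [∀ j, Field (Kl j)] [∀ j, Fintype (Kl j)]
    [∀ j, Algebra F (Kl j)] [∀ j, Algebra Kk (Kl j)] [∀ j, Algebra (Kn j) (Kl j)]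
    [∀ j, IsScalarTower F Kk (Kl j)] [∀ j, IsScalarTower F (Kn j) (Kl j)]
    (hKl : ∀ j, Module.finrank F (Kl j) = Nat.lcm (nn j) k)
    (m : ℕ) (hm : 1 ≤ m)
    (Kkm : Type) [Field Kkm] [Fintype Kkm] [DecidableEq Kkm]
    [Algebra F Kkm] [Algebra Kk Kkm] [IsScalarTower F Kk Kkm]
    (hKkm : Module.finrank F Kkm = k * m)
    [∀ j, Fintype ((Kl j) ⊗[Kk] Kkm)] [∀ j, DecidableEq ((Kl j) ⊗[Kk] Kkm)]
    [∀ j, Fintype ((Kn j) ⊗[F] Kkm)] [∀ j, DecidableEq ((Kn j) ⊗[F] Kkm)]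
    (α : ∀ j, (Kn j)ˣ →* ℂˣ)
    (a : Fˣ) :
    (∑ x ∈ Finset.univ.filter
        (fun x : (j : Fin r) → Fin (Nat.gcd (nn j) k) → ((Kl j) ⊗[Kk] Kkm)ˣ =>
          (∏ j, ∏ i, tensorNormRight Kk (Kl j) Kkm ((x j i : (Kl j) ⊗[Kk] Kkm))) =
            algebraMap F Kkm (a : F)),
        (∏ j, ∏ i : Fin (Nat.gcd (nn j) k),
          ((((α j).comp ((powMonoidHom (Fintype.card F ^ (i : ℕ))).comp
                (Units.map (Algebra.norm (Kn j) : Kl j →* Kn j))))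
              (Units.map (Algebra.norm (Kl j) : ((Kl j) ⊗[Kk] Kkm) →* Kl j) (x j i)) : ℂ))⁻¹) *
          ψ (Algebra.trace F Kk
            (∑ j, ∑ i : Fin (Nat.gcd (nn j) k),
              Algebra.trace Kk ((Kl j) ⊗[Kk] Kkm) ((x j i : (Kl j) ⊗[Kk] Kkm))))) =
      (∑ y ∈ Finset.univ.filter
          (fun y : (j : Fin r) → ((Kn j) ⊗[F] Kkm)ˣ =>
            (∏ j, tensorNormRight F (Kn j) Kkm ((y j : (Kn j) ⊗[F] Kkm))) =
              algebraMap F Kkm (a : F)),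
          (∏ j, (((α j)
              (Units.map (Algebra.norm (Kn j) : ((Kn j) ⊗[F] Kkm) →* Kn j) (y j)) : ℂ))⁻¹) *
            ψ (∑ j, Algebra.trace F ((Kn j) ⊗[F] Kkm) ((y j : (Kn j) ⊗[F] Kkm)))) := by
  have hC (j : Fin r) : Module.finrank F (Kl j) =
      (Module.finrank F (Kn j)).lcm (Module.finrank F Kk) := by rw [hKl, hKn, hKk]
  obtain rfl : nn = fun j ↦ Module.finrank F (Kn j) := funext fun j ↦ (hKn j).symm
  subst hKk
  let Φ (j : Fin r) := (Units.mapEquiv (frobeniusTensorEquiv F (Kn j) Kk (Kl j) Kkm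
    (hC j)).toMulEquiv).trans MulEquiv.piUnits
  have hΦ (j y i) : ((Φ j y i : ((Kl j) ⊗[Kk] Kkm)ˣ) : (Kl j) ⊗[Kk] Kkm) =
      frobeniusTensorEquiv F (Kn j) Kk (Kl j) Kkm (hC j) y i := rfl
  symm
  refine Finset.sum_equiv (Equiv.piCongrRight fun j ↦ (Φ j).toEquiv) (fun y ↦ ?_) fun y _ ↦ ?_
  · simp only [Finset.mem_filter, Finset.mem_univ, true_and, Equiv.piCongrRight_apply, Pi.map_apply,
      MulEquiv.toEquiv_eq_coe, MulEquiv.coe_toEquiv, hΦ,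
      tensorNormRight_eq_prod_frobeniusTensorEquiv F (Kn _) Kk (Kl _) Kkm (hC _)]
  · simp only [Equiv.piCongrRight_apply, Pi.map_apply,
      MulEquiv.toEquiv_eq_coe, MulEquiv.coe_toEquiv, hΦ]
    congr 1
    · refine Finset.prod_congr rfl fun j _ ↦ ?_
      rw [Finset.prod_inv_distrib, ← Units.coe_prod]
      simp only [MonoidHom.comp_apply]
      rw [← map_prod]
      congr 3
      ext
      rw [Units.coe_map, Units.coe_prod]
      exact norm_eq_prod_frobeniusTensorEquiv F (Kn j) Kk (Kl j) Kkm (hC j) (y j)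
    · congr 1
      rw [map_sum]
      exact Finset.sum_congr rfl fun j _ ↦
        trace_eq_sum_frobeniusTensorEquiv F (Kn j) Kk (Kl j) Kkm (hC j) (y j)
end
end
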